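/- Suppose κ is a weakly compact cardinal. Then a set S ⊆ κ is a weakly compact subset of κ if and only if S ∩ C ≠ ∅ for every 1-club subset C of κ. (Sun's characterization.) -/

import Mathlib

open FirstOrder FirstOrder.Language ZFSet
open scoped Classical

noncomputable section

def memLang : Language where
  Functions := fun _ => Empty
  Relations := fun n => match n with | 2 => Unit | _ => Empty

def memRel : memLang.Relations 2 := Unit.unit

def mem' (n : ℕ) (i j : Fin n) : memLang.BoundedFormula Empty n :=
  Relations.boundedFormula₂ memRel (Term.var (Sum.inr i)) (Term.var (Sum.inr j))

def eq' (n : ℕ) (i j : Fin n) : memLang.BoundedFormula Empty n :=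
  Term.bdEqual (Term.var (Sum.inr i)) (Term.var (Sum.inr j))

def extAx : memLang.Sentence :=
  ((((mem' 3 2 0).iff (mem' 3 2 1)).all.imp (eq' 2 0 1)).all).all

def pairAx : memLang.Sentence :=
  ((((mem' 3 0 2) ⊓ (mem' 3 1 2)).ex).all).all

def unionAx : memLang.Sentence :=
  (((((mem' 4 2 3) ⊓ (mem' 4 3 0)).imp (mem' 4 2 1)).all.all).ex).all

def foundAx : memLang.Sentence :=
  (((mem' 2 1 0).ex.imp
    (((mem' 2 1 0) ⊓ (((mem' 3 2 1).imp (mem' 3 2 0).not).all)).ex)).all)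


def infAx₁ : memLang.BoundedFormula Empty 1 :=
  ((mem' 2 1 0) ⊓ ((mem' 3 2 1).not.all)).ex

def infAx₂ : memLang.BoundedFormula Empty 1 :=
  ((mem' 2 1 0).imp
    (((mem' 3 2 0) ⊓ ((mem' 3 1 2) ⊓
      (((mem' 4 3 2).iff ((mem' 4 3 1) ⊔ (eq' 4 3 1))).all))).ex)).all

def infAx : memLang.Sentence := (infAx₁ ⊓ infAx₂).ex

def choiceHyp₁ : memLang.BoundedFormula Empty 1 :=
  ((mem' 2 1 0).imp ((mem' 3 2 1).ex)).all

def choiceHyp₂ : memLang.BoundedFormula Empty 1 :=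
  ((((mem' 3 1 0) ⊓ ((mem' 3 2 0) ⊓ (eq' 3 1 2).not)).imp
     (((mem' 4 3 1) ⊓ (mem' 4 3 2)).ex.not)).all).all

def choiceConcl : memLang.BoundedFormula Empty 1 :=
  (((mem' 3 2 0).imp
    (((mem' 4 3 2) ⊓ ((mem' 4 3 1) ⊓
       ((((mem' 5 4 2) ⊓ (mem' 5 4 1)).imp (eq' 5 4 3)).all))).ex)).all).ex

def choiceAx : memLang.Sentence :=
  (((choiceHyp₁ ⊓ choiceHyp₂).imp choiceConcl)).all

def sepAx (n : ℕ) (φ : memLang.BoundedFormula Empty (n + 2)) : memLang.Sentence :=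
  (((((mem' (n+3) ⟨n+2, by omega⟩ ⟨n+1, by omega⟩).iff
      ((mem' (n+3) ⟨n+2, by omega⟩ ⟨n, by omega⟩) ⊓ (φ.liftAt 1 (n+1)))).all).ex).all).alls

def collAx (n : ℕ) (φ : memLang.BoundedFormula Empty (n + 3)) : memLang.Sentence :=
  (((((mem' (n+2) ⟨n+1, by omega⟩ ⟨n, by omega⟩).imp φ.ex).all).imp
    ((((mem' (n+3) ⟨n+2, by omega⟩ ⟨n, by omega⟩).imp
        (((mem' (n+4) ⟨n+3, by omega⟩ ⟨n+1, by omega⟩) ⊓ (φ.liftAt 1 (n+1))).ex)).all).ex)).all).alls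

def ZFCminus : Set memLang.Sentence :=
  {extAx, pairAx, unionAx, foundAx, infAx, choiceAx}
    ∪ (⋃ n, Set.range (sepAx n)) ∪ (⋃ n, Set.range (collAx n))

end

noncomputable section

/-! ## Satisfaction in transitive sets -/

instance zfStr (M : ZFSet.{0}) : memLang.Structure M.toSet where
  funMap := fun {_} f _ => f.elim
  RelMap := fun {n} =>
    match n with
    | 2 => fun _ v => ((v 0 : M.toSet) : ZFSet) ∈ ((v 1 : M.toSet) : ZFSet)
    | 0 => fun r _ => r.elim
    | 1 => fun r _ => r.elim
    | (_+3) => fun r _ => r.elim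

/-- Realization of a formula in the membership structure `(M, ∈)`, with a valuation
taking values in `M`. -/
def RealizeIn (M : ZFSet.{0}) {n : ℕ} (φ : memLang.BoundedFormula Empty n)
    (v : Fin n → ZFSet.{0}) : Prop :=
  ∃ hv : ∀ i, v i ∈ M, φ.Realize (fun e => e.elim) (fun i => (⟨v i, hv i⟩ : M.toSet))

/-- `M ⊨ ZFC⁻`. -/
def ModelsZFCminus (M : ZFSet.{0}) : Prop :=
  ∀ φ ∈ ZFCminus, Sentence.Realize (↥M.toSet) φ

/-! ## Cardinals, ordinals and basic combinatorial notions -/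

/-- The cardinality of (the extension of) a ZF-set. -/
def zcard (x : ZFSet.{0}) : Cardinal := Cardinal.mk x.toSet

/-- `κ` is a (von Neumann) cardinal. -/
def IsCardinalZ (κ : ZFSet.{0}) : Prop :=
  κ.IsOrdinal ∧ ∀ β ∈ κ, zcard β < zcard κ

/-- `κ^{<κ} = κ`. -/
def PowLtEqSelf (κ : ZFSet.{0}) : Prop :=
  ∀ β ∈ κ, zcard κ ^ zcard β ≤ zcard κ

def zsucc (x : ZFSet.{0}) : ZFSet := insert x x

def natZ : ℕ → ZFSet.{0}
  | 0 => ∅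
  | n+1 => zsucc (natZ n)

def iterSucc (β : ZFSet.{0}) : ℕ → ZFSet
  | 0 => β
  | n+1 => zsucc (iterSucc β n)

def IsLimitZ (α : ZFSet.{0}) : Prop := α.IsOrdinal ∧ α ≠ ∅ ∧ ∀ β ∈ α, zsucc β ∈ α

/-- The value `f(x)` of a ZF-coded function `f` at `x`. -/
def app (f x : ZFSet.{0}) : ZFSet :=
  ⋃₀ (ZFSet.sep (fun y => ZFSet.pair x y ∈ f) (⋃₀ (⋃₀ f)))

/-- The restriction `f ↾ β` of a ZF-coded function. -/
def restrictF (f β : ZFSet.{0}) : ZFSet :=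
  ZFSet.sep (fun z => ∃ ξ ∈ β, ∃ y, z = ZFSet.pair ξ y) f

/-! ## κ-models, elementary embeddings and weak compactness,
relative to an ambient class `W` of sets (`W = Set.univ` is the ground universe `V`). -/

/-- `M` is a κ-model (computed relative to the universe `W`): it is transitive, of size `κ`,
contains `κ`, is closed under `<κ`-sequences lying in `W`, and satisfies `ZFC⁻`. -/
def IsKappaModelIn (W : Set ZFSet.{0}) (κ M : ZFSet.{0}) : Prop :=
  M ∈ W ∧ κ ∈ M ∧ M.IsTransitive ∧ zcard M = zcard κ ∧
  (∀ β ∈ κ, ∀ f : ZFSet, f ∈ W → ZFSet.IsFunc β M f → f ∈ M) ∧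
  ModelsZFCminus M

abbrev IsKappaModel (κ M : ZFSet.{0}) : Prop := IsKappaModelIn Set.univ κ M

/-- `j` is an elementary embedding from `(M, ∈)` to `(N, ∈)`. -/
def IsElemEmbedding (M N : ZFSet.{0}) (j : ZFSet.{0} → ZFSet.{0}) : Prop :=
  (∀ x ∈ M, j x ∈ N) ∧
  ∀ (n : ℕ) (φ : memLang.BoundedFormula Empty n) (v : Fin n → ZFSet),
    (∀ i, v i ∈ M) → (RealizeIn M φ v ↔ RealizeIn N φ (fun i => j (v i)))

/-- `j` has critical point `κ`: it fixes every ordinal below `κ` and moves `κ`. -/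
def HasCritPoint (j : ZFSet.{0} → ZFSet.{0}) (κ : ZFSet.{0}) : Prop :=
  (∀ x ∈ κ, j x = x) ∧ κ ∈ j κ

/-- `S` is a weakly compact subset of `κ`, computed relative to the universe `W`:
for every `A ⊆ κ` in `W` there are κ-models `M ∋ A, S` and `N` and an elementary
embedding `j : M → N` with critical point `κ` such that `κ ∈ j(S)`. -/
def IsWeaklyCompactIn (W : Set ZFSet.{0}) (κ S : ZFSet.{0}) : Prop :=
  S ⊆ κ ∧ ∀ A : ZFSet, A ∈ W → A ⊆ κ →
    ∃ (M N : ZFSet) (j : ZFSet → ZFSet),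
      IsKappaModelIn W κ M ∧ IsKappaModelIn W κ N ∧ A ∈ M ∧ S ∈ M ∧
      IsElemEmbedding M N j ∧ HasCritPoint j κ ∧ κ ∈ j S

abbrev IsWeaklyCompactSubset (κ S : ZFSet.{0}) : Prop := IsWeaklyCompactIn Set.univ κ S

/-- `κ` is a weakly compact cardinal (relative to the universe `W`). -/
def IsWCCardinalIn (W : Set ZFSet.{0}) (κ : ZFSet.{0}) : Prop :=
  IsCardinalZ κ ∧ PowLtEqSelf κ ∧ IsWeaklyCompactIn W κ κ

abbrev IsWCCardinal (κ : ZFSet.{0}) : Prop := IsWCCardinalIn Set.univ κ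

/-! ## Clubs, stationarity, inaccessibility, Mahloness -/

/-- `C` is a closed unbounded subset of the ordinal `γ`. -/
def IsClubIn (C γ : ZFSet.{0}) : Prop :=
  C ⊆ γ ∧ (∀ ξ ∈ γ, ∃ η ∈ C, ξ ∈ η ∨ ξ = η) ∧
  ∀ β ∈ γ, (∃ ξ, ξ ∈ β) → (∀ ξ ∈ β, ∃ η, η ∈ C ∧ η ∈ β ∧ ξ ∈ η) → β ∈ C

/-- `S` is a stationary subset of `γ`, relative to the universe `W`. -/
def IsStationaryIn (W : Set ZFSet.{0}) (S γ : ZFSet.{0}) : Prop :=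
  ∀ C : ZFSet, C ∈ W → IsClubIn C γ → ∃ x, x ∈ S ∧ x ∈ C

/-- `γ` is a regular cardinal, relative to the universe `W`. -/
def IsRegularIn (W : Set ZFSet.{0}) (γ : ZFSet.{0}) : Prop :=
  IsCardinalZ γ ∧
  ∀ β ∈ γ, ∀ f : ZFSet, f ∈ W → ZFSet.IsFunc β γ f →
    ∃ δ ∈ γ, ∀ ξ ∈ β, ∀ y, ZFSet.pair ξ y ∈ f → y ∈ δ

/-- `γ` is an inaccessible cardinal (regular, uncountable strong limit),
relative to the universe `W`. -/
def IsInaccessibleIn (W : Set ZFSet.{0}) (γ : ZFSet.{0}) : Prop :=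
  IsRegularIn W γ ∧ ZFSet.omega ∈ γ ∧
  ∀ β ∈ γ, ¬ ∃ f : ZFSet, f ∈ W ∧ ZFSet.IsFunc γ (ZFSet.powerset β) f ∧
    (∀ x x' y, ZFSet.pair x y ∈ f → ZFSet.pair x' y ∈ f → x = x')

/-- `γ` is a Mahlo cardinal: it is inaccessible and the inaccessibles below it
are stationary, relative to the universe `W`. -/
def IsMahloIn (W : Set ZFSet.{0}) (γ : ZFSet.{0}) : Prop :=
  IsInaccessibleIn W γ ∧
  IsStationaryIn W (ZFSet.sep (fun β => IsInaccessibleIn W β) γ) γ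

/-- `C` is 1-closed in `κ`: it contains every inaccessible `γ < κ` in which `C ∩ γ`
is stationary (relative to the universe `W`). -/
def IsOneClosedIn (W : Set ZFSet.{0}) (C κ : ZFSet.{0}) : Prop :=
  ∀ γ ∈ κ, IsInaccessibleIn W γ → IsStationaryIn W (C ∩ γ) γ → γ ∈ C

/-- `C` is 1-club in `κ`: stationary and 1-closed (relative to the universe `W`). -/
def IsOneClubIn (W : Set ZFSet.{0}) (C κ : ZFSet.{0}) : Prop :=
  IsStationaryIn W C κ ∧ IsOneClosedIn W C κ

/-! ## Traces and higher orders of weak compactness -/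

/-- The weakly compact trace operation. -/
def wcTraceIn (W : Set ZFSet.{0}) (κ X : ZFSet.{0}) : ZFSet :=
  ZFSet.sep (fun γ => IsWeaklyCompactIn W γ (X ∩ γ)) κ

/-- Finite iterates of the weakly compact trace operation (on the canonical
representatives of the classes `[X]₁`). -/
def iterWcTraceIn (W : Set ZFSet.{0}) (κ : ZFSet.{0}) : ℕ → ZFSet.{0} → ZFSet.{0}
  | 0, X => X
  | n+1, X => wcTraceIn W κ (iterWcTraceIn W κ n X)

/-- `κ` is an `n`-weakly compact cardinal (relative to the universe `W`):
all iterates `Tr^m_{wc}([κ]₁)` for `m < n` are nonzero, i.e. weakly compact. -/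
def IsNWeaklyCompactIn (W : Set ZFSet.{0}) (κ : ZFSet.{0}) (n : ℕ) : Prop :=
  ∀ m < n, IsWeaklyCompactIn W κ (iterWcTraceIn W κ m κ)

/-- `κ` is an `ω`-weakly compact cardinal (relative to the universe `W`). -/
def IsOmegaWeaklyCompactIn (W : Set ZFSet.{0}) (κ : ZFSet.{0}) : Prop :=
  ∀ n : ℕ, IsWeaklyCompactIn W κ (iterWcTraceIn W κ n κ)

/-- `S^β_n`: the Mahlo cardinals below `β` for `n = 0`, and the `n`-weakly compact
cardinals below `β` for `n > 0` (relative to the universe `W`). -/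
def SsetIn (W : Set ZFSet.{0}) (β : ZFSet.{0}) : ℕ → ZFSet
  | 0 => ZFSet.sep (fun α => IsMahloIn W α) β
  | n+1 => ZFSet.sep (fun α => IsNWeaklyCompactIn W α (n+1)) β

/-- The weakly compact reflection principle `Refl_wc(κ)` (relative to the universe `W`):
`κ` is weakly compact and every weakly compact subset of `κ` has a weakly compact
proper initial segment. -/
def ReflWcIn (W : Set ZFSet.{0}) (κ : ZFSet.{0}) : Prop :=
  IsWCCardinalIn W κ ∧
  ∀ S : ZFSet, S ∈ W → IsWeaklyCompactIn W κ S → ∃ γ ∈ κ, IsWeaklyCompactIn W γ (S ∩ γ)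

end

noncomputable section

/-! ## Forcing notions, generic filters, names and generic extensions -/

/-- The order of a ZF-coded partial order: `p ≤ q` iff `(p, q) ∈ R`. -/
def zle (R p q : ZFSet.{0}) : Prop := ZFSet.pair p q ∈ R

/-- `(P, R)` is a ZF-coded partial order (a forcing notion). -/
def IsPosetOn (P R : ZFSet.{0}) : Prop :=
  R ⊆ ZFSet.prod P P ∧ (∀ p ∈ P, zle R p p) ∧
  ∀ p q r : ZFSet, zle R p q → zle R q r → zle R p r

/-- `D` is a dense subset of the forcing notion `(P, R)`. -/
def IsDenseIn (P R D : ZFSet.{0}) : Prop :=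
  D ⊆ P ∧ ∀ p ∈ P, ∃ q ∈ D, zle R q p

/-- `G` (a class of conditions) is a filter on `(P, R)`. -/
def IsClassFilterOn (P R : ZFSet.{0}) (G : Set ZFSet.{0}) : Prop :=
  (∀ p ∈ G, p ∈ P) ∧ (∀ p ∈ G, ∀ q, q ∈ P → zle R p q → q ∈ G) ∧
  ∀ p ∈ G, ∀ q ∈ G, ∃ r, r ∈ G ∧ zle R r p ∧ zle R r q

/-- `G` is generic over the universe `V` for `(P, R)`: it is a filter meeting every
dense subset of `P` (lying in `V`). -/
def IsGenericOverV (P R : ZFSet.{0}) (G : Set ZFSet.{0}) : Prop :=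
  IsClassFilterOn P R G ∧ ∀ D : ZFSet, IsDenseIn P R D → ∃ q, q ∈ G ∧ q ∈ D

/-- `G` is generic for `(P, R)` over the class `W`: it is a filter meeting every
dense subset of `P` lying in `W`. -/
def IsGenericOverClass (W : Set ZFSet.{0}) (P R : ZFSet.{0}) (G : Set ZFSet.{0}) : Prop :=
  IsClassFilterOn P R G ∧ ∀ D : ZFSet, D ∈ W → IsDenseIn P R D → ∃ q, q ∈ G ∧ q ∈ D

/-- A ZF-coded filter on `(P, R)`. -/
def IsSetFilterOn (P R G : ZFSet.{0}) : Prop :=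
  G ⊆ P ∧ (∀ p ∈ G, ∀ q ∈ P, zle R p q → q ∈ G) ∧
  ∀ p ∈ G, ∀ q ∈ G, ∃ r ∈ G, zle R r p ∧ zle R r q

/-- `G` is a filter on `(P, R)` generic over the (set) model `M`. -/
def IsGenericOverSet (M P R G : ZFSet.{0}) : Prop :=
  IsSetFilterOn P R G ∧ ∀ D : ZFSet, D ∈ M → IsDenseIn P R D → ∃ q ∈ G, q ∈ D

/-- The image of a ZF-set under an arbitrary (class) function. -/
def myImage (f : ZFSet.{0} → ZFSet.{0}) (x : ZFSet.{0}) : ZFSet.{0} :=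
  ZFSet.range.{0,0} (fun a : (Quotient.out x).Type => f (ZFSet.mk ((Quotient.out x).Func a)))

/-- The evaluation `val_G(τ)` of a `P`-name `τ` by a filter `G`
(every ZF-set is regarded as a name). -/
def zval (G : Set ZFSet.{0}) : ZFSet.{0} → ZFSet.{0} :=
  (ZFSet.mem_wf.transGen).fix (fun τ rec =>
    myImage (fun σ => if h : Relation.TransGen (· ∈ ·) σ τ then rec σ h else ∅)
      (ZFSet.sep (fun σ => ∃ p, p ∈ G ∧ ZFSet.pair σ p ∈ τ) (⋃₀ (⋃₀ τ : ZFSet))))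

/-- The generic extension `V[G]` of the universe, as a class: all evaluations of names. -/
def VofG (G : Set ZFSet.{0}) : Set ZFSet.{0} := Set.range (zval G)

/-- The generic extension `M[G]` of a set model `M` by a class filter `G`:
the evaluations of all names lying in `M`. -/
def extClass (M : ZFSet.{0}) (G : Set ZFSet.{0}) : ZFSet.{0} := myImage (zval G) M

/-- The generic extension `M[G]` of a set model `M` by a set filter `G`. -/
def extSet (M G : ZFSet.{0}) : ZFSet.{0} := extClass M {x | x ∈ G}

/-- The check-name `x̌` of a ground model set `x` (relative to the forcing `P`). -/
def checkName (P : ZFSet.{0}) : ZFSet.{0} → ZFSet.{0} :=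
  ZFSet.mem_wf.fix (fun x rec =>
    ⋃₀ (myImage (fun y => if h : y ∈ x then myImage (fun p => ZFSet.pair (rec y h) p) P else ∅) x))

/-- The canonical name `Ġ` for the generic filter. -/
def genName (P : ZFSet.{0}) : ZFSet.{0} :=
  myImage (fun p => ZFSet.pair (checkName P p) p) P

/-- The ground model `V`, as a class. -/
def GroundV : Set ZFSet.{0} := Set.univ

/-- `(P, R)` is `κ`-c.c.: every antichain has size `< κ`. -/
def IsKappaCC (P R κ : ZFSet.{0}) : Prop :=
  ∀ A : ZFSet, A ⊆ P →
    (∀ p ∈ A, ∀ q ∈ A, p ≠ q → ¬ ∃ r ∈ P, zle R r p ∧ zle R r q) →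
    zcard A < zcard κ

/-! ## Games and strategic closure -/

/-- It is Player II's turn at stage `α`: `α` is a limit ordinal, or of the form `λ + (2n+1)`
(Player I moves first, at stage `0`, and Player II plays first at limit stages). -/
def IsIITurn (α : ZFSet.{0}) : Prop :=
  IsLimitZ α ∨ ∃ (β : ZFSet) (n : ℕ), (β = ∅ ∨ IsLimitZ β) ∧ α = iterSucc β (2*n+1)

/-- `f` is a ZF-coded descending sequence of conditions of `(P, R)` of length `α`. -/
def IsDescPlay (P R α f : ZFSet.{0}) : Prop :=
  ZFSet.IsFunc α P f ∧ ∀ β ∈ α, ∀ γ ∈ β, zle R (app f β) (app f γ)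

/-- `s` is (the graph of) a deterministic strategy. -/
def IsFunctionLike (s : ZFSet.{0}) : Prop :=
  ∀ x y y', ZFSet.pair x y ∈ s → ZFSet.pair x y' ∈ s → y = y'

/-- `s` is a winning strategy for Player II in the game `G_δ(P)`: along any descending play
(lying in the universe `W`) in which Player II has followed `s`, when it is Player II's turn
`s` provides a condition below all conditions played so far. -/
def IsWinningStratII (W : Set ZFSet.{0}) (P R δ s : ZFSet.{0}) : Prop :=
  ∀ α ∈ δ, ∀ f : ZFSet, f ∈ W → IsDescPlay P R α f →
    (∀ β ∈ α, IsIITurn β → ZFSet.pair (restrictF f β) (app f β) ∈ s) →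
    IsIITurn α →
    ∃ q, ZFSet.pair (restrictF f α) q ∈ s ∧ q ∈ P ∧ ∀ γ ∈ α, zle R q (app f γ)

/-- `(P, R)` is `δ`-strategically closed, relative to the universe `W`:
Player II has a winning strategy in the game of length `δ`. -/
def IsStratClosedIn (W : Set ZFSet.{0}) (P R δ : ZFSet.{0}) : Prop :=
  ∃ s, s ∈ W ∧ IsFunctionLike s ∧ IsWinningStratII W P R δ s

/-- `(P, R)` is `<κ`-strategically closed relative to `W`. -/
def IsLtStratClosedIn (W : Set ZFSet.{0}) (P R κ : ZFSet.{0}) : Prop :=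
  ∀ δ ∈ κ, IsStratClosedIn W P R δ

/-- `(P, R)` is `α⁺`-closed: every descending sequence of length `< α⁺`
(i.e. of length an ordinal of size `≤ |α|`) has a lower bound in `P`. -/
def IsSuccCardClosed (P R α : ZFSet.{0}) : Prop :=
  ∀ β : ZFSet, β.IsOrdinal → zcard β ≤ zcard α →
    ∀ f : ZFSet, IsDescPlay P R β f → ∃ q ∈ P, ∀ γ ∈ β, zle R q (app f γ)

/-! ## The 1-club shooting forcing `T¹(X)` -/

/-- `c` is bounded below `κ`. -/
def IsBoundedBelow (c κ : ZFSet.{0}) : Prop := ∃ β ∈ κ, c ⊆ β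

/-- The poset `T¹(X)` of bounded 1-closed subsets of `X ⊆ κ`, relative to the universe `W`. -/
def T1In (W : Set ZFSet.{0}) (κ X : ZFSet.{0}) : ZFSet :=
  ZFSet.sep (fun c => c ∈ W ∧ IsBoundedBelow c κ ∧ IsOneClosedIn W c κ) (ZFSet.powerset X)

abbrev T1 (κ X : ZFSet.{0}) : ZFSet := T1In Set.univ κ X

/-- `c₁` end-extends `c₂` (i.e. `c₁ ≤ c₂` in `T¹(X)`). -/
def IsEndExtension (c₁ c₂ : ZFSet.{0}) : Prop :=
  c₂ ⊆ c₁ ∧ ∀ x ∈ c₁, x ∉ c₂ → ∀ y ∈ c₂, y ∈ x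

/-- The end-extension order on `T¹(X)`, as a ZF-coded relation. -/
def T1OrderIn (W : Set ZFSet.{0}) (κ X : ZFSet.{0}) : ZFSet :=
  ZFSet.pairSep (fun c₁ c₂ => IsEndExtension c₁ c₂) (T1In W κ X) (T1In W κ X)

abbrev T1Order (κ X : ZFSet.{0}) : ZFSet := T1OrderIn Set.univ κ X

end

noncomputable section

/-! ## The von Neumann hierarchy -/

/-- The von Neumann hierarchy `V_α` (for `α` an ordinal): `V_x = ⋃_{y ∈ x} 𝒫(V_y)`. -/
def Vrank : ZFSet.{0} → ZFSet.{0} :=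
  ZFSet.mem_wf.fix (fun x rec =>
    ⋃₀ (myImage (fun y => if h : y ∈ x then ZFSet.powerset (rec y h) else ∅) x))

/-! ## Π¹₁-indescribability -/

/-- The language with a membership relation and two unary predicates
(for the parameter `A` and a second-order variable `X`). -/
def memLang2 : Language where
  Functions := fun _ => Empty
  Relations := fun n => match n with | 1 => Fin 2 | 2 => Unit | _ => Empty

/-- The structure `(Vκ, ∈, A, B)`. -/
def str2 (Vk A B : ZFSet.{0}) : memLang2.Structure (↥Vk.toSet) where
  funMap := fun {_} f _ => f.elim
  RelMap := fun {n} =>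
    match n with
    | 1 => fun (r : Fin 2) v => if r = 0 then (((v 0 : Vk.toSet) : ZFSet) ∈ A)
                      else (((v 0 : Vk.toSet) : ZFSet) ∈ B)
    | 2 => fun _ v => ((v 0 : Vk.toSet) : ZFSet) ∈ ((v 1 : Vk.toSet) : ZFSet)
    | 0 => fun r _ => r.elim
    | (_+3) => fun r _ => r.elim

/-- `(Vk, ∈, A) ⊨ ∀X ψ(X)`: the Π¹₁-sentence with first-order matrix `ψ` holds in
`(Vk, ∈, A)`, where the second-order universal quantifier ranges over all subsets of `Vk`. -/
def SatisfiesPi11 (Vk A : ZFSet.{0}) (ψ : memLang2.Sentence) : Prop :=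
  ∀ B : ZFSet, B ⊆ Vk → @Sentence.Realize memLang2 _ (str2 Vk A B) ψ

/-! ## Products of 1-club shooting forcings, and lottery sums -/

/-- The ZF-coded set `[m, ω)` of natural numbers `≥ m`. -/
def omegaFrom (m : ℕ) : ZFSet.{0} :=
  ZFSet.sep (fun n => natZ m ⊆ n) ZFSet.omega

/-- The product `∏_{n ∈ [m, ω)} T¹(γ \ S^γ_n)`, computed relative to the universe `W`. -/
def prodT1In (W : Set ZFSet.{0}) (γ : ZFSet.{0}) (m : ℕ) : ZFSet :=
  ZFSet.sep
    (fun f => f ∈ W ∧ ZFSet.IsFunc (omegaFrom m) (ZFSet.powerset γ) f ∧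
      ∀ n : ℕ, m ≤ n → app f (natZ n) ∈ T1In W γ (γ \ SsetIn W γ n))
    (ZFSet.powerset (ZFSet.prod (omegaFrom m) (ZFSet.powerset γ)))

/-- The (pointwise end-extension) order on the product. -/
def prodT1Le (f g : ZFSet.{0}) (m : ℕ) : Prop :=
  ∀ n : ℕ, m ≤ n → IsEndExtension (app f (natZ n)) (app g (natZ n))

/-- The lottery sum `⊕_{m<ω} ∏_{n ∈ [m,ω)} T¹(γ \ S^γ_n)`, relative to the universe `W`;
`∅` serves as the top element `1`. -/
def lotterySumIn (W : Set ZFSet.{0}) (γ : ZFSet.{0}) : ZFSet :=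
  insert ∅ (ZFSet.sep
    (fun z => ∃ (m : ℕ) (f : ZFSet), z = ZFSet.pair (natZ m) f ∧ f ∈ prodT1In W γ m)
    (ZFSet.prod ZFSet.omega (ZFSet.powerset (ZFSet.prod ZFSet.omega (ZFSet.powerset γ)))))

/-- The order on the lottery sum: everything is below the top `∅`, and
`(m, f) ≤ (m', g)` iff `m = m'` and `f ≤ g` pointwise. -/
def lotteryLeIn (W : Set ZFSet.{0}) (γ : ZFSet.{0}) (a b : ZFSet.{0}) : Prop :=
  b = ∅ ∨ ∃ (m : ℕ) (f g : ZFSet), a = ZFSet.pair (natZ m) f ∧ b = ZFSet.pair (natZ m) g ∧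
    f ∈ prodT1In W γ m ∧ g ∈ prodT1In W γ m ∧ prodT1Le f g m

/-- The order on the lottery sum, as a ZF-coded relation. -/
def lotteryOrderIn (W : Set ZFSet.{0}) (γ : ZFSet.{0}) : ZFSet :=
  ZFSet.pairSep (fun a b => lotteryLeIn W γ a b) (lotterySumIn W γ) (lotterySumIn W γ)

/-! ## Easton-support iterations -/

/-- `p` is a ZF-coded function with domain `α`. -/
def IsFuncWithDomain (p α : ZFSet.{0}) : Prop := ∃ y : ZFSet, ZFSet.IsFunc α y p

/-- `p` (a condition of an iteration of length `α`) has Easton support: its support is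
bounded below every inaccessible `δ ≤ α` (stages where `p` takes the trivial value `∅`
are outside the support). -/
def HasEastonSupport (p α : ZFSet.{0}) : Prop :=
  ∀ δ : ZFSet, IsInaccessibleIn Set.univ δ → (δ ∈ α ∨ δ = α) →
    ∃ β ∈ δ, ∀ ξ ∈ δ, app p ξ ≠ ∅ → ξ ∈ β

/-- The restriction of a class filter `G` on an iteration to the first `β` stages. -/
def resFilter (G : Set ZFSet.{0}) (β : ZFSet.{0}) : Set ZFSet.{0} :=
  {q | ∃ p, p ∈ G ∧ q = restrictF p β}

/-- `⟨(P_α, Q̇_α) : α < κ⟩` is an Easton-support forcing iteration (described by the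
cumulative sequence of initial segments `Pseq α` with orders `Rseq α`, whose conditions
are functions with domain `α` and Easton support, coherent under restriction). -/
structure IsEastonIteration (κ : ZFSet.{0}) (Pseq Rseq : ZFSet.{0} → ZFSet.{0}) : Prop where
  isOrd : κ.IsOrdinal
  poset : ∀ α : ZFSet, α.IsOrdinal → (α ∈ κ ∨ α = κ) → IsPosetOn (Pseq α) (Rseq α)
  conds : ∀ α : ZFSet, α.IsOrdinal → (α ∈ κ ∨ α = κ) →
    ∀ p ∈ Pseq α, IsFuncWithDomain p α ∧ HasEastonSupport p α
  coherMem : ∀ α : ZFSet, α.IsOrdinal → (α ∈ κ ∨ α = κ) →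
    ∀ β ∈ α, ∀ p ∈ Pseq α, restrictF p β ∈ Pseq β
  coherLe : ∀ α : ZFSet, α.IsOrdinal → (α ∈ κ ∨ α = κ) →
    ∀ β ∈ α, ∀ p ∈ Pseq α, ∀ q ∈ Pseq α,
      zle (Rseq α) p q → zle (Rseq β) (restrictF p β) (restrictF q β)
  genRes : ∀ α : ZFSet, α.IsOrdinal → (α ∈ κ ∨ α = κ) → ∀ β ∈ α,
    ∀ G : Set ZFSet, IsGenericOverV (Pseq α) (Rseq α) G →
      IsGenericOverV (Pseq β) (Rseq β) (resFilter G β)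

/-- The main iteration of the paper: the Easton-support iteration which, at each stage
`γ < κ` that is Mahlo in `V`, forces with the lottery sum
`⊕_{m<ω} ∏_{n ∈ [m,ω)} T¹(γ \ S^γ_n)` as computed in `V^{P_γ}`, and trivially at
other stages.  The stage-`γ` behaviour is described by evaluating the stage-`γ`
components of conditions by a generic for the first `γ` stages. -/
structure IsMainIteration (κ : ZFSet.{0}) (Pseq Rseq : ZFSet.{0} → ZFSet.{0})
    extends IsEastonIteration κ Pseq Rseq : Prop where
  trivialStage : ∀ γ ∈ κ, ¬ IsMahloIn Set.univ γ → ∀ p ∈ Pseq κ, app p γ = ∅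
  lotteryStage : ∀ γ ∈ κ, IsMahloIn Set.univ γ →
    ∀ G : Set ZFSet, IsGenericOverV (Pseq γ) (Rseq γ) G →
      (∀ p ∈ Pseq (zsucc γ), zval G (app p γ) ∈ lotterySumIn (VofG G) γ) ∧
      (∀ q ∈ lotterySumIn (VofG G) γ, ∃ p ∈ Pseq (zsucc γ), zval G (app p γ) = q) ∧
      (∀ p ∈ Pseq (zsucc γ), ∀ q ∈ Pseq (zsucc γ), zle (Rseq (zsucc γ)) p q →
        zle (lotteryOrderIn (VofG G) γ) (zval G (app p γ)) (zval G (app q γ)))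

/-- An Easton-support iteration all of whose stages are (forced to be)
`α`-strategically closed. -/
structure IsStratClosedIteration (κ : ZFSet.{0}) (Pseq Rseq : ZFSet.{0} → ZFSet.{0})
    extends IsEastonIteration κ Pseq Rseq : Prop where
  stageClosed : ∀ α ∈ κ,
    ∀ G : Set ZFSet, IsGenericOverV (Pseq α) (Rseq α) G →
      ∃ Q R' : ZFSet, Q ∈ VofG G ∧ R' ∈ VofG G ∧ IsPosetOn Q R' ∧
        IsStratClosedIn (VofG G) Q R' α ∧
        (∀ p ∈ Pseq (zsucc α), zval G (app p α) ∈ Q) ∧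
        (∀ q ∈ Q, ∃ p ∈ Pseq (zsucc α), zval G (app p α) = q) ∧
        (∀ p ∈ Pseq (zsucc α), ∀ q ∈ Pseq (zsucc α), zle (Rseq (zsucc α)) p q →
          zle R' (zval G (app p α)) (zval G (app q α)))

end

noncomputable section

/-! ## Miscellaneous auxiliary notions used in the statements -/

/-- `M` is an elementary substructure of `(H, ∈)`. -/
def IsElemSubstructure (M H : ZFSet.{0}) : Prop :=
  M ⊆ H ∧ ∀ (n : ℕ) (φ : memLang.BoundedFormula Empty n) (v : Fin n → ZFSet),
    (∀ i, v i ∈ M) → (RealizeIn M φ v ↔ RealizeIn H φ v)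

/-- `H = H_{κ⁺}`: the sets whose transitive closure has size at most `κ`. -/
def IsHkappaPlus (κ H : ZFSet.{0}) : Prop :=
  ∀ x : ZFSet, x ∈ H ↔ ∃ t : ZFSet, x ⊆ t ∧ t.IsTransitive ∧ zcard t ≤ zcard κ

/-- `I` is a (proper) ideal on `lam`. -/
def IsIdealOn (lam I : ZFSet.{0}) : Prop :=
  (∀ X ∈ I, X ⊆ lam) ∧ ∅ ∈ I ∧ lam ∉ I ∧
  (∀ X ∈ I, ∀ Y : ZFSet, Y ⊆ X → Y ∈ I) ∧
  (∀ X ∈ I, ∀ Y ∈ I, X ∪ Y ∈ I)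

/-- `I` is `lam`-complete: it is closed under unions of fewer than `lam` members. -/
def IsLamCompleteIdeal (lam I : ZFSet.{0}) : Prop :=
  ∀ x : ZFSet, x ⊆ I → zcard x < zcard lam → (⋃₀ x : ZFSet) ∈ I

/-- `I` is a normal `lam`-complete (proper) ideal on `lam`: every regressive ZF-coded
function on an `I`-positive set is constant on an `I`-positive set. -/
def IsNormalIdealOn (lam I : ZFSet.{0}) : Prop :=
  IsIdealOn lam I ∧ IsLamCompleteIdeal lam I ∧
  ∀ S : ZFSet, S ⊆ lam → S ∉ I →
    ∀ f : ZFSet, ZFSet.IsFunc S lam f → (∀ α ∈ S, α ≠ ∅ → app f α ∈ α) →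
      ∃ β ∈ lam, ZFSet.sep (fun α => ZFSet.pair α β ∈ f) S ∉ I

/-- The pair `(W, V)` has the `δ`-approximation property. -/
def HasApproxProperty (W : Set ZFSet.{0}) (δ : ZFSet.{0}) : Prop :=
  ∀ A : ZFSet, (∀ a ∈ A, a ∈ W) →
    (∀ a : ZFSet, a ∈ W → zcard a < zcard δ → A ∩ a ∈ W) → A ∈ W

/-- The pair `(W, V)` has the `δ`-cover property. -/
def HasCoverProperty (W : Set ZFSet.{0}) (δ : ZFSet.{0}) : Prop :=
  ∀ A : ZFSet, (∀ a ∈ A, a ∈ W) → zcard A < zcard δ →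
    ∃ B : ZFSet, B ∈ W ∧ A ⊆ B ∧ zcard B < zcard δ

/-- The dense set `D_α = {c ∈ T¹(X) : sup c > α⁺}` (a set `c` has `sup c > α⁺` iff it
contains an ordinal of cardinality greater than `|α|`). -/
def DsetT1 (κ X α : ZFSet.{0}) : ZFSet :=
  ZFSet.sep (fun c => ∃ ξ ∈ c, zcard α < zcard ξ) (T1 κ X)

/-- The `1`-club `C = ⋃ {f(m) : f ∈ I_γ}` added by the product selected by the lottery
held at stage `γ` of the main iteration. -/
def stageClub (G : Set ZFSet.{0}) (γ : ZFSet.{0}) (m : ℕ) : ZFSet :=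
  ZFSet.sep (fun ξ => ∃ p, p ∈ G ∧ ∃ f : ZFSet,
    zval (resFilter G γ) (app p γ) = ZFSet.pair (natZ m) f ∧ ξ ∈ app f (natZ m)) γ

end

namespace SunChar

open Cardinal Ordinal

/-! ## Bounding lemmas for regular and inaccessible ordinals -/

/-- `γ` is an initial ordinal whose cardinality is regular. -/
def IsRegOrd (γ : Ordinal.{0}) : Prop := γ.card.ord = γ ∧ γ.card.IsRegular

/-- `γ` is an initial ordinal whose cardinality is inaccessible. -/
def IsInaccOrd (γ : Ordinal.{0}) : Prop := γ.card.ord = γ ∧ γ.card.IsInaccessible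

theorem IsInaccOrd.isRegOrd {γ : Ordinal.{0}} (h : IsInaccOrd γ) : IsRegOrd γ :=
  ⟨h.1, h.2.isRegular⟩

theorem IsInaccOrd.omega0_lt {γ : Ordinal.{0}} (h : IsInaccOrd γ) : ω < γ := by
  rw [← h.1, ← ord_aleph0, ord_lt_ord]
  exact h.2.aleph0_lt

theorem card_lt_of_lt {γ α : Ordinal.{0}} (h : γ.card.ord = γ) (hα : α < γ) : α.card < γ.card := by
  rw [← h] at hα
  exact lt_ord.1 hα

theorem IsRegOrd.exists_bound {γ : Ordinal.{0}} (h : IsRegOrd γ) {ι : Type} (hι : #ι < γ.card)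
    (f : ι → Ordinal.{0}) (hf : ∀ i, f i < γ) : ∃ δ < γ, ∀ i, f i < δ := by
  refine ⟨⨆ i, f i + 1, ?_, fun i => ?_⟩
  · apply iSup_add_one_lt_of_lt_cof _ hf
    rw [← h.1, h.2.cof_ord]; exact hι
  · exact (Order.lt_add_one_iff.2 le_rfl).trans_le (Ordinal.le_iSup (fun i => f i + 1) i)

theorem IsRegOrd.exists_bound_Iio {γ : Ordinal.{0}} (h : IsRegOrd γ) {β : Ordinal.{0}} (hβ : β < γ)
    (f : Ordinal.{0} → Ordinal.{0}) (hf : ∀ α < β, f α < γ) : ∃ δ < γ, ∀ α < β, f α < δ := by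
  obtain ⟨δ, hδ, h2⟩ := h.exists_bound (ι := β.ToType) (by simpa using card_lt_of_lt h.1 hβ)
    (fun i => f (ToType.toOrd i).1) (fun i => hf _ (ToType.toOrd i).2)
  refine ⟨δ, hδ, fun α hα => ?_⟩
  simpa using h2 (ToType.mk ⟨α, hα⟩)

theorem IsRegOrd.isSuccLimit {γ : Ordinal.{0}} (h : IsRegOrd γ) : Order.IsSuccLimit γ := by
  rw [← h.1]; exact isSuccLimit_ord h.2.1

theorem IsRegOrd.add_one_lt {γ α : Ordinal.{0}} (h : IsRegOrd γ) (hα : α < γ) : α + 1 < γ :=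
  h.isSuccLimit.add_one_lt hα

theorem IsRegOrd.pos {γ : Ordinal.{0}} (h : IsRegOrd γ) : 0 < γ :=
  pos_iff_ne_zero.2 h.isSuccLimit.ne_bot

theorem exists_le_of_injOn {γ : Ordinal.{0}} (h : γ.card.ord = γ) (f : Ordinal.{0} → Ordinal.{0})
    (hf : ∀ x < γ, ∀ y < γ, f x = f y → x = y) {a : Ordinal.{0}} (ha : a < γ) :
    ∃ l < γ, a ≤ f l := by
  by_contra! hcon
  have h1 : #(γ.ToType) ≤ #(a.ToType) := by
    refine mk_le_of_injective (f := fun i => ToType.mk ⟨f (ToType.toOrd i).1,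
      hcon _ (ToType.toOrd i).2⟩) ?_
    intro i j hij
    have := hf _ (ToType.toOrd i).2 _ (ToType.toOrd j).2
      (congrArg Subtype.val (ToType.mk.injective hij))
    exact ToType.mk.symm.injective (Subtype.ext this)
  simp only [mk_toType] at h1
  exact absurd (card_lt_of_lt h ha) (not_lt.2 h1)

theorem exists_cofinal_map (o : Ordinal.{0}) :
    ∃ f : Ordinal.{0} → Ordinal.{0}, (∀ α < o.cof.ord, f α < o) ∧
      ∀ a < o, ∃ α < o.cof.ord, a ≤ f α := by
  obtain ⟨ι, f, hf, hι⟩ := exists_lsub_cof o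
  have e : ι ≃ o.cof.ord.ToType := Classical.choice (Cardinal.eq.1 (by simp [hι]))
  refine ⟨fun α => if h : α < o.cof.ord then f (e.symm (ToType.mk ⟨α, h⟩)) else 0, ?_, ?_⟩
  · intro α hα
    simp only [hα, dite_true]
    conv_rhs => rw [← hf]
    exact lt_lsub _ _
  · intro a ha
    rw [← hf, lt_lsub_iff] at ha
    obtain ⟨i, hi⟩ := ha
    refine ⟨(ToType.toOrd (e i)).1, (ToType.toOrd (e i)).2, ?_⟩
    have : ((ToType.toOrd (e i)).1 : Ordinal) < o.cof.ord := (ToType.toOrd (e i)).2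
    have h2 : ToType.mk ⟨(ToType.toOrd (e i)).1, this⟩ = e i := ToType.mk.apply_symm_apply _
    simpa only [this, dite_true, h2, Equiv.symm_apply_apply] using hi

theorem exists_cofinal_map_of_not_regular {o : Ordinal.{0}} (h : o.card.ord = o) (ho : ω ≤ o)
    (hn : ¬ o.card.IsRegular) :
    ∃ β < o, ∃ f : Ordinal.{0} → Ordinal.{0}, (∀ α < β, f α < o) ∧ ∀ a < o, ∃ α < β, a ≤ f α := by
  refine ⟨o.cof.ord, ?_, exists_cofinal_map o⟩
  have h0 : ℵ₀ ≤ o.card := by simpa using Ordinal.card_le_card ho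
  conv_rhs => rw [← h]
  rw [ord_lt_ord]
  by_contra! hc
  exact hn ⟨h0, by rw [h]; exact hc⟩

/-- A subset of a regular ordinal which is covered by `β < γ` many points is bounded. -/
theorem IsRegOrd.card_of_unbounded {γ : Ordinal.{0}} (h : IsRegOrd γ) {X : Set Ordinal.{0}}
    (hX : ∀ a < γ, ∃ v < γ, a ≤ v ∧ v ∈ X) {d : Cardinal.{0}} (hd : d < γ.card) :
    ∃ (ι : Type) (y : ι → Ordinal.{0}), #ι = d ∧ Function.Injective y ∧
      ∀ i, y i ∈ X ∧ y i < γ := by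
  have h1 : Cardinal.lift.{1} d ≤ #{x // x ∈ X ∧ x < γ} := by
    by_contra! hlt
    have := sSup_add_one_lt_of_lt_cof (s := {x | x ∈ X ∧ x < γ}) (a := γ) (by
      rw [← lift_cof]
      refine hlt.trans ?_
      rw [Cardinal.lift_lt, ← h.1, h.2.cof_ord]; exact hd) (fun i hi => hi.2)
    obtain ⟨v, hv, hav, hvX⟩ := hX _ this
    have : v + 1 ≤ sSup ((· + 1) '' {x | x ∈ X ∧ x < γ}) := by
      apply le_csSup
      · refine ⟨γ, ?_⟩
        rintro _ ⟨x, hx, rfl⟩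
        exact Order.add_one_le_iff.2 hx.2
      · exact ⟨v, ⟨hvX, hv⟩, rfl⟩
    exact absurd (Order.add_one_le_iff.1 (this.trans hav)) (lt_irrefl _)
  have h2 : Cardinal.lift.{1} (#(d.out)) ≤ Cardinal.lift.{0} #{x // x ∈ X ∧ x < γ} := by
    simpa using h1
  obtain ⟨e⟩ := Cardinal.lift_mk_le'.1 h2
  exact ⟨d.out, fun i => (e i).1, by simp, fun i j hij => e.injective (Subtype.ext hij),
    fun i => (e i).2⟩

/-- Every sequence of sets is guessed, on arbitrarily long initial segments and together with the
truth value of unboundedness, at ordinals of `S`. -/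
def NormalGuess (k : Ordinal.{0}) (S : Set Ordinal.{0}) : Prop :=
  ∀ A : Ordinal.{0} → Set Ordinal.{0}, ∃ X : Set Ordinal.{0}, ∀ β < k, ∃ γ < k, γ ∈ S ∧ β < γ ∧
    (∀ c < β, c ∈ A γ ↔ c ∈ X) ∧
    ((∀ a < γ, ∃ v < γ, a ≤ v ∧ v ∈ A γ) ↔ ∀ a < k, ∃ v < k, a ≤ v ∧ v ∈ X)

theorem NormalGuess.isRegOrd {k : Ordinal.{0}} {S : Set Ordinal.{0}} (hk : k.card.ord = k)
    (hω : ω < k) (h : NormalGuess k S) : IsRegOrd k := by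
  refine ⟨hk, ?_⟩
  by_contra hn
  obtain ⟨β, hβ, f, hf, hf2⟩ := exists_cofinal_map_of_not_regular hk hω.le hn
  have hlim : Order.IsSuccLimit k := by
    rw [← hk]; exact isSuccLimit_ord (by simpa using Ordinal.card_le_card hω.le)
  obtain ⟨X, hX⟩ := h fun γ => {ξ | ξ < β ∧ γ ≤ f ξ}
  obtain ⟨γ, hγ, -, hβγ, h1, -⟩ := hX β hβ
  obtain ⟨ξ, hξ, hξ2⟩ := hf2 γ hγ
  have hξX : ξ ∈ X := (h1 ξ hξ).1 ⟨hξ, hξ2⟩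
  obtain ⟨γ', hγ', -, hβγ', h1', -⟩ := hX (max β (f ξ)) (max_lt hβ (hf ξ hξ))
  have := ((h1' ξ (hξ.trans_le (le_max_left _ _))).2 hξX).2
  exact absurd (this.trans_lt ((le_max_right _ _).trans_lt hβγ')) (lt_irrefl _)

theorem NormalGuess.isInaccOrd {k : Ordinal.{0}} {S : Set Ordinal.{0}} (hk : k.card.ord = k)
    (hω : ω < k) (h : NormalGuess k S) : IsInaccOrd k := by
  have hreg := h.isRegOrd hk hω
  refine ⟨hk, ?_, hreg.2.2, ?_⟩
  · rw [← hk, ← ord_aleph0, ord_lt_ord] at hω; exact hω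
  intro μ hμ
  by_contra! hcon
  have hcon' : #(k.ToType) ≤ #(Set (μ.ord.ToType)) := by simpa using hcon
  obtain ⟨e⟩ := Cardinal.le_def _ _ |>.1 hcon'
  have hμk : μ.ord < k := by rw [← hk]; exact ord_lt_ord.2 hμ
  obtain ⟨X, hX⟩ := h fun γ => {c | ∃ (hγ : γ < k) (hc : c < μ.ord),
    ToType.mk ⟨c, hc⟩ ∈ e (ToType.mk ⟨γ, hγ⟩)}
  obtain ⟨γ, hγ, -, hβγ, h1, -⟩ := hX _ hμk
  obtain ⟨γ', hγ', -, hβγ', h1', -⟩ := hX _ hγ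
  have : e (ToType.mk ⟨γ, hγ⟩) = e (ToType.mk ⟨γ', hγ'⟩) := by
    ext x
    obtain ⟨⟨c, hc⟩, rfl⟩ := ToType.mk.surjective x
    have a1 := h1 c hc
    have a2 := h1' c (lt_trans hc hβγ)
    simp only [Set.mem_ofPred_eq, hγ, hγ', exists_true_left] at a1 a2
    have hc' : c < μ.ord := hc
    simp only [hc', exists_true_left] at a1 a2
    rw [a1, a2]
  have := congrArg Subtype.val (ToType.mk.injective (e.injective this))
  exact hβγ'.ne this

/-- An ordinal closed under exponentiation is inaccessible or has a short cofinal sequence. -/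
theorem isInaccOrd_or_cofinal {γ : Ordinal.{0}} (hω : ω < γ)
    (h : ∀ l < γ, 1 ≤ l → (2 ^ l.card : Cardinal).ord < γ) :
    IsInaccOrd γ ∨ ∃ l < γ, 1 ≤ l ∧ ∃ f : Ordinal.{0} → Ordinal.{0},
      ∀ a < γ, ∃ α < l, a ≤ f α ∧ f α < γ := by
  have hc : γ.card.ord = γ := by
    refine le_antisymm (ord_card_le γ) (not_lt.1 fun hlt => ?_)
    have h1 : 1 ≤ γ.card.ord := by
      rw [Order.one_le_iff_pos]
      rw [← ord_zero, ord_lt_ord, pos_iff_ne_zero, Ne, card_eq_zero]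
      exact (pos_of_gt hω).ne'
    have := h _ hlt h1
    have h2 := card_le_card this.le
    rw [card_ord, card_ord] at h2
    exact absurd (cantor γ.card) (not_lt.2 h2)
  by_cases hr : γ.card.IsRegular
  · left
    refine ⟨hc, ?_, hr.2, ?_⟩
    · rw [← hc, ← ord_aleph0, ord_lt_ord] at hω; exact hω
    intro μ hμ
    by_cases h0 : μ = 0
    · subst h0
      simpa using (hr.nat_lt 1)
    · have := h μ.ord (by rw [← hc]; exact ord_lt_ord.2 hμ) (by
        rw [Order.one_le_iff_pos, ← ord_zero, ord_lt_ord, pos_iff_ne_zero]; exact h0)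
      rw [card_ord, ← hc, ord_lt_ord] at this
      exact this
  · right
    obtain ⟨β, hβ, f, hf, hf2⟩ := exists_cofinal_map_of_not_regular hc hω.le hr
    refine ⟨β, hβ, ?_, f, fun a ha => (hf2 a ha).imp fun α hα => ⟨hα.1, hα.2, hf α hα.1⟩⟩
    obtain ⟨α, hα, -⟩ := hf2 0 (pos_of_gt hω)
    exact Order.one_le_iff_pos.2 (pos_of_gt hα)

/-- Bounded sequences of ordinals can be coded by ordinals. -/
theorem exists_seq_code {k : Ordinal.{0}} (hk : IsInaccOrd k)
    (hpow : ∀ μ < k.card, k.card ^ μ ≤ k.card) :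
    ∃ enc : Ordinal.{0} → (Ordinal.{0} → Ordinal.{0}) → Ordinal.{0},
      (∀ l f, enc l f < k) ∧
      (∀ l f f', (∀ a < l, f a = f' a) → enc l f = enc l f') ∧
      (∀ l < k, ∀ l' < k, ∀ f f', (∀ a < l, f a < k) → (∀ a < l', f' a < k) →
        enc l f = enc l' f' → l = l' ∧ ∀ a < l, f a = f' a) := by
  have hcard : #(Σ b : k.ToType, ((ToType.toOrd b).1.ToType → k.ToType)) ≤ #(k.ToType) := by
    rw [mk_sigma]
    refine (Cardinal.sum_le_sum _ (fun _ => k.card) fun b => ?_).trans ?_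
    · simpa using hpow _ (card_lt_of_lt hk.1 (ToType.toOrd b).2)
    · rw [sum_const']
      simp [mul_eq_self hk.2.aleph0_lt.le]
  obtain ⟨e⟩ := Cardinal.le_def _ _ |>.1 hcard
  have hk0 : 0 < k := hk.isRegOrd.pos
  let tr : Ordinal.{0} → k.ToType := fun x => if h : x < k then ToType.mk ⟨x, h⟩
    else ToType.mk ⟨0, hk0⟩
  have htr : ∀ x < k, ∀ y < k, tr x = tr y → x = y := by
    intro x hx y hy hxy
    simp only [tr, hx, hy, dite_true] at hxy
    exact congrArg Subtype.val (ToType.mk.injective hxy)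
  refine ⟨fun l f => (ToType.toOrd (e ⟨tr l, fun i => tr (f (ToType.toOrd i).1)⟩)).1, ?_, ?_, ?_⟩
  · intro l f; exact (ToType.toOrd (e _)).2
  · intro l f f' hff
    have hl : (ToType.toOrd (tr l)).1 ≤ l := by
      simp only [tr]
      split_ifs <;> simp
    have : (fun i : (ToType.toOrd (tr l)).1.ToType => tr (f (ToType.toOrd i).1)) =
        fun i => tr (f' (ToType.toOrd i).1) := by
      funext i
      rw [hff _ (lt_of_lt_of_le (ToType.toOrd i).2 hl)]
    simp only [this]
  · intro l hl l' hl' f f' hf hf' heq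
    have h1 := e.injective (ToType.mk.symm.injective (Subtype.ext heq))
    rw [Sigma.mk.inj_iff] at h1
    obtain rfl := htr l hl l' hl' h1.1
    refine ⟨rfl, fun a ha => ?_⟩
    have h2 := eq_of_heq h1.2
    have hlt : a < (ToType.toOrd (tr l)).1 := by simpa [tr, hl] using ha
    have h3 := congrFun h2 (ToType.mk ⟨a, hlt⟩)
    simp only [OrderIso.symm_apply_apply] at h3
    exact htr _ (hf a ha) _ (hf' a ha) h3

theorem IsInaccOrd.exists_bound_code {k : Ordinal.{0}} (hk : IsInaccOrd k)
    {enc : Ordinal.{0} → (Ordinal.{0} → Ordinal.{0}) → Ordinal.{0}}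
    (h1 : ∀ l f, enc l f < k) (h2 : ∀ l f f', (∀ a < l, f a = f' a) → enc l f = enc l f')
    {b : Ordinal.{0}} (hb : b < k) :
    ∃ δ < k, ∀ l < b, ∀ f, (∀ a < l, f a < b) → enc l f < δ := by
  have hcard : #(b.ToType × (b.ToType → b.ToType)) < k.card := by
    have hbc := card_lt_of_lt hk.1 hb
    simp only [mk_prod, Cardinal.lift_id, mk_toType, mk_pi, prod_const]
    refine mul_lt_of_lt hk.2.aleph0_lt.le hbc ?_
    refine (power_le_power_right (cantor b.card).le).trans_lt ?_
    rw [← power_mul]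
    exact hk.2.isStrongPrelimit (mul_lt_of_lt hk.2.aleph0_lt.le hbc hbc)
  obtain ⟨δ, hδ, h3⟩ := hk.isRegOrd.exists_bound hcard
    (fun p => enc (ToType.toOrd p.1).1
      (fun a => if h : a < b then (ToType.toOrd (p.2 (ToType.mk ⟨a, h⟩))).1 else 0))
    (fun _ => h1 _ _)
  refine ⟨δ, hδ, fun l hl f hf => ?_⟩
  have hb0 : 0 < b := pos_of_gt hl
  refine lt_of_eq_of_lt ?_ (h3 (ToType.mk ⟨l, hl⟩, fun i =>
    if h : f (ToType.toOrd i).1 < b then ToType.mk ⟨f (ToType.toOrd i).1, h⟩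
    else ToType.mk ⟨0, hb0⟩))
  simp only [OrderIso.symm_apply_apply]
  refine h2 _ _ _ fun a ha => ?_
  have hab : a < b := ha.trans hl
  simp [hab, hf a ha]

/-- Every sequence of regressive functions is guessed, on arbitrarily long initial segments, at
inaccessible members of `S` which are closed under a prescribed function. -/
def RegressiveGuess (k : Ordinal.{0}) (S : Set Ordinal.{0}) : Prop :=
  ∀ F : Ordinal.{0} → Ordinal.{0} → Ordinal.{0},
    (∀ γ < k, IsInaccOrd γ → ∀ α < γ, F α γ < γ) →
    ∀ g : Ordinal.{0} → Ordinal.{0}, (∀ l < k, g l < k) →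
    ∃ V : Ordinal.{0} → Ordinal.{0}, ∀ β < k, ∃ γ < k, γ ∈ S ∧ IsInaccOrd γ ∧ β < γ ∧
      (∀ l < γ, g l < γ) ∧ ∀ α < β, F α γ = V α

theorem NormalGuess.regressiveGuess {k : Ordinal.{0}} {S : Set Ordinal.{0}} (hk : IsInaccOrd k)
    (hpow : ∀ μ < k.card, k.card ^ μ ≤ k.card) (h : NormalGuess k S) : RegressiveGuess k S := by
  intro F hF g hg
  have hreg := hk.isRegOrd
  have hωk := hk.omega0_lt
  obtain ⟨enc, enc1, enc2, enc3⟩ := exists_seq_code hk hpow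
  choose! bd hbd1 hbd2 using fun b (hb : b < k) => hk.exists_bound_code enc1 enc2 hb
  -- the closure function
  let G : Ordinal.{0} → Ordinal.{0} := fun l =>
    max (max (g l) (g 0)) (max (bd l) (2 ^ l.card : Cardinal).ord)
  have hG : ∀ l < k, G l < k := by
    intro l hl
    refine max_lt (max_lt (hg l hl) (hg 0 hreg.pos)) (max_lt (hbd1 l hl) ?_)
    rw [← hk.1, ord_lt_ord]
    exact hk.2.isStrongPrelimit (card_lt_of_lt hk.1 hl)
  let Good : Ordinal.{0} → Prop := fun γ => IsInaccOrd γ ∧ ∀ l < γ, 1 ≤ l → G l < γ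
  have hbad : ∀ γ, ω < γ → ¬ Good γ → ∃ l < γ, 1 ≤ l ∧ (γ ≤ G l ∨
      ∃ f : Ordinal.{0} → Ordinal.{0}, ∀ a < γ, ∃ α < l, a ≤ f α ∧ f α < γ) := by
    intro γ hω hγ
    by_cases hcl : ∀ l < γ, 1 ≤ l → G l < γ
    · rcases isInaccOrd_or_cofinal hω fun l hl h1 => lt_of_le_of_lt
        ((le_max_right _ _).trans (le_max_right _ _)) (hcl l hl h1) with hi | ⟨l, hl, h1, f, hf⟩
      · exact absurd ⟨hi, hcl⟩ hγ
      · exact ⟨l, hl, h1, Or.inr ⟨f, hf⟩⟩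
    · push Not at hcl
      obtain ⟨l, hl, h1, h2⟩ := hcl
      exact ⟨l, hl, h1, Or.inl h2⟩
  choose! L hL1 hL2 hL3 using hbad
  have hL4 : ∀ γ, ∃ f : Ordinal.{0} → Ordinal.{0}, ω < γ → ¬ Good γ → ¬ γ ≤ G (L γ) →
      ∀ a < γ, ∃ α < L γ, a ≤ f α ∧ f α < γ := by
    intro γ
    by_cases hc : ω < γ ∧ ¬ Good γ ∧ ¬ γ ≤ G (L γ)
    · obtain ⟨f, hf⟩ := (hL3 γ hc.1 hc.2.1).resolve_left hc.2.2
      exact ⟨f, fun _ _ _ => hf⟩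
    · exact ⟨id, fun h1 h2 h3 => absurd ⟨h1, h2, h3⟩ hc⟩
  choose f hf using hL4
  let A : Ordinal.{0} → Set Ordinal.{0} := fun γ =>
    if Good γ then {x | x = 0 ∨ ∃ l < γ, x = 1 + enc l (fun α => F α γ)}
    else {x | L γ ≤ x ∧ (γ ≤ G (L γ) ∨ x = L γ ∨ ∃ α < L γ, x = f γ α)}
  obtain ⟨X, hX⟩ := h A
  -- closure of good ordinals under codes
  have hgood : ∀ γ < k, Good γ → ∀ l < γ, 1 + enc l (fun α => F α γ) < γ := by
    intro γ hγ hg l hl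
    obtain ⟨δ, hδ, h2⟩ := hg.1.isRegOrd.exists_bound_Iio hl (fun α => F α γ)
      (fun α hα => hF γ hγ hg.1 α (hα.trans hl))
    have hm : max (max δ (l + 1)) 1 < γ := max_lt (max_lt hδ (hg.1.isRegOrd.add_one_lt hl))
      (Ordinal.one_lt_omega0.trans hg.1.omega0_lt)
    have h3 : enc l (fun α => F α γ) < bd (max (max δ (l + 1)) 1) := by
      refine hbd2 _ (hm.trans hγ) l ?_ _ fun a ha => (h2 a ha).trans_le ?_
      · exact (Order.lt_add_one_iff.2 le_rfl).trans_le
          ((le_max_right _ _).trans (le_max_left _ _))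
      · exact (le_max_left _ _).trans (le_max_left _ _)
    have h4 := h3.trans ((((le_max_left _ _).trans (le_max_right _ _)).trans_lt
      (hg.2 _ hm (le_max_right _ _))))
    have hp : IsPrincipal (· + ·) γ := by
      rw [← hg.1.1]; exact isPrincipal_add_ord hg.1.2.aleph0_lt.le
    exact hp (Ordinal.one_lt_omega0.trans hg.1.omega0_lt) h4
  have hU : ∀ γ < k, ω < γ → ∀ a < γ, ∃ v < γ, a ≤ v ∧ v ∈ A γ := by
    intro γ hγ hω a ha
    by_cases hg : Good γ
    · obtain ⟨l, hl, h2⟩ := exists_le_of_injOn hg.1.1 (fun l => 1 + enc l (fun α => F α γ)) (by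
        intro x hx y hy hxy
        have h5 := (add_right_inj _).1 hxy
        exact (enc3 x (hx.trans hγ) y (hy.trans hγ) _ _
          (fun a ha => (hF γ hγ hg.1 a (ha.trans hx)).trans hγ)
          (fun a ha => (hF γ hγ hg.1 a (ha.trans hy)).trans hγ) h5).1) ha
      refine ⟨_, hgood γ hγ hg l hl, h2, ?_⟩
      simp only [A, hg, if_true]
      exact Or.inr ⟨l, hl, rfl⟩
    · by_cases hγL : γ ≤ G (L γ)
      · refine ⟨max a (L γ), max_lt ha (hL1 γ hω hg), le_max_left _ _, ?_⟩
        simp only [A, hg, if_false]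
        exact ⟨le_max_right _ _, Or.inl hγL⟩
      · obtain ⟨α, hα, h1, h2⟩ := hf γ hω hg hγL (max a (L γ)) (max_lt ha (hL1 γ hω hg))
        refine ⟨_, h2, (le_max_left _ _).trans h1, ?_⟩
        simp only [A, hg, if_false]
        exact ⟨(le_max_right _ _).trans h1, Or.inr (Or.inr ⟨α, hα, rfl⟩)⟩
  have hXU : ∀ a < k, ∃ v < k, a ≤ v ∧ v ∈ X := by
    obtain ⟨γ, hγ, -, h1, -, h2⟩ := hX ω hωk
    exact h2.1 (hU γ hγ h1)
  by_cases h0 : (0 : Ordinal.{0}) ∈ X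
  · have hmem : ∀ b < k, ∃ γ < k, γ ∈ S ∧ Good γ ∧ b < γ ∧
        ∀ x ∈ X, x < b → x = 0 ∨ ∃ l < γ, x = 1 + enc l (fun α => F α γ) := by
      intro b hb
      obtain ⟨γ, hγ, hS, hbγ, h1, -⟩ := hX (max b ω) (max_lt hb hωk)
      have hωγ : ω < γ := (le_max_right _ _).trans_lt hbγ
      have hg : Good γ := by
        by_contra hg
        have h2 : (0 : Ordinal.{0}) ∈ A γ :=
          (h1 0 (Ordinal.omega0_pos.trans_le (le_max_right _ _))).2 h0
        simp only [A, hg, if_false] at h2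
        have := (hL2 γ hωγ hg).trans h2.1
        simp at this
      refine ⟨γ, hγ, hS, hg, (le_max_left _ _).trans_lt hbγ, fun x hx hxb => ?_⟩
      have h2 := (h1 x (hxb.trans_le (le_max_left _ _))).2 hx
      simp only [A, hg, if_true] at h2
      exact h2
    have huniq : ∀ x ∈ X, x < k → ∀ y ∈ X, y < k → ∀ l < k, ∀ f₁ f₂ : Ordinal.{0} → Ordinal.{0},
        (∀ a < l, f₁ a < k) → (∀ a < l, f₂ a < k) → x = 1 + enc l f₁ → y = 1 + enc l f₂ →
        x = y := by
      intro x hx hxk y hy hyk l hl f₁ f₂ hf₁ hf₂ h1 h2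
      obtain ⟨γ, hγ, -, hg, hbγ, h3⟩ := hmem (max x y + 1) (hreg.add_one_lt (max_lt hxk hyk))
      have key : ∀ z ∈ X, z < max x y + 1 → ∀ f₃ : Ordinal.{0} → Ordinal.{0}, (∀ a < l, f₃ a < k) →
          z = 1 + enc l f₃ → z = 1 + enc l (fun α => F α γ) := by
        intro z hz hzl f₃ hf₃ h4
        rcases h3 z hz hzl with rfl | ⟨l', hl', h5⟩
        · exact absurd h4.symm (by simp)
        · rw [h4] at h5
          obtain ⟨rfl, -⟩ := enc3 l hl l' (hl'.trans hγ) _ _ hf₃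
            (fun a ha => (hF γ hγ hg.1 a (ha.trans hl')).trans hγ) ((add_right_inj _).1 h5)
          rw [h4]; exact h5
      rw [key x hx (Order.lt_add_one_iff.2 (le_max_left _ _)) f₁ hf₁ h1,
        key y hy (Order.lt_add_one_iff.2 (le_max_right _ _)) f₂ hf₂ h2]
    have hlong : ∀ α < k, ∃ x < k, x ∈ X ∧ ∃ l < k, ∃ f' : Ordinal.{0} → Ordinal.{0}, α < l ∧
        (∀ a < l, f' a < k) ∧ x = 1 + enc l f' := by
      intro α hα
      by_contra hcon
      let P : Ordinal.{0} → Ordinal.{0} → Prop := fun l x => x < k ∧ x ∈ X ∧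
        ∃ f' : Ordinal.{0} → Ordinal.{0}, (∀ a < l, f' a < k) ∧ x = 1 + enc l f'
      obtain ⟨δ, hδ, hb⟩ := hreg.exists_bound_Iio (hreg.add_one_lt hα)
        (fun l => if h : ∃ x, P l x then h.choose else 0) (by
          intro l hl
          split_ifs with h
          · exact h.choose_spec.1
          · exact hreg.pos)
      obtain ⟨x, hxk, hδx, hxX⟩ := hXU δ hδ
      obtain ⟨γ, hγ, -, hg, hbγ, h3⟩ := hmem (x + 1) (hreg.add_one_lt hxk)
      rcases h3 x hxX (Order.lt_add_one_iff.2 le_rfl) with rfl | ⟨l, hl, h5⟩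
      · have := (hb 0 (Order.lt_add_one_iff.2 (zero_le))).trans_le hδx
        exact absurd this not_lt_zero
      · have hv : ∀ a < l, F a γ < k := fun a ha => (hF γ hγ hg.1 a (ha.trans hl)).trans hγ
        have hlα : l < α + 1 := by
          rw [Order.lt_add_one_iff]
          by_contra! hαl
          exact hcon ⟨x, hxk, hxX, l, hl.trans hγ, _, hαl, hv, h5⟩
        have hex : ∃ x, P l x := ⟨x, hxk, hxX, _, hv, h5⟩
        have h6 := hb l hlα
        simp only [hex, dite_true] at h6
        obtain ⟨h7, h8, f', h9, h10⟩ := hex.choose_spec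
        have := huniq _ hxX hxk _ h8 h7 l (hl.trans hγ) _ _ hv h9 h5 h10
        rw [← this] at h6
        exact absurd h6 (not_lt.2 hδx)
    choose! x hxk hxX l hlk f' hαl hf'k hxe using hlong
    refine ⟨fun α => f' α α, fun β hβ => ?_⟩
    obtain ⟨δ, hδ, hb⟩ := hreg.exists_bound_Iio hβ x fun α hα => hxk α (hα.trans hβ)
    obtain ⟨γ, hγ, hS, hg, hbγ, h3⟩ := hmem (max β δ) (max_lt hβ hδ)
    refine ⟨γ, hγ, hS, hg.1, (le_max_left _ _).trans_lt hbγ, ?_, ?_⟩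
    · intro i hi
      have hone : (1 : Ordinal.{0}) < γ := Ordinal.one_lt_omega0.trans hg.1.omega0_lt
      have h4 := hg.2 (max i 1) (max_lt hi hone) (le_max_right _ _)
      rcases le_total i 1 with h5 | h5
      · rcases h5.lt_or_eq with h6 | rfl
        · obtain rfl := Order.lt_one_iff.1 h6
          exact (((le_max_right _ _).trans (le_max_left _ _)).trans_lt h4)
        · rw [max_self] at h4
          exact (((le_max_left _ _).trans (le_max_left _ _)).trans_lt h4)
      · rw [max_eq_left h5] at h4
        exact (((le_max_left _ _).trans (le_max_left _ _)).trans_lt h4)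
    · intro α hα
      have hαk := hα.trans hβ
      rcases h3 (x α) (hxX α hαk) ((hb α hα).trans_le (le_max_right _ _)) with h4 | ⟨l', hl', h5⟩
      · rw [hxe α hαk] at h4
        exact absurd h4 (by simp)
      · rw [hxe α hαk] at h5
        obtain ⟨h6, h7⟩ := enc3 _ (hlk α hαk) _ (hl'.trans hγ) _ _ (hf'k α hαk)
          (fun a ha => (hF γ hγ hg.1 a (ha.trans hl')).trans hγ) ((add_right_inj _).1 h5)
        exact (h7 α (hαl α hαk)).symm
  · exfalso
    obtain ⟨v, hvk, -, hvX⟩ := hXU 0 hreg.pos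
    have hmX : sInf X ∈ X := csInf_mem ⟨v, hvX⟩
    have hmin : ∀ x ∈ X, sInf X ≤ x := fun x hx => csInf_le' hx
    generalize sInf X = m at hmX hmin
    have hmk : m < k := (hmin v hvX).trans_lt hvk
    obtain ⟨ι, y, hι, hy, hyX⟩ := hreg.card_of_unbounded hXU
      (d := 2 ^ (max m.card ℵ₀)) (hk.2.isStrongPrelimit
        (max_lt (card_lt_of_lt hk.1 hmk) hk.2.aleph0_lt))
    obtain ⟨b, hbk, hb⟩ := hreg.exists_bound (ι := ι) (by
      rw [hι]
      exact hk.2.isStrongPrelimit (max_lt (card_lt_of_lt hk.1 hmk) hk.2.aleph0_lt)) y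
      (fun i => (hyX i).2)
    obtain ⟨γ, hγ, -, hbγ, h1, -⟩ := hX (max (max b ω) (max (G m) (m + 1)))
      (max_lt (max_lt hbk hωk) (max_lt (hG m hmk) (hreg.add_one_lt hmk)))
    have hmb : m < max (max b ω) (max (G m) (m + 1)) := (Order.lt_add_one_iff.2 le_rfl).trans_le
      ((le_max_right _ _).trans (le_max_right _ _))
    have hωb : ω ≤ max (max b ω) (max (G m) (m + 1)) := (le_max_right _ _).trans (le_max_left _ _)
    have hωγ : ω < γ := hωb.trans_lt hbγ
    have hg : ¬ Good γ := by
      intro hg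
      refine h0 ((h1 0 (Ordinal.omega0_pos.trans_le hωb)).1 ?_)
      simp only [A, hg, if_true]
      exact Or.inl rfl
    have hA : A γ = {x | L γ ≤ x ∧ (γ ≤ G (L γ) ∨ x = L γ ∨ ∃ α < L γ, x = f γ α)} := by
      simp only [A, hg, if_false]
    rw [hA] at h1
    have hL : L γ = m := by
      have h2 : L γ ≤ m := ((h1 m hmb).2 hmX).1
      exact le_antisymm h2 (hmin _ ((h1 (L γ) (h2.trans_lt hmb)).1 ⟨le_rfl, Or.inr (Or.inl rfl)⟩))
    rw [hL] at h1
    have hγG : ¬ γ ≤ G m := not_le.2 (((le_max_left _ _).trans (le_max_right _ _)).trans_lt hbγ)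
    have h2 : ∀ i, ∃ o : Option m.ToType, y i = o.elim m (fun t => f γ (ToType.toOrd t).1) := by
      intro i
      have h3 := (h1 (y i) ((hb i).trans_le ((le_max_left _ _).trans (le_max_left _ _)))).2
        (hyX i).1
      rcases h3.2 with h4 | h4 | ⟨α, hα, h4⟩
      · exact absurd h4 hγG
      · exact ⟨none, h4⟩
      · exact ⟨some (ToType.mk ⟨α, hα⟩), by simpa using h4⟩
    choose o ho using h2
    have h3 : #ι ≤ #(Option m.ToType) := mk_le_of_injective (f := o) fun i j hij => hy (by
      rw [ho, ho, hij])
    rw [hι, mk_option, mk_toType] at h3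
    have h4 : m.card + 1 ≤ max m.card ℵ₀ :=
      (add_le_add (le_max_left _ _) (one_le_aleph0.trans (le_max_right _ _))).trans
        (add_eq_self (le_max_right _ _)).le
    exact absurd (h3.trans h4) (not_le.2 (cantor _))

/-! ## Clubs, stationary sets and 1-clubs of ordinals -/

/-- `C ∩ γ` is closed unbounded in `γ`. -/
def IsClubOrd (C : Set Ordinal.{0}) (γ : Ordinal.{0}) : Prop :=
  (∀ ξ < γ, ∃ η ∈ C, η < γ ∧ ξ ≤ η) ∧
  ∀ β < γ, 0 < β → (∀ ξ < β, ∃ η ∈ C, η < β ∧ ξ < η) → β ∈ C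

/-- `S ∩ γ` is stationary in `γ`. -/
def IsStationaryOrd (S : Set Ordinal.{0}) (γ : Ordinal.{0}) : Prop :=
  ∀ C, IsClubOrd C γ → ∃ x < γ, x ∈ S ∧ x ∈ C

/-- `C ∩ k` is 1-club in `k`. -/
def IsOneClubOrd (C : Set Ordinal.{0}) (k : Ordinal.{0}) : Prop :=
  IsStationaryOrd C k ∧ ∀ γ < k, IsInaccOrd γ → IsStationaryOrd C γ → γ ∈ C

theorem IsRegOrd.isClubOrd_closed {γ : Ordinal.{0}} (hγ : IsRegOrd γ) (hω : ω < γ)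
    {h : Ordinal.{0} → Ordinal.{0}} (hh : ∀ α < γ, h α < γ) :
    IsClubOrd {δ | 0 < δ ∧ ∀ α < δ, h α < δ} γ := by
  refine ⟨fun ξ hξ => ?_, fun β _ h0 hβ => ⟨h0, fun α hα => ?_⟩⟩
  · choose! b hb1 hb2 using fun x (hx : x < γ) =>
      hγ.exists_bound_Iio hx h fun α hα => hh α (hα.trans hx)
    let x : ℕ → Ordinal.{0} := fun n => Nat.rec (ξ + 1) (fun _ y => max (y + 1) (b y)) n
    have hx : ∀ n, x n < γ := by
      intro n
      induction n with
      | zero => exact hγ.add_one_lt hξ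
      | succ n ih => exact max_lt (hγ.add_one_lt ih) (hb1 _ ih)
    obtain ⟨δ, hδ, hxδ⟩ := hγ.exists_bound (ι := ℕ) (by
      rw [mk_nat, ← ord_lt_ord, ord_aleph0, hγ.1]; exact hω) x hx
    have hsup : ξ < ⨆ n, x n := (Order.lt_add_one_iff.2 le_rfl).trans_le (Ordinal.le_iSup x 0)
    refine ⟨⨆ n, x n, ⟨pos_of_gt hsup, fun α hα => ?_⟩,
      (Ordinal.iSup_le fun n => (hxδ n).le).trans_lt hδ, hsup.le⟩
    obtain ⟨n, hn⟩ := Ordinal.lt_iSup_iff.1 hα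
    exact (hb2 _ (hx n) α hn).trans_le
      ((le_max_right (x n + 1) (b (x n))).trans (Ordinal.le_iSup x (n + 1)))
  · obtain ⟨η, hη, hηβ, hαη⟩ := hβ α hα
    exact (hη.2 α hαη).trans hηβ

theorem IsStationaryOrd.exists_gt {S : Set Ordinal.{0}} {γ α : Ordinal.{0}} (hγ : IsRegOrd γ)
    (h : IsStationaryOrd S γ) (hα : α < γ) : ∃ x < γ, x ∈ S ∧ α < x := by
  refine h {x | α < x} ⟨fun ξ hξ => ⟨max ξ α + 1, ?_, hγ.add_one_lt (max_lt hξ hα), ?_⟩, ?_⟩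
  · exact Set.mem_ofPred_eq ▸ Order.lt_add_one_iff.2 (le_max_right ξ α)
  · exact (le_max_left _ _).trans (Order.lt_add_one_iff.2 le_rfl).le
  · intro β _ h0 hβ
    obtain ⟨η, hη, hηβ, -⟩ := hβ 0 h0
    exact lt_trans hη hηβ

theorem RegressiveGuess.exists_mem_oneClub {k : Ordinal.{0}} {S C : Set Ordinal.{0}}
    (hk : IsInaccOrd k) (h : RegressiveGuess k S) (hC : IsOneClubOrd C k) :
    ∃ γ < k, γ ∈ S ∧ γ ∈ C := by
  by_contra! hcon
  have hD : ∀ γ, ∃ D, γ < k → IsInaccOrd γ → γ ∈ S →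
      IsClubOrd D γ ∧ ∀ x < γ, x ∈ C → x ∉ D := by
    intro γ
    by_cases hc : γ < k ∧ IsInaccOrd γ ∧ γ ∈ S
    · have h1 : ¬ IsStationaryOrd C γ := fun hs =>
        hcon γ hc.1 hc.2.2 (hC.2 γ hc.1 hc.2.1 hs)
      simp only [IsStationaryOrd] at h1
      push Not at h1
      obtain ⟨D, h2, h3⟩ := h1
      exact ⟨D, fun _ _ _ => ⟨h2, h3⟩⟩
    · exact ⟨∅, fun h1 h2 h3 => absurd ⟨h1, h2, h3⟩ hc⟩
  choose D hD using hD
  have hF : ∀ α γ, ∃ f, γ < k → IsInaccOrd γ → α < γ → f < γ ∧ (γ ∈ S → f ∈ D γ ∧ α < f) := by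
    intro α γ
    by_cases hc : γ < k ∧ IsInaccOrd γ ∧ α < γ ∧ γ ∈ S
    · obtain ⟨η, h1, h2, h3⟩ := (hD γ hc.1 hc.2.1 hc.2.2.2).1.1 (α + 1)
        (hc.2.1.isRegOrd.add_one_lt hc.2.2.1)
      exact ⟨η, fun _ _ _ => ⟨h2, fun _ => ⟨h1, Order.add_one_le_iff.1 h3⟩⟩⟩
    · exact ⟨0, fun h1 h2 h3 => ⟨h2.isRegOrd.pos, fun h4 => absurd ⟨h1, h2, h3, h4⟩ hc⟩⟩
  choose F hF using hF
  obtain ⟨V, hV⟩ := h F (fun γ hγ hi α hα => (hF α γ hγ hi hα).1) id fun _ h => h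
  have hVk : ∀ α < k, V α < k := by
    intro α hα
    obtain ⟨γ, hγ, -, hi, hαγ, -, h1⟩ := hV (α + 1) (hk.isRegOrd.add_one_lt hα)
    rw [← h1 α (Order.lt_add_one_iff.2 le_rfl)]
    exact (hF α γ hγ hi ((Order.lt_add_one_iff.2 le_rfl).trans hαγ)).1.trans hγ
  obtain ⟨δ, hδ, hδC, h0, hδV⟩ := hC.1 _ (hk.isRegOrd.isClubOrd_closed hk.omega0_lt hVk)
  obtain ⟨γ, hγ, hγS, hi, hδγ, -, h1⟩ := hV δ hδ
  obtain ⟨h2, h3⟩ := hD γ hγ hi hγS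
  refine h3 δ hδγ hδC (h2.2 δ hδγ h0 fun ξ hξ => ?_)
  obtain ⟨-, h4⟩ := hF ξ γ hγ hi (hξ.trans hδγ)
  refine ⟨F ξ γ, (h4 hγS).1, ?_, (h4 hγS).2⟩
  rw [h1 ξ hξ]
  exact hδV ξ hξ

theorem RegressiveGuess.of_meets_oneClub {k : Ordinal.{0}} {S : Set Ordinal.{0}}
    (hk : IsInaccOrd k) (h : RegressiveGuess k Set.univ)
    (hS : ∀ C, IsOneClubOrd C k → ∃ γ < k, γ ∈ S ∧ γ ∈ C) : RegressiveGuess k S := by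
  intro F hF g hg
  have hreg := hk.isRegOrd
  let T : (Ordinal.{0} → Ordinal.{0}) → Ordinal.{0} → Set Ordinal.{0} := fun V β =>
    {δ | δ < k ∧ δ ∈ S ∧ IsInaccOrd δ ∧ (∀ l < δ, g l < δ) ∧ ∀ α < β, F α δ = V α}
  let Unb : Set Ordinal.{0} → Prop := fun X => ∀ ξ < k, ∃ δ ∈ X, ξ < δ
  have hT : ∀ V V' β, (∀ α < β, V α = V' α) → T V β = T V' β := by
    intro V V' β hVV
    ext δ
    constructor
    · rintro ⟨h1, h2, h3, h4, h5⟩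
      exact ⟨h1, h2, h3, h4, fun α hα => (h5 α hα).trans (hVV α hα)⟩
    · rintro ⟨h1, h2, h3, h4, h5⟩
      exact ⟨h1, h2, h3, h4, fun α hα => (h5 α hα).trans (hVV α hα).symm⟩
  by_contra hcon
  have hno : ¬ ∃ V : Ordinal.{0} → Ordinal.{0}, ∀ β < k, Unb (T V β) := by
    rintro ⟨V, hV⟩
    refine hcon ⟨V, fun β hβ => ?_⟩
    obtain ⟨δ, ⟨h1, h2, h3, h4, h5⟩, h6⟩ := hV β hβ β hβ
    exact ⟨δ, h1, h2, h3, h6, h4, h5⟩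
  have hbound : ∀ X, ∃ ξ < k, ¬ Unb X → ∀ δ ∈ X, δ ≤ ξ := by
    intro X
    by_cases hX : Unb X
    · exact ⟨0, hreg.pos, fun h => absurd hX h⟩
    · simp only [Unb] at hX
      push Not at hX
      obtain ⟨ξ, h1, h2⟩ := hX
      exact ⟨ξ, h1, fun _ => h2⟩
  choose e he1 he2 using hbound
  choose! gE hgE1 hgE2 using fun b (hb : b < k) =>
    hk.exists_bound_code (enc := fun l f => e (T f l)) (fun _ _ => he1 _)
      (fun l f f' hff => by simp only [hT f f' l hff]) hb
  let G : Ordinal.{0} → Ordinal.{0} := fun l => max (gE l) (g l)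
  let Br : Ordinal.{0} → (Ordinal.{0} → Ordinal.{0}) → Prop := fun γ V =>
    (∀ α < γ, V α < γ) ∧ ∀ β < γ, Unb (T V β)
  have hclub : IsOneClubOrd {γ | IsInaccOrd γ ∧ (∀ l < γ, G l < γ) ∧ ¬ ∃ V, Br γ V} k := by
    refine ⟨fun D hD => ?_, fun γ hγ hi hst => ⟨hi, fun l hl => ?_, ?_⟩⟩
    · by_contra! hdis
      choose! nx hnx1 hnx2 hnx3 using hD.1
      let F' : Ordinal.{0} → Ordinal.{0} → Ordinal.{0} := fun α γ =>
        if h : ∃ V, Br γ V then h.choose α else 0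
      obtain ⟨V, hV⟩ := h F' (by
        intro γ hγ hi α hα
        by_cases hb : ∃ V, Br γ V
        · simp only [F', hb, dite_true]
          exact hb.choose_spec.1 α hα
        · simp only [F', hb, dite_false]
          exact hi.isRegOrd.pos) (fun l => max (G l) (nx (l + 1)))
          fun l hl => max_lt (max_lt (hgE1 l hl) (hg l hl)) (hnx2 _ (hreg.add_one_lt hl))
      refine hno ⟨V, fun β hβ => ?_⟩
      obtain ⟨γ, hγ, -, hi, hβγ, hcl, h1⟩ := hV β hβ
      have hγD : γ ∈ D := by
        refine hD.2 γ hγ hi.isRegOrd.pos fun ξ hξ => ⟨nx (ξ + 1), ?_, ?_, ?_⟩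
        · exact hnx1 _ (hreg.add_one_lt (hξ.trans hγ))
        · exact (le_max_right _ _).trans_lt (hcl ξ hξ)
        · exact Order.add_one_le_iff.1 (hnx3 _ (hreg.add_one_lt (hξ.trans hγ)))
      have hb : ∃ V, Br γ V := by
        by_contra hb
        exact hdis γ hγ ⟨hi, fun l hl => (le_max_left _ _).trans_lt (hcl l hl), not_exists.1 hb⟩ hγD
      rw [← hT hb.choose V β fun α hα => by
        have := h1 α hα
        simpa only [F', hb, dite_true] using this]
      exact hb.choose_spec.2 β hβγ
    · obtain ⟨x, hx, hxC, hlx⟩ := hst.exists_gt hi.isRegOrd hl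
      exact (hxC.2.1 l hlx).trans hx
    · rintro ⟨V, hV1, hV2⟩
      obtain ⟨δ, hδ, hδC, -, hδV⟩ := hst _ (hi.isRegOrd.isClubOrd_closed hi.omega0_lt hV1)
      exact hδC.2.2 ⟨V, hδV, fun β hβ => hV2 β (hβ.trans hδ)⟩
  obtain ⟨γ, hγ, hγS, hi, hcl, hbr⟩ := hS _ hclub
  refine hbr ⟨fun α => F α γ, fun α hα => hF γ hγ hi α hα, fun β hβ => ?_⟩
  by_contra hU
  obtain ⟨b, hb, hb2⟩ := hi.isRegOrd.exists_bound_Iio hβ (fun α => F α γ)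
    fun α hα => hF γ hγ hi α (hα.trans hβ)
  have hm : max b (β + 1) < γ := max_lt hb (hi.isRegOrd.add_one_lt hβ)
  have h1 := hgE2 (max b (β + 1)) (hm.trans hγ) β
    ((Order.lt_add_one_iff.2 le_rfl).trans_le (le_max_right _ _)) (fun α => F α γ)
    fun α hα => (hb2 α hα).trans_le (le_max_left _ _)
  have h2 := he2 _ hU γ
    ⟨hγ, hγS, hi, fun l hl => (le_max_right _ _).trans_lt (hcl l hl), fun _ _ => rfl⟩
  exact absurd (h2.trans_lt (h1.trans ((le_max_left _ _).trans_lt (hcl _ hm)))) (lt_irrefl _)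

/-! ## Satisfaction in transitive sets -/

/-- Satisfaction of a formula by elements of `M`. -/
abbrev Sat (M : ZFSet.{0}) {n : ℕ} (φ : memLang.BoundedFormula Empty n) (v : Fin n → M.toSet) :
    Prop :=
  φ.Realize (fun e => e.elim) v

theorem realizeIn_iff_sat {M : ZFSet.{0}} {n : ℕ} {φ : memLang.BoundedFormula Empty n}
    {v : Fin n → ZFSet.{0}} (hv : ∀ i, v i ∈ M) : RealizeIn M φ v ↔ Sat M φ fun i => ⟨v i, hv i⟩ :=
  ⟨fun ⟨_, h⟩ => h, fun h => ⟨hv, h⟩⟩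

@[simp]
theorem realize_mem' {M : ZFSet.{0}} {n : ℕ} (i j : Fin n) (e : Empty → M.toSet)
    (v : Fin n → M.toSet) : (mem' n i j).Realize e v ↔ (v i).1 ∈ (v j).1 :=
  BoundedFormula.realize_rel₂

@[simp]
theorem realize_eq' {M : ZFSet.{0}} {n : ℕ} (i j : Fin n) (e : Empty → M.toSet)
    (v : Fin n → M.toSet) : (eq' n i j).Realize e v ↔ v i = v j := by
  simp [eq', BoundedFormula.realize_bdEqual]

/-- The formula expressing that the variable `0` is the ordered pair of the variables
`1` and `2`. -/
def orderedPairFormula : memLang.BoundedFormula Empty 3 :=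
  ((mem' 5 3 0 ⊓ mem' 5 4 0) ⊓ (mem' 5 1 3 ⊓ (mem' 5 1 4 ⊓ mem' 5 2 4)) ⊓
    (((mem' 6 5 3).imp (eq' 6 5 1)).all ⊓ (((mem' 6 5 4).imp (eq' 6 5 1 ⊔ eq' 6 5 2)).all ⊓
      ((mem' 6 5 0).imp (eq' 6 5 3 ⊔ eq' 6 5 4)).all))).ex.ex

theorem sat_orderedPairFormula {M : ZFSet.{0}} (hM : M.IsTransitive) (v : Fin 3 → M.toSet) :
    Sat M orderedPairFormula v ↔ (v 0).1 = pair (v 1).1 (v 2).1 := by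
  have tr : ∀ {x y : ZFSet.{0}}, x ∈ y → y ∈ M → x ∈ M := fun h1 h2 => hM _ h2 h1
  have e : Sat M orderedPairFormula v ↔ ∃ p q : M.toSet,
      ((p.1 ∈ (v 0).1 ∧ q.1 ∈ (v 0).1) ∧ ((v 1).1 ∈ p.1 ∧ (v 1).1 ∈ q.1 ∧ (v 2).1 ∈ q.1)) ∧
      (∀ w : M.toSet, w.1 ∈ p.1 → w = v 1) ∧ (∀ w : M.toSet, w.1 ∈ q.1 → w = v 1 ∨ w = v 2) ∧
      ∀ w : M.toSet, w.1 ∈ (v 0).1 → w = p ∨ w = q := by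
    simp only [Sat, orderedPairFormula, BoundedFormula.realize_ex, BoundedFormula.realize_inf,
      BoundedFormula.realize_sup, BoundedFormula.realize_all, BoundedFormula.realize_imp,
      realize_mem', realize_eq']
    rfl
  rw [e]
  constructor
  · rintro ⟨p, q, ⟨⟨h1, h2⟩, h3, h4, h5⟩, h6, h7, h8⟩
    have hp : p.1 = {(v 1).1} := by
      ext w
      rw [mem_singleton]
      exact ⟨fun hw => congrArg Subtype.val (h6 ⟨w, tr hw p.2⟩ hw), fun hw => hw ▸ h3⟩
    have hq : q.1 = {(v 1).1, (v 2).1} := by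
      ext w
      rw [mem_pair]
      refine ⟨fun hw => ?_, ?_⟩
      · exact (h7 ⟨w, tr hw q.2⟩ hw).imp (congrArg Subtype.val) (congrArg Subtype.val)
      · rintro (rfl | rfl)
        exacts [h4, h5]
    ext w
    rw [pair, mem_pair, ← hp, ← hq]
    refine ⟨fun hw => ?_, ?_⟩
    · exact (h8 ⟨w, tr hw (v 0).2⟩ hw).imp (congrArg Subtype.val) (congrArg Subtype.val)
    · rintro (rfl | rfl)
      exacts [h1, h2]
  · intro h
    have h1 : ({(v 1).1} : ZFSet) ∈ (v 0).1 := by rw [h, pair, mem_pair]; exact Or.inl rfl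
    have h2 : ({(v 1).1, (v 2).1} : ZFSet) ∈ (v 0).1 := by rw [h, pair, mem_pair]; exact Or.inr rfl
    refine ⟨⟨_, tr h1 (v 0).2⟩, ⟨_, tr h2 (v 0).2⟩, ⟨⟨h1, h2⟩, ?_⟩, ?_, ?_, ?_⟩
    · simp
    · intro w hw
      exact Subtype.ext (mem_singleton.1 hw)
    · intro w hw
      exact (mem_pair.1 hw).imp Subtype.ext Subtype.ext
    · intro w hw
      rw [h, pair, mem_pair] at hw
      exact hw.imp Subtype.ext Subtype.ext

/-! ## The collapse of a reduced power -/

section ReducedPower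

variable {Tm : Type} {M : ZFSet.{0}} (U : Filter Ordinal.{0}) (ev : Tm → Ordinal.{0} → M.toSet)

/-- Membership of terms modulo a filter. -/
def TermMem (t s : Tm) : Prop := ∀ᶠ γ in U, (ev t γ).1 ∈ (ev s γ).1

variable {U ev}

theorem wellFounded_termMem [U.NeBot] (hU : ∀ Q : ℕ → Ordinal.{0} → Prop,
    (∀ n, ∀ᶠ γ in U, Q n γ) → ∀ᶠ γ in U, ∀ n, Q n γ) : WellFounded (TermMem U ev) := by
  rw [wellFounded_iff_isEmpty_descending_chain]
  refine ⟨fun ⟨f, hf⟩ => ?_⟩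
  obtain ⟨γ, hγ⟩ := (hU _ hf).exists
  exact (wellFounded_iff_isEmpty_descending_chain.1 mem_wf).false
    ⟨fun n => (ev (f n) γ).1, hγ⟩

theorem exists_collapse (h : WellFounded (TermMem U ev)) : ∃ π : Tm → ZFSet.{0},
    ∀ s x, x ∈ π s ↔ ∃ t, TermMem U ev t s ∧ π t = x := by
  let π := h.fix (C := fun _ => ZFSet.{0}) fun s ih =>
    ZFSet.range fun t : {t // TermMem U ev t s} => ih t.1 t.2
  refine ⟨π, fun s x => ?_⟩
  have : π s = ZFSet.range fun t : {t // TermMem U ev t s} => π t.1 := h.fix_eq _ s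
  rw [this, mem_range]
  simp

theorem collapse_eq_iff (hwf : WellFounded (TermMem U ev)) {π : Tm → ZFSet.{0}}
    (hπ : ∀ s x, x ∈ π s ↔ ∃ t, TermMem U ev t s ∧ π t = x) (hM : M.IsTransitive)
    (hdec : ∀ (n : ℕ) (φ : memLang.BoundedFormula Empty n) (t : Fin n → Tm),
      (∀ᶠ γ in U, Sat M φ fun i => ev (t i) γ) ∨ ∀ᶠ γ in U, ¬ Sat M φ fun i => ev (t i) γ)
    (hsk : ∀ (n : ℕ) (φ : memLang.BoundedFormula Empty (n + 1)) (t : Fin n → Tm), ∃ u, ∀ γ,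
      Sat M φ.ex (fun i => ev (t i) γ) → Sat M φ (Fin.snoc (fun i => ev (t i) γ) (ev u γ)))
    [U.NeBot] (t s : Tm) : π t = π s ↔ ∀ᶠ γ in U, ev t γ = ev s γ := by
  constructor
  · induction t using hwf.induction generalizing s with
    | _ t ih =>
    intro hts
    have hmem : ∀ u, TermMem U ev u t ↔ TermMem U ev u s := by
      intro u
      constructor
      · intro hu
        obtain ⟨u', h1, h2⟩ := (hπ s (π u)).1 (hts ▸ (hπ t _).2 ⟨u, hu, rfl⟩)
        have := ih u hu u' h2.symm
        filter_upwards [h1, this] with γ h3 h4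
        rw [h4]; exact h3
      · intro hu
        obtain ⟨u', h1, h2⟩ := (hπ t (π u)).1 (hts ▸ (hπ s _).2 ⟨u, hu, rfl⟩)
        have := ih u' h1 u h2
        filter_upwards [h1, this] with γ h3 h4
        rw [← h4]; exact h3
    have hsub : ∀ t s, (∀ u, TermMem U ev u t → TermMem U ev u s) →
        ∀ᶠ γ in U, (ev t γ).1 ⊆ (ev s γ).1 := by
      intro t s hts
      have e : ∀ γ, Sat M ((mem' 3 2 0) ⊓ (mem' 3 2 1).not).ex (fun i => ev (![t, s] i) γ) ↔
          ∃ x : M.toSet, x.1 ∈ (ev t γ).1 ∧ x.1 ∉ (ev s γ).1 := by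
        intro γ
        simp only [Sat, BoundedFormula.realize_ex, BoundedFormula.realize_inf,
          BoundedFormula.realize_not, realize_mem']
        rfl
      rcases hdec 2 ((mem' 3 2 0) ⊓ (mem' 3 2 1).not).ex ![t, s] with h1 | h1
      · exfalso
        obtain ⟨u, hu⟩ := hsk 2 ((mem' 3 2 0) ⊓ (mem' 3 2 1).not) ![t, s]
        have h2 : ∀ᶠ γ in U, (ev u γ).1 ∈ (ev t γ).1 ∧ (ev u γ).1 ∉ (ev s γ).1 := by
          filter_upwards [h1] with γ h3
          have := hu γ h3
          simp only [Sat, BoundedFormula.realize_inf,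
            BoundedFormula.realize_not, realize_mem'] at this
          exact this
        obtain ⟨γ, h3, h4⟩ := ((hts u (h2.mono fun _ h => h.1)).and h2).exists
        exact h4.2 h3
      · filter_upwards [h1] with γ h2
        rw [e] at h2
        intro x hx
        by_contra hxs
        exact h2 ⟨⟨x, hM _ (ev t γ).2 hx⟩, hx, hxs⟩
    filter_upwards [hsub t s fun u => (hmem u).1, hsub s t fun u => (hmem u).2] with γ h1 h2
    exact Subtype.ext (subset_antisymm h1 h2)
  · intro h
    ext x
    rw [hπ, hπ]
    refine exists_congr fun u => and_congr_left fun _ => ⟨fun hu => ?_, fun hu => ?_⟩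
    · filter_upwards [h, hu] with γ h1 h2
      rw [← h1]; exact h2
    · filter_upwards [h, hu] with γ h1 h2
      rw [h1]; exact h2

/-- Łoś's theorem for the transitive collapse of a reduced power which decides all formulas. -/
theorem sat_collapse_iff (hwf : WellFounded (TermMem U ev)) {π : Tm → ZFSet.{0}}
    (hπ : ∀ s x, x ∈ π s ↔ ∃ t, TermMem U ev t s ∧ π t = x) (hM : M.IsTransitive)
    (hdec : ∀ (n : ℕ) (φ : memLang.BoundedFormula Empty n) (t : Fin n → Tm),
      (∀ᶠ γ in U, Sat M φ fun i => ev (t i) γ) ∨ ∀ᶠ γ in U, ¬ Sat M φ fun i => ev (t i) γ)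
    (hsk : ∀ (n : ℕ) (φ : memLang.BoundedFormula Empty (n + 1)) (t : Fin n → Tm), ∃ u, ∀ γ,
      Sat M φ.ex (fun i => ev (t i) γ) → Sat M φ (Fin.snoc (fun i => ev (t i) γ) (ev u γ)))
    [U.NeBot] {N : ZFSet.{0}} (hN : ∀ x, x ∈ N ↔ ∃ t, π t = x) {n : ℕ}
    (φ : memLang.BoundedFormula Empty n) (t : Fin n → Tm) :
    Sat N φ (fun i => ⟨π (t i), (hN _).2 ⟨t i, rfl⟩⟩) ↔
      ∀ᶠ γ in U, Sat M φ fun i => ev (t i) γ := by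
  have hterm : ∀ {n : ℕ} (a : memLang.Term (Empty ⊕ Fin n)), ∃ i, a = Term.var (Sum.inr i) := by
    intro n a
    cases a with
    | var x => rcases x with e | i; exacts [e.elim, ⟨i, rfl⟩]
    | func f _ => exact f.elim
  have heq := collapse_eq_iff hwf hπ hM hdec hsk
  have hmem : ∀ t s, π t ∈ π s ↔ TermMem U ev t s := by
    intro t s
    rw [hπ]
    refine ⟨?_, fun h => ⟨t, h, rfl⟩⟩
    rintro ⟨u, h1, h2⟩
    filter_upwards [h1, (heq u t).1 h2] with γ h3 h4
    rw [← h4]; exact h3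
  induction φ with
  | falsum => simp [Sat, BoundedFormula.Realize, Filter.NeBot.ne (f := U) inferInstance]
  | @equal m a b =>
    obtain ⟨i, rfl⟩ := hterm a
    obtain ⟨j, rfl⟩ := hterm b
    have e1 : Sat N (eq' m i j) (fun i => ⟨π (t i), (hN _).2 ⟨t i, rfl⟩⟩) ↔ π (t i) = π (t j) := by
      simp [Sat, Subtype.ext_iff]
    have e2 : ∀ γ, Sat M (eq' m i j) (fun i => ev (t i) γ) ↔ ev (t i) γ = ev (t j) γ := by
      simp [Sat]
    have e3 := heq (t i) (t j)
    simp only [← e2] at e3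
    exact e1.trans e3
  | @rel m l R ts =>
    match l, R, ts with
    | 0, R, _ => exact Empty.elim R
    | 1, R, _ => exact Empty.elim R
    | 2, R, ts =>
      obtain ⟨i, hi⟩ := hterm (ts 0)
      obtain ⟨j, hj⟩ := hterm (ts 1)
      have h0 : BoundedFormula.rel R ts = mem' m i j := by
        change _ = BoundedFormula.rel memRel _
        congr 1
        funext x
        match x with
        | 0 => exact hi
        | 1 => exact hj
      rw [h0]
      have e2 : ∀ γ, Sat M (mem' m i j) (fun i => ev (t i) γ) ↔
          (ev (t i) γ).1 ∈ (ev (t j) γ).1 := by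
        simp [Sat]
      have e1 : Sat N (mem' m i j) (fun i => ⟨π (t i), (hN _).2 ⟨t i, rfl⟩⟩) ↔
          π (t i) ∈ π (t j) := by
        simp [Sat]
      rw [e1, hmem]
      simp only [e2]
      rfl
    | (_ + 3), R, _ => exact Empty.elim R
  | imp φ ψ ih1 ih2 =>
    refine (imp_congr (ih1 t) (ih2 t)).trans ?_
    constructor
    · intro h
      rcases hdec _ φ t with h1 | h1
      · exact (h h1).mono fun _ h2 _ => h2
      · exact h1.mono fun _ h2 h3 => absurd h3 h2
    · intro h h1
      filter_upwards [h, h1] with γ h2 h3 using h2 h3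
  | @all m φ ih =>
    have hsnoc : ∀ u : Tm, (fun i => (⟨π ((Fin.snoc t u : Fin (m + 1) → Tm) i), (hN _).2 ⟨_, rfl⟩⟩ :
        N.toSet)) = Fin.snoc (fun i => (⟨π (t i), (hN _).2 ⟨t i, rfl⟩⟩ : N.toSet))
          ⟨π u, (hN _).2 ⟨u, rfl⟩⟩ := by
      intro u
      funext i
      refine Fin.lastCases ?_ (fun i => ?_) i <;> simp
    have hsnoc' : ∀ (u : Tm) γ, (fun i => ev ((Fin.snoc t u : Fin (m + 1) → Tm) i) γ) =
        Fin.snoc (fun i => ev (t i) γ) (ev u γ) := by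
      intro u γ
      funext i
      refine Fin.lastCases ?_ (fun i => ?_) i <;> simp
    have ih' : ∀ u, _ := fun u => ih (Fin.snoc t u)
    simp only [hsnoc, hsnoc'] at ih'
    have e : ∀ γ, ¬ Sat M φ.all (fun i => ev (t i) γ) ↔ Sat M φ.not.ex fun i => ev (t i) γ := by
      intro γ
      simp [Sat]
    constructor
    · intro h
      rcases hdec _ φ.all t with h1 | h1
      · exact h1
      · exfalso
        obtain ⟨u, hu⟩ := hsk _ φ.not t
        have h2 := (ih' u).1 (h ⟨π u, (hN _).2 ⟨u, rfl⟩⟩)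
        obtain ⟨γ, h3, h4⟩ := (h1.and h2).exists
        have h5 := hu γ ((e γ).1 h3)
        simp only [Sat, BoundedFormula.realize_not] at h5
        exact h5 h4
    · rintro h ⟨x, hx⟩
      obtain ⟨u, rfl⟩ := (hN x).1 hx
      exact (ih' u).2 (h.mono fun γ h1 => h1 (ev u γ))

end ReducedPower

theorem RegressiveGuess.exists_filter {k : Ordinal.{0}} {S : Set Ordinal.{0}} (hk : IsInaccOrd k)
    (h : RegressiveGuess k S) {I : Type} (hI : #I ≤ k.card)
    (F : I → Ordinal.{0} → Ordinal.{0}) (hF : ∀ i, ∀ γ < k, IsInaccOrd γ → F i γ < γ) :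
    ∃ U : Filter Ordinal.{0}, U.NeBot ∧ (∀ᶠ γ in U, γ < k ∧ γ ∈ S ∧ IsInaccOrd γ) ∧
      (∀ β < k, ∀ᶠ γ in U, β < γ) ∧
      (∀ ι : Type, #ι < k.card → ∀ Q : ι → Ordinal.{0} → Prop, (∀ x, ∀ᶠ γ in U, Q x γ) →
        ∀ᶠ γ in U, ∀ x, Q x γ) ∧ ∀ i, ∃ v, ∀ᶠ γ in U, F i γ = v := by
  have hreg := hk.isRegOrd
  obtain ⟨e⟩ : Nonempty (I ↪ k.ToType) := by rw [← Cardinal.le_def]; simpa using hI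
  let F' : Ordinal.{0} → Ordinal.{0} → Ordinal.{0} := fun α γ =>
    if h : ∃ i, (ToType.toOrd (e i)).1 = α then F h.choose γ else 0
  have hF' : ∀ i, F' (ToType.toOrd (e i)).1 = F i := by
    intro i
    have h1 : ∃ j, (ToType.toOrd (e j)).1 = (ToType.toOrd (e i)).1 := ⟨i, rfl⟩
    have h2 : h1.choose = i := e.injective (ToType.mk.symm.injective (Subtype.ext h1.choose_spec))
    funext γ
    simp only [F', h1, dite_true, h2]
  obtain ⟨V, hV⟩ := h F' (by
    intro γ hγ hi α _
    simp only [F']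
    split_ifs with h
    · exact hF _ γ hγ hi
    · exact hi.isRegOrd.pos) id fun _ h => h
  let B : Ordinal.{0} → Set Ordinal.{0} := fun β =>
    {γ | γ < k ∧ γ ∈ S ∧ IsInaccOrd γ ∧ β < γ ∧ ∀ α < β, F' α γ = V α}
  have hB : ∀ β β', β ≤ β' → B β' ⊆ B β := fun β β' hle γ hγ =>
    ⟨hγ.1, hγ.2.1, hγ.2.2.1, hle.trans_lt hγ.2.2.2.1, fun α hα => hγ.2.2.2.2 α (hα.trans_le hle)⟩
  let U : Filter Ordinal.{0} :=
    { sets := {X | ∃ β < k, B β ⊆ X}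
      univ_sets := ⟨0, hreg.pos, Set.subset_univ _⟩
      sets_of_superset := fun ⟨β, hβ, h1⟩ h2 => ⟨β, hβ, h1.trans h2⟩
      inter_sets := fun ⟨β, hβ, h1⟩ ⟨β', hβ', h2⟩ => ⟨max β β', max_lt hβ hβ',
        Set.subset_inter ((hB _ _ (le_max_left _ _)).trans h1)
          ((hB _ _ (le_max_right _ _)).trans h2)⟩ }
  have hU : ∀ p : Ordinal.{0} → Prop, (∀ᶠ γ in U, p γ) ↔ ∃ β < k, ∀ γ ∈ B β, p γ :=
    fun p => Iff.rfl
  refine ⟨U, ⟨fun hbot => ?_⟩, ?_, fun β hβ => ?_, fun ι hι Q hQ => ?_, fun i => ?_⟩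
  · have : ∀ᶠ γ in U, False := by rw [hbot]; exact Filter.eventually_bot
    obtain ⟨β, hβ, h1⟩ := (hU _).1 this
    obtain ⟨γ, h2, h3, h4, h5, -, h6⟩ := hV β hβ
    exact h1 γ ⟨h2, h3, h4, h5, h6⟩
  · exact (hU _).2 ⟨0, hreg.pos, fun γ hγ => ⟨hγ.1, hγ.2.1, hγ.2.2.1⟩⟩
  · exact (hU _).2 ⟨β, hβ, fun γ hγ => hγ.2.2.2.1⟩
  · choose β hβ h1 using fun x => (hU _).1 (hQ x)
    obtain ⟨δ, hδ, h2⟩ := hreg.exists_bound hι β hβ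
    exact (hU _).2 ⟨δ, hδ, fun γ hγ x => h1 x γ (hB _ _ (h2 x).le hγ)⟩
  · have h1 : (ToType.toOrd (e i)).1 < k := (ToType.toOrd (e i)).2
    refine ⟨V (ToType.toOrd (e i)).1, (hU _).2 ⟨_, hreg.add_one_lt h1, fun γ hγ => ?_⟩⟩
    rw [← hF']
    exact hγ.2.2.2.2 _ (Order.lt_add_one_iff.2 le_rfl)

theorem mk_sigma_boundedFormula_le : #(Σ n, memLang.BoundedFormula Empty n) ≤ ℵ₀ := by
  have h1 : ∀ n, Countable (memLang.Functions n) := fun n => inferInstanceAs (Countable Empty)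
  have h2 : ∀ n, Countable (memLang.Relations n) := fun n =>
    match n with
    | 0 => inferInstanceAs (Countable Empty)
    | 1 => inferInstanceAs (Countable Empty)
    | 2 => inferInstanceAs (Countable Unit)
    | (_ + 3) => inferInstanceAs (Countable Empty)
  have h3 : memLang.card ≤ ℵ₀ := mk_le_aleph0_iff.2 (by
    unfold Language.Symbols
    infer_instance)
  refine BoundedFormula.card_le.trans (max_le le_rfl ?_)
  simpa using h3

/-- The arity of the operations generating the terms: named functions, Skolem functions, and
formation of short sequences. -/
def termArity (k : Ordinal.{0}) (C : Type) :
    C ⊕ ((Σ n, memLang.BoundedFormula Empty (n + 1)) ⊕ k.ToType) → Type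
  | Sum.inl _ => Empty
  | Sum.inr (Sum.inl p) => Fin p.1
  | Sum.inr (Sum.inr b) => (ToType.toOrd b).1.ToType

/-- Any small family of functions into `M` is contained in a small family which is closed under
Skolem functions and formation of short sequences. -/
theorem exists_terms {k : Ordinal.{0}} (hk : IsInaccOrd k)
    (hpow : ∀ μ < k.card, k.card ^ μ ≤ k.card) {M : ZFSet.{0}} (hne : M.Nonempty)
    (hM : ∀ β < k, ∀ a : β.ToType → M.toSet, ∃ m : M.toSet, ∀ x, x ∈ m.1 ↔
      ∃ i, x = pair (toZFSet (ToType.toOrd i).1) (a i).1)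
    {C : Type} (hC : #C ≤ k.card) (c : C → Ordinal.{0} → M.toSet) :
    ∃ (Tm : Type) (ev : Tm → Ordinal.{0} → M.toSet), #Tm ≤ k.card ∧ (∀ i, ∃ t, ev t = c i) ∧
      (∀ (n : ℕ) (φ : memLang.BoundedFormula Empty (n + 1)) (t : Fin n → Tm), ∃ u, ∀ γ,
        Sat M φ.ex (fun i => ev (t i) γ) → Sat M φ (Fin.snoc (fun i => ev (t i) γ) (ev u γ))) ∧
      ∀ β < k, ∀ a : β.ToType → Tm, ∃ u, ∀ γ x, x ∈ (ev u γ).1 ↔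
        ∃ i, x = pair (toZFSet (ToType.toOrd i).1) (ev (a i) γ).1 := by
  obtain ⟨m₀, hm₀⟩ := hne
  have hω := hk.2.aleph0_lt.le
  have hsk : ∀ (n : ℕ) (φ : memLang.BoundedFormula Empty (n + 1)) (v : Fin n → M.toSet),
      ∃ x, Sat M φ.ex v → Sat M φ (Fin.snoc v x) := by
    intro n φ v
    by_cases h : Sat M φ.ex v
    · obtain ⟨x, hx⟩ := BoundedFormula.realize_ex.1 h
      exact ⟨x, fun _ => hx⟩
    · exact ⟨⟨m₀, hm₀⟩, fun h' => absurd h' h⟩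
  choose sk hsk using hsk
  have : Nonempty M.toSet := ⟨⟨m₀, hm₀⟩⟩
  choose! sq hsq using hM
  let step : (Σ a, termArity k C a → Ordinal.{0} → M.toSet) → Ordinal.{0} → M.toSet := fun p γ =>
    match p with
    | ⟨Sum.inl i, _⟩ => c i γ
    | ⟨Sum.inr (Sum.inl q), f⟩ => sk q.1 q.2 fun i => f i γ
    | ⟨Sum.inr (Sum.inr b), f⟩ => sq (ToType.toOrd b).1 fun i => f i γ
  refine ⟨WType (termArity k C), WType.elim _ step, ?_, ?_, ?_, ?_⟩
  · refine WType.cardinalMk_le_of_le' ?_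
    refine (Cardinal.sum_le_sum _ (fun _ => k.card) fun a => ?_).trans ?_
    · match a with
      | Sum.inl _ => simpa [termArity] using one_le_aleph0.trans hω
      | Sum.inr (Sum.inl p) => simpa [termArity] using power_nat_le hω
      | Sum.inr (Sum.inr b) =>
        simpa [termArity] using hpow _ (card_lt_of_lt hk.1 (ToType.toOrd b).2)
    · rw [sum_const']
      have h1 : #(Σ n, memLang.BoundedFormula Empty (n + 1)) ≤ ℵ₀ := by
        refine le_trans ?_ mk_sigma_boundedFormula_le
        refine mk_le_of_injective (f := fun p => ⟨p.1 + 1, p.2⟩) ?_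
        rintro ⟨n, φ⟩ ⟨m, ψ⟩ h
        simp only [Sigma.mk.injEq, Nat.add_right_cancel_iff] at h
        obtain ⟨rfl, h⟩ := h
        rw [eq_of_heq h]
      refine mul_le_of_le hω ?_ le_rfl
      simp only [mk_sum, Cardinal.lift_id, mk_toType]
      exact add_le_of_le hω hC (add_le_of_le hω (h1.trans hω) le_rfl)
  · intro i
    exact ⟨WType.mk (Sum.inl i) fun e : Empty => e.elim, rfl⟩
  · intro n φ t
    exact ⟨WType.mk (Sum.inr (Sum.inl ⟨n, φ⟩)) t, fun γ => hsk n φ _⟩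
  · intro β hβ a
    have hb : (ToType.toOrd (ToType.mk ⟨β, hβ⟩)).1 = β := by simp
    generalize ToType.mk (⟨β, hβ⟩ : Set.Iio k) = b at hb
    subst hb
    exact ⟨WType.mk (Sum.inr (Sum.inr b)) a, fun γ => hsq _ hβ _⟩

theorem zcard_toZFSet (o : Ordinal.{0}) : zcard o.toZFSet = Cardinal.lift.{1} o.card := by
  have := cardinalMk_coe_sort (x := o.toZFSet)
  rw [card_toZFSet] at this
  exact this

/-- An ordinal-indexed sequence of sets, as a set-theoretic function. -/
theorem exists_seq_function (β : Ordinal.{0}) (a : β.ToType → ZFSet.{0}) :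
    ∃ f : ZFSet.{0}, ∀ x, x ∈ f ↔ ∃ i, x = pair (toZFSet (ToType.toOrd i).1) (a i) := by
  refine ⟨ZFSet.range fun i => pair (toZFSet (ToType.toOrd i).1) (a i), fun x => ?_⟩
  rw [mem_range]
  simp [eq_comm]

theorem isFunc_of_mem_iff {β : Ordinal.{0}} {a : β.ToType → ZFSet.{0}} {f Y : ZFSet.{0}}
    (hf : ∀ x, x ∈ f ↔ ∃ i, x = pair (toZFSet (ToType.toOrd i).1) (a i)) (ha : ∀ i, a i ∈ Y) :
    IsFunc β.toZFSet Y f := by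
  refine ⟨fun x hx => ?_, fun z hz => ?_⟩
  · obtain ⟨i, rfl⟩ := (hf x).1 hx
    rw [pair_mem_prod]
    exact ⟨mem_toZFSet_iff.2 ⟨_, (ToType.toOrd i).2, rfl⟩, ha i⟩
  · obtain ⟨ξ, hξ, rfl⟩ := mem_toZFSet_iff.1 hz
    refine ⟨a (ToType.mk ⟨ξ, hξ⟩), (hf _).2 ⟨ToType.mk ⟨ξ, hξ⟩, by simp⟩, fun y hy => ?_⟩
    obtain ⟨i, hi⟩ := (hf _).1 hy
    obtain ⟨h1, rfl⟩ := pair_inj.1 hi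
    have h2 : ToType.mk ⟨ξ, hξ⟩ = i := by
      apply ToType.mk.symm.injective
      apply Subtype.ext
      rw [OrderIso.symm_apply_apply]
      exact toZFSet_injective h1
    rw [h2]

theorem exists_seq_of_isFunc {β : Ordinal.{0}} {f Y : ZFSet.{0}} (h : IsFunc β.toZFSet Y f) :
    ∃ a : β.ToType → ZFSet.{0}, (∀ i, a i ∈ Y) ∧
      ∀ x, x ∈ f ↔ ∃ i, x = pair (toZFSet (ToType.toOrd i).1) (a i) := by
  have hm : ∀ i : β.ToType, toZFSet (ToType.toOrd i).1 ∈ β.toZFSet := fun i =>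
    mem_toZFSet_iff.2 ⟨_, (ToType.toOrd i).2, rfl⟩
  choose a ha ha2 using fun i => h.2 _ (hm i)
  refine ⟨a, fun i => (pair_mem_prod.1 (h.1 (ha i))).2, fun x => ⟨fun hx => ?_, ?_⟩⟩
  · obtain ⟨z, hz, y, hy, rfl⟩ := mem_prod.1 (h.1 hx)
    obtain ⟨ξ, hξ, rfl⟩ := mem_toZFSet_iff.1 hz
    refine ⟨ToType.mk ⟨ξ, hξ⟩, ?_⟩
    have h1 := ha2 (ToType.mk ⟨ξ, hξ⟩) y (by simpa using hx)
    rw [← h1]; simp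
  · rintro ⟨i, rfl⟩
    exact ha i

theorem exists_seq_mem {k : Ordinal.{0}} {M : ZFSet.{0}}
    (hM : IsKappaModel k.toZFSet M) {β : Ordinal.{0}} (hβ : β < k) (a : β.ToType → M.toSet) :
    ∃ m : M.toSet, ∀ x, x ∈ m.1 ↔ ∃ i, x = pair (toZFSet (ToType.toOrd i).1) (a i).1 := by
  obtain ⟨f, hf⟩ := exists_seq_function β fun i => (a i).1
  have := hM.2.2.2.2.1 β.toZFSet (mem_toZFSet_iff.2 ⟨β, hβ, rfl⟩) f trivial
    (isFunc_of_mem_iff hf fun i => (a i).2)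
  exact ⟨⟨f, this⟩, hf⟩

theorem exists_sep {M : ZFSet.{0}} (hM : ModelsZFCminus M)
    (φ : memLang.BoundedFormula Empty 3) (f a : M.toSet) :
    ∃ b : M.toSet, ∀ z : M.toSet, z.1 ∈ b.1 ↔ z.1 ∈ a.1 ∧ Sat M φ ![f, a, z] := by
  have h := hM (sepAx 1 φ) (Or.inl (Or.inr (Set.mem_iUnion.2 ⟨1, φ, rfl⟩)))
  have h1 := BoundedFormula.realize_alls.1 h ![f]
  simp only [BoundedFormula.realize_ex, BoundedFormula.realize_all, BoundedFormula.realize_iff,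
    BoundedFormula.realize_inf, realize_mem'] at h1
  obtain ⟨b, hb⟩ := h1 a
  refine ⟨b, fun z => (hb z).trans (and_congr Iff.rfl ?_)⟩
  rw [BoundedFormula.realize_liftAt_one (by omega)]
  refine iff_of_eq (congrArg₂ (fun e v => BoundedFormula.Realize φ e v)
    (funext fun e => e.elim) ?_)
  funext i
  fin_cases i <;> rfl

theorem inter_mem_kappaModel {k : Ordinal.{0}} {M : ZFSet.{0}}
    (hM : IsKappaModel k.toZFSet M) {γ : Ordinal.{0}} (hγ : γ < k) (A : ZFSet.{0}) :
    A ∩ γ.toZFSet ∈ M := by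
  obtain ⟨-, hκ, htr, -, -, hZ⟩ := id hM
  have hγM : γ.toZFSet ∈ M := htr _ hκ (mem_toZFSet_iff.2 ⟨γ, hγ, rfl⟩)
  have hm : ∀ i : γ.ToType, toZFSet (ToType.toOrd i).1 ∈ γ.toZFSet := fun i =>
    mem_toZFSet_iff.2 ⟨_, (ToType.toOrd i).2, rfl⟩
  obtain ⟨f, hf⟩ := exists_seq_mem hM hγ fun i =>
    if toZFSet (ToType.toOrd i).1 ∈ A then ⟨_, htr _ hγM (hm i)⟩ else ⟨k.toZFSet, hκ⟩
  obtain ⟨b, hb⟩ := exists_sep hZ ((mem' 4 3 0) ⊓ ((mem' 5 4 3).imp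
    ((mem' 6 5 4).iff (eq' 6 5 2)).all).all).ex f ⟨_, hγM⟩
  suffices h : A ∩ γ.toZFSet = b.1 by rw [h]; exact b.2
  ext x
  rw [mem_inter]
  have hiff : ∀ z : M.toSet, Sat M ((mem' 4 3 0) ⊓ ((mem' 5 4 3).imp
      ((mem' 6 5 4).iff (eq' 6 5 2)).all).all).ex ![f, ⟨_, hγM⟩, z] ↔
      ∃ p : M.toSet, p.1 ∈ f.1 ∧ ∀ q : M.toSet, q.1 ∈ p.1 → ∀ y : M.toSet, y.1 ∈ q.1 ↔ y = z := by
    intro z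
    simp only [Sat, BoundedFormula.realize_ex, BoundedFormula.realize_inf,
      BoundedFormula.realize_all, BoundedFormula.realize_imp, BoundedFormula.realize_iff,
      realize_mem', realize_eq']
    rfl
  simp only [hiff] at hb
  constructor
  · rintro ⟨hxA, hxγ⟩
    have hxM := htr _ hγM hxγ
    refine (hb ⟨x, hxM⟩).2 ⟨hxγ, ?_⟩
    obtain ⟨ξ, hξ, rfl⟩ := mem_toZFSet_iff.1 hxγ
    have hp : pair ξ.toZFSet ξ.toZFSet ∈ f.1 := (hf _).2 ⟨ToType.mk ⟨ξ, hξ⟩, by simp [hxA]⟩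
    refine ⟨⟨_, htr _ f.2 hp⟩, hp, fun q hq y => ?_⟩
    have hq' : q.1 = {ξ.toZFSet} := by
      have : q.1 ∈ pair ξ.toZFSet ξ.toZFSet := hq
      simpa [pair] using this
    rw [hq', mem_singleton, Subtype.ext_iff]
  · intro hx
    have hxM := htr _ b.2 hx
    obtain ⟨hxγ, p, hp, hpx⟩ := (hb ⟨x, hxM⟩).1 hx
    refine ⟨?_, hxγ⟩
    obtain ⟨i, hi⟩ := (hf _).1 hp
    have key : ∀ q, q ∈ p.1 → ∀ y, y ∈ q → y = x := by
      intro q hq y hy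
      have hqM := htr _ p.2 hq
      exact congrArg Subtype.val ((hpx ⟨q, hqM⟩ hq ⟨y, htr _ hqM hy⟩).1 hy)
    rw [hi] at key
    have h1 := key {toZFSet (ToType.toOrd i).1} (by simp [pair]) _ (mem_singleton.2 rfl)
    have h2 := key _ (by rw [pair, mem_pair]; exact Or.inr rfl) _ (mem_pair.2 (Or.inr rfl))
    by_contra hxA
    rw [if_neg (by rw [h1]; exact hxA)] at h2
    have h3 : x ∈ k.toZFSet := by
      obtain ⟨ξ, hξ, rfl⟩ := mem_toZFSet_iff.1 hxγ
      exact mem_toZFSet_iff.2 ⟨ξ, lt_trans hξ hγ, rfl⟩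
    rw [← h2] at h3
    exact mem_irrefl _ h3

theorem exists_reducedPower {k : Ordinal.{0}} (hk : IsInaccOrd k)
    (hpow : ∀ μ < k.card, k.card ^ μ ≤ k.card) {S : Set Ordinal.{0}} (h : RegressiveGuess k S)
    {M : ZFSet.{0}} (hM : IsKappaModel k.toZFSet M)
    {C : Type} (hC : #C ≤ k.card) (c : C → Ordinal.{0} → M.toSet) :
    ∃ (Tm : Type) (ev : Tm → Ordinal.{0} → M.toSet) (U : Filter Ordinal.{0}), #Tm ≤ k.card ∧
      (∀ i, ∃ t, ev t = c i) ∧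
      (∀ (n : ℕ) (φ : memLang.BoundedFormula Empty (n + 1)) (t : Fin n → Tm), ∃ u, ∀ γ,
        Sat M φ.ex (fun i => ev (t i) γ) → Sat M φ (Fin.snoc (fun i => ev (t i) γ) (ev u γ))) ∧
      (∀ β < k, ∀ a : β.ToType → Tm, ∃ u, ∀ γ x, x ∈ (ev u γ).1 ↔
        ∃ i, x = pair (toZFSet (ToType.toOrd i).1) (ev (a i) γ).1) ∧
      U.NeBot ∧ (∀ᶠ γ in U, γ < k ∧ γ ∈ S) ∧ (∀ β < k, ∀ᶠ γ in U, β < γ) ∧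
      (∀ ι : Type, #ι < k.card → ∀ Q : ι → Ordinal.{0} → Prop, (∀ x, ∀ᶠ γ in U, Q x γ) →
        ∀ᶠ γ in U, ∀ x, Q x γ) ∧
      (∀ (n : ℕ) (φ : memLang.BoundedFormula Empty n) (t : Fin n → Tm),
        (∀ᶠ γ in U, Sat M φ fun i => ev (t i) γ) ∨
          ∀ᶠ γ in U, ¬ Sat M φ fun i => ev (t i) γ) ∧
      ∀ t, ∃ v, ∀ᶠ γ in U, ∀ ξ < γ, (ev t γ).1 = toZFSet ξ → ξ = v := by
  obtain ⟨Tm, ev, hT, hc, hsk, hseq⟩ := exists_terms hk hpow ⟨_, hM.2.1⟩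
    (fun β hβ a => exists_seq_mem hM hβ a) hC c
  have hω := hk.2.aleph0_lt.le
  let I := (Σ p : (Σ n, memLang.BoundedFormula Empty n), (Fin p.1 → Tm)) ⊕ Tm
  have hI : #I ≤ k.card := by
    rw [Cardinal.mk_sum, Cardinal.lift_id, Cardinal.lift_id]
    refine Cardinal.add_le_of_le hω ?_ hT
    rw [Cardinal.mk_sigma]
    refine (Cardinal.sum_le_sum _ (fun _ => k.card) fun p => ?_).trans ?_
    · have : #(Fin p.1 → Tm) = #Tm ^ p.1 := by simp
      rw [this]
      exact (pow_le_pow_left' hT _).trans (Cardinal.power_nat_le hω)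
    · rw [Cardinal.sum_const']
      exact (mul_le_mul_left (mk_sigma_boundedFormula_le.trans hω) _).trans
        (Cardinal.mul_eq_self hω).le
  let F : I → Ordinal.{0} → Ordinal.{0} := fun i γ => match i with
    | Sum.inl ⟨p, t⟩ => if Sat M p.2 (fun i => ev (t i) γ) then 1 else 0
    | Sum.inr t => if rank (ev t γ).1 < γ then rank (ev t γ).1 else 0
  have hF : ∀ i, ∀ γ < k, IsInaccOrd γ → F i γ < γ := by
    intro i γ _ hγ
    have h1 : 1 < γ := one_lt_omega0.trans hγ.omega0_lt
    have h0 : 0 < γ := zero_lt_one.trans h1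
    rcases i with ⟨p, t⟩ | t
    · simp only [F]; split_ifs <;> assumption
    · simp only [F]; split_ifs <;> assumption
  obtain ⟨U, hU, hS, hb, hcomp, hconst⟩ := h.exists_filter hk hI F hF
  refine ⟨Tm, ev, U, hT, hc, hsk, hseq, hU, hS.mono fun γ h => ⟨h.1, h.2.1⟩, hb, hcomp, ?_, ?_⟩
  · intro n φ t
    obtain ⟨v, hv⟩ := hconst (Sum.inl ⟨⟨n, φ⟩, t⟩)
    by_cases h1 : v = 1
    · left
      filter_upwards [hv] with γ h2
      by_contra h3
      simp only [F, if_neg h3] at h2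
      exact zero_ne_one (h2.trans h1)
    · right
      filter_upwards [hv] with γ h2 h3
      simp only [F, if_pos h3] at h2
      exact h1 h2.symm
  · intro t
    obtain ⟨v, hv⟩ := hconst (Sum.inr t)
    refine ⟨v, hv.mono fun γ h1 ξ hξ h2 => ?_⟩
    simp only [F, h2, rank_toZFSet, if_pos hξ] at h1
    exact h1

theorem exists_embedding {k : Ordinal.{0}} (hk : IsInaccOrd k)
    (hpow : ∀ μ < k.card, k.card ^ μ ≤ k.card) {S M A B : ZFSet.{0}}
    (h : RegressiveGuess k {γ | γ.toZFSet ∈ S}) (hM : IsKappaModel k.toZFSet M) (hSM : S ∈ M)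
    (hA : A ⊆ k.toZFSet) (hB : B ⊆ k.toZFSet) :
    ∃ (N : ZFSet.{0}) (j : ZFSet.{0} → ZFSet.{0}), IsKappaModel k.toZFSet N ∧
      IsElemEmbedding M N j ∧ HasCritPoint j k.toZFSet ∧ k.toZFSet ∈ j S ∧ A ∈ N ∧ B ∈ N := by
  have hω := hk.2.aleph0_lt.le
  have htr := hM.2.2.1
  have hκM := hM.2.1
  have hsub : ∀ ξ < k, ξ.toZFSet ∈ M := fun ξ hξ => htr _ hκM (mem_toZFSet_iff.2 ⟨ξ, hξ, rfl⟩)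
  have h2 : #M.toSet = Cardinal.lift.{1} k.card := hM.2.2.2.1.trans (zcard_toZFSet k)
  have hsmall : Small.{0} M.toSet := by
    rw [← mk_toType k, ← Cardinal.mk_uLift] at h2
    obtain ⟨e⟩ := Cardinal.eq.1 h2
    exact small_map (e.trans Equiv.ulift)
  let D : Fin 3 → ZFSet.{0} := ![k.toZFSet, A, B]
  let c : Shrink.{0} M.toSet ⊕ Fin 3 → Ordinal.{0} → M.toSet := fun i γ => match i with
    | Sum.inl m => (equivShrink _).symm m
    | Sum.inr i => if h : D i ∩ γ.toZFSet ∈ M then ⟨_, h⟩ else ⟨_, hκM⟩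
  have hC : #(Shrink.{0} M.toSet ⊕ Fin 3) ≤ k.card := by
    have h1 : #(Shrink.{0} M.toSet) = k.card := by
      have h3 : Cardinal.lift.{1} #(Shrink.{0} M.toSet) = #M.toSet :=
        (Cardinal.mk_congr (Equiv.ulift.trans (equivShrink M.toSet).symm))
      exact Cardinal.lift_injective (h3.trans h2)
    rw [Cardinal.mk_sum, Cardinal.lift_id, Cardinal.lift_id, h1]
    refine Cardinal.add_le_of_le hω le_rfl ?_
    simpa using (Cardinal.natCast_lt_aleph0 (n := 3)).le.trans hω
  obtain ⟨Tm, ev, U, hT, hc, hsk, hseq, hU, hS, hb, hcomp, hdec, hord⟩ :=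
    exists_reducedPower hk hpow h hM hC c
  have hwf := wellFounded_termMem (U := U) (ev := ev) fun Q hQ =>
    hcomp ℕ (by simpa using hk.2.aleph0_lt) Q hQ
  obtain ⟨π, hπ⟩ := exists_collapse hwf
  have heq := collapse_eq_iff hwf hπ htr hdec hsk
  let N : ZFSet.{0} := ZFSet.range π
  have hN : ∀ x, x ∈ N ↔ ∃ t, π t = x := fun x => mem_range
  have hlos : ∀ {n : ℕ} (φ : memLang.BoundedFormula Empty n) (t : Fin n → Tm), _ :=
    fun φ t => sat_collapse_iff hwf hπ htr hdec hsk hN φ t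
  have hNtr : N.IsTransitive := by
    intro x hx y hy
    obtain ⟨s, rfl⟩ := (hN _).1 hx
    obtain ⟨t, -, rfl⟩ := (hπ _ _).1 hy
    exact (hN _).2 ⟨t, rfl⟩
  choose T hTm using hc
  let K : M.toSet → Tm := fun m => T (Sum.inl (equivShrink _ m))
  have hK : ∀ m γ, ev (K m) γ = m := by
    intro m γ
    simp [K, hTm, c]
  have hset : ∀ X : ZFSet.{0}, X ⊆ k.toZFSet →
      (∀ ξ (hξ : ξ < k), ξ.toZFSet ∈ X → π (K ⟨_, hsub ξ hξ⟩) = ξ.toZFSet) →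
      ∀ s, (∀ᶠ γ in U, (ev s γ).1 = X ∩ γ.toZFSet) → π s = X := by
    intro X hX hfix s hs
    ext x
    rw [hπ]
    constructor
    · rintro ⟨t, ht, rfl⟩
      obtain ⟨v, hv⟩ := hord t
      have h1 : ∀ᶠ γ in U, (ev t γ).1 = toZFSet v ∧ toZFSet v ∈ X := by
        filter_upwards [ht, hs, hv] with γ h2 h3 h4
        rw [h3, mem_inter] at h2
        obtain ⟨ξ, hξ, h5⟩ := mem_toZFSet_iff.1 h2.2
        rw [← h4 ξ hξ h5.symm, h5]
        exact ⟨rfl, h2.1⟩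
      obtain ⟨γ, -, hvX⟩ := h1.exists
      have hvk : v < k := toZFSet_mem_toZFSet_iff.1 (hX hvX)
      have h2 : π t = π (K ⟨_, hsub v hvk⟩) :=
        (heq _ _).2 (h1.mono fun γ h3 => Subtype.ext (by rw [hK]; exact h3.1))
      rw [h2, hfix v hvk hvX]
      exact hvX
    · intro hx
      obtain ⟨ξ, hξ, rfl⟩ := mem_toZFSet_iff.1 (hX hx)
      refine ⟨_, ?_, hfix ξ hξ hx⟩
      filter_upwards [hs, hb ξ hξ] with γ h1 h2
      rw [h1, hK, mem_inter]
      exact ⟨hx, mem_toZFSet_iff.2 ⟨ξ, h2, rfl⟩⟩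
  have hfix : ∀ ξ (hξ : ξ < k), π (K ⟨_, hsub ξ hξ⟩) = ξ.toZFSet := by
    intro ξ
    induction ξ using WellFoundedLT.induction with
    | _ ξ ih =>
    intro hξ
    refine hset _ (toZFSet_subset_toZFSet_iff.2 hξ.le)
      (fun η hη h1 => ih η (toZFSet_mem_toZFSet_iff.1 h1) hη) _ ?_
    filter_upwards [hb ξ hξ] with γ hγ
    rw [hK]
    ext x
    rw [mem_inter]
    exact ⟨fun hx => ⟨hx, toZFSet_subset_toZFSet_iff.2 hγ.le hx⟩, fun hx => hx.1⟩
  have hDsub : ∀ i, D i ⊆ k.toZFSet := by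
    intro i
    fin_cases i
    exacts [fun _ h => h, hA, hB]
  have hD : ∀ i, π (T (Sum.inr i)) = D i := by
    intro i
    refine hset _ (hDsub i) (fun ξ hξ _ => hfix ξ hξ) _ ?_
    filter_upwards [hS] with γ hγ
    have h1 : D i ∩ γ.toZFSet ∈ M := inter_mem_kappaModel hM hγ.1 _
    simp only [hTm, c, dif_pos h1]
  have hDN : ∀ i, D i ∈ N := fun i => (hN _).2 ⟨_, hD i⟩
  have hκN : k.toZFSet ∈ N := hDN 0
  let j : ZFSet.{0} → ZFSet.{0} := fun x => if h : x ∈ M then π (K ⟨x, h⟩) else ∅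
  have hj : ∀ x (hx : x ∈ M), j x = π (K ⟨x, hx⟩) := fun x hx => dif_pos hx
  have hκj : ∀ X, X ∈ M → (∀ᶠ γ in U, γ.toZFSet ∈ X) → k.toZFSet ∈ j X := by
    intro X hX hUX
    rw [hj X hX, hπ]
    refine ⟨_, ?_, hD 0⟩
    refine (hS.and hUX).mono fun γ ⟨hγ, h1⟩ => ?_
    have h2 : D 0 ∩ γ.toZFSet ∈ M := inter_mem_kappaModel hM hγ.1 _
    have h3 : D 0 ∩ γ.toZFSet = γ.toZFSet := by
      ext x
      rw [mem_inter]
      exact ⟨fun hx => hx.2, fun hx => ⟨toZFSet_subset_toZFSet_iff.2 hγ.1.le hx, hx⟩⟩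
    simp only [hTm, c, dif_pos h2]
    rw [hK, h3]
    exact h1
  have hpair : ∀ s p q : Tm, π s = pair (π p) (π q) ↔
      ∀ᶠ γ in U, (ev s γ).1 = pair (ev p γ).1 (ev q γ).1 := by
    intro s p q
    have h1 := hlos orderedPairFormula ![s, p, q]
    simp only [sat_orderedPairFormula hNtr, sat_orderedPairFormula htr] at h1
    exact h1
  refine ⟨N, j, ⟨trivial, hκN, hNtr, ?_, ?_, ?_⟩, ⟨?_, ?_⟩, ⟨?_, ?_⟩, ?_, hDN 1, hDN 2⟩
  · refine le_antisymm ?_ (Cardinal.mk_le_mk_of_subset (hNtr _ hκN))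
    rw [zcard_toZFSet]
    refine le_trans ?_ (Cardinal.lift_le.2 hT)
    rw [← Cardinal.mk_uLift]
    refine Cardinal.mk_le_of_surjective
      (f := fun t : ULift.{1} Tm => (⟨π t.down, (hN _).2 ⟨_, rfl⟩⟩ : N.toSet)) ?_
    rintro ⟨x, hx⟩
    obtain ⟨t, rfl⟩ := (hN x).1 hx
    exact ⟨⟨t⟩, rfl⟩
  · intro β hβ f _ hf
    obtain ⟨b, hb', rfl⟩ := mem_toZFSet_iff.1 hβ
    obtain ⟨a, haN, ha⟩ := exists_seq_of_isFunc hf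
    choose t ht using fun i => (hN _).1 (haN i)
    obtain ⟨u, hu⟩ := hseq b hb' t
    have hik : ∀ i : b.ToType, (ToType.toOrd i).1 < k := fun i => lt_trans (ToType.toOrd i).2 hb'
    have hpi : ∀ i s, π s = pair (toZFSet (ToType.toOrd i).1) (a i) ↔
        ∀ᶠ γ in U, (ev s γ).1 = pair (toZFSet (ToType.toOrd i).1) (ev (t i) γ).1 := by
      intro i s
      have := hpair s (K ⟨_, hsub _ (hik i)⟩) (t i)
      simpa only [hK, hfix _ (hik i), ht] using this
    refine (hN _).2 ⟨u, ?_⟩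
    ext x
    rw [hπ, ha]
    constructor
    · rintro ⟨s, hs, rfl⟩
      by_contra hne
      push Not at hne
      have h1 : ∀ i, ∀ᶠ γ in U,
          ¬ (ev s γ).1 = pair (toZFSet (ToType.toOrd i).1) (ev (t i) γ).1 := by
        intro i
        have h2 := hdec 3 orderedPairFormula ![s, K ⟨_, hsub _ (hik i)⟩, t i]
        simp only [sat_orderedPairFormula htr] at h2
        have h3 := (hpi i s).not.1 (hne i)
        rcases h2 with h2 | h2
        · exact absurd (h2.mono fun γ h4 => by simpa [hK] using h4) h3
        · exact h2.mono fun γ h4 => by simpa [hK] using h4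
      have hcard : #b.ToType < k.card := by
        rw [mk_toType]
        exact card_lt_of_lt hk.1 hb'
      obtain ⟨γ, h4, h5⟩ := ((hcomp _ hcard _ h1).and hs).exists
      obtain ⟨i, hi⟩ := (hu γ _).1 h5
      exact h4 i hi
    · rintro ⟨i, rfl⟩
      obtain ⟨w, hw⟩ := hsk 2 (mem' 3 2 0 ⊓ ((mem' 4 3 2).imp (mem' 4 1 3)).all)
        ![u, K ⟨_, hsub _ (hik i)⟩]
      have h1 : ∀ γ, (ev w γ).1 = pair (toZFSet (ToType.toOrd i).1) (ev (t i) γ).1 := by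
        intro γ
        have h2 := hw γ
        simp only [Sat, BoundedFormula.realize_ex, BoundedFormula.realize_inf,
          BoundedFormula.realize_all, BoundedFormula.realize_imp, realize_mem'] at h2
        have h3 : (∃ x : M.toSet, x.1 ∈ (ev u γ).1 ∧
            ∀ p : M.toSet, p.1 ∈ x.1 → (ev (K ⟨_, hsub _ (hik i)⟩) γ).1 ∈ p.1) →
            (ev w γ).1 ∈ (ev u γ).1 ∧
            ∀ p : M.toSet, p.1 ∈ (ev w γ).1 → (ev (K ⟨_, hsub _ (hik i)⟩) γ).1 ∈ p.1 := h2
        simp only [hK] at h3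
        have h4 : pair (toZFSet (ToType.toOrd i).1) (ev (t i) γ).1 ∈ (ev u γ).1 :=
          (hu γ _).2 ⟨i, rfl⟩
        obtain ⟨h5, h6⟩ := h3 ⟨⟨_, htr _ (ev u γ).2 h4⟩, h4, fun p hp => by
          have : p.1 = {toZFSet (ToType.toOrd i).1} ∨
            p.1 = {toZFSet (ToType.toOrd i).1, (ev (t i) γ).1} := by simpa [pair] using hp
          rcases this with h | h <;> simp [h]⟩
        obtain ⟨i', hi'⟩ := (hu γ _).1 h5
        have h7 : {toZFSet (ToType.toOrd i').1} ∈ (ev w γ).1 := by rw [hi', pair]; simp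
        have h8 := h6 ⟨_, htr _ (ev w γ).2 h7⟩ h7
        have h9 : (ToType.toOrd i).1 = (ToType.toOrd i').1 := by
          simpa [toZFSet_injective.eq_iff] using h8
        have h10 : i = i' := ToType.mk.symm.injective (Subtype.ext h9)
        rw [h10]
        exact hi'
      refine ⟨w, Filter.Eventually.of_forall fun γ => ?_,
        (hpi i w).2 (Filter.Eventually.of_forall h1)⟩
      rw [h1]
      exact (hu γ _).2 ⟨i, rfl⟩
  · intro φ hφ
    have h1 := (hlos φ Fin.elim0).2 (Filter.Eventually.of_forall fun γ => by
      have := hM.2.2.2.2.2 φ hφ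
      refine (iff_of_eq (congrArg₂ (fun e v => BoundedFormula.Realize φ e v) ?_ ?_)).1 this
      exacts [Subsingleton.elim _ _, Subsingleton.elim _ _])
    refine (iff_of_eq (congrArg₂ (fun e v => BoundedFormula.Realize φ e v) ?_ ?_)).1 h1
    exacts [Subsingleton.elim _ _, Subsingleton.elim _ _]
  · intro x hx
    rw [hj x hx]
    exact (hN _).2 ⟨_, rfl⟩
  · intro n φ v hv
    have hv' : ∀ i, j (v i) ∈ N := fun i => by rw [hj _ (hv i)]; exact (hN _).2 ⟨_, rfl⟩
    rw [realizeIn_iff_sat hv, realizeIn_iff_sat hv']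
    have h1 := hlos φ fun i => K ⟨v i, hv i⟩
    simp only [hK, Filter.eventually_const] at h1
    rw [← h1]
    simp only [hj _ (hv _)]
  · intro x hx
    obtain ⟨ξ, hξ, rfl⟩ := mem_toZFSet_iff.1 hx
    rw [hj _ (hsub ξ hξ), hfix ξ hξ]
  · exact hκj _ hκM (hS.mono fun γ hγ => mem_toZFSet_iff.2 ⟨γ, hγ.1, rfl⟩)
  · exact hκj _ hSM (hS.mono fun γ hγ => hγ.2)

/-! ## Definable predicates -/

/-- A predicate is uniformly definable over transitive sets. -/
def Definable {n : ℕ} (P : ZFSet.{0} → (Fin n → ZFSet.{0}) → Prop) : Prop :=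
  ∃ φ : memLang.BoundedFormula Empty n, ∀ (M : ZFSet.{0}), M.IsTransitive →
    ∀ v : Fin n → M.toSet, Sat M φ v ↔ P M fun i => (v i).1

/-- A projection to one coordinate. -/
def IsVar {n : ℕ} (a : (Fin n → ZFSet.{0}) → ZFSet.{0}) : Prop := ∃ i, a = fun v => v i

namespace Definable

variable {n : ℕ} {P Q : ZFSet.{0} → (Fin n → ZFSet.{0}) → Prop}
  {a b : (Fin n → ZFSet.{0}) → ZFSet.{0}}

theorem var (i : Fin n) : IsVar fun v : Fin n → ZFSet.{0} => v i := ⟨i, rfl⟩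

theorem lift_var (ha : IsVar a) :
    IsVar fun w : Fin (n + 1) → ZFSet.{0} => a fun i => w i.castSucc := by
  obtain ⟨i, rfl⟩ := ha
  exact ⟨i.castSucc, rfl⟩

theorem const (p : Prop) : Definable fun (_ : ZFSet.{0}) (_ : Fin n → ZFSet.{0}) => p := by
  by_cases hp : p
  · exact ⟨⊤, fun M _ v => by simp [Sat, hp]⟩
  · exact ⟨⊥, fun M _ v => by simp [Sat, hp]⟩

theorem mem (ha : IsVar a) (hb : IsVar b) : Definable fun _ v => a v ∈ b v := by
  obtain ⟨i, rfl⟩ := ha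
  obtain ⟨j, rfl⟩ := hb
  exact ⟨mem' n i j, fun M _ v => by simp [Sat]⟩

theorem eq (ha : IsVar a) (hb : IsVar b) : Definable fun _ v => a v = b v := by
  obtain ⟨i, rfl⟩ := ha
  obtain ⟨j, rfl⟩ := hb
  exact ⟨eq' n i j, fun M _ v => by simp [Sat, Subtype.ext_iff]⟩

theorem not (hP : Definable P) : Definable fun M v => ¬ P M v := by
  obtain ⟨φ, hφ⟩ := hP
  exact ⟨φ.not, fun M hM v => by
    beta_reduce
    rw [← hφ M hM v, Sat, BoundedFormula.realize_not]⟩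

theorem and (hP : Definable P) (hQ : Definable Q) : Definable fun M v => P M v ∧ Q M v := by
  obtain ⟨φ, hφ⟩ := hP
  obtain ⟨ψ, hψ⟩ := hQ
  exact ⟨φ ⊓ ψ, fun M hM v => by
    beta_reduce
    rw [← hφ M hM v, ← hψ M hM v, Sat, BoundedFormula.realize_inf]⟩

theorem or (hP : Definable P) (hQ : Definable Q) : Definable fun M v => P M v ∨ Q M v := by
  obtain ⟨φ, hφ⟩ := hP
  obtain ⟨ψ, hψ⟩ := hQ
  exact ⟨φ ⊔ ψ, fun M hM v => by
    beta_reduce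
    rw [← hφ M hM v, ← hψ M hM v, Sat, BoundedFormula.realize_sup]⟩

theorem imp (hP : Definable P) (hQ : Definable Q) : Definable fun M v => P M v → Q M v := by
  obtain ⟨φ, hφ⟩ := hP
  obtain ⟨ψ, hψ⟩ := hQ
  exact ⟨φ.imp ψ, fun M hM v => by
    beta_reduce
    rw [← hφ M hM v, ← hψ M hM v, Sat, BoundedFormula.realize_imp]⟩

theorem iff (hP : Definable P) (hQ : Definable Q) : Definable fun M v => (P M v ↔ Q M v) := by
  obtain ⟨φ, hφ⟩ := hP
  obtain ⟨ψ, hψ⟩ := hQ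
  exact ⟨φ.iff ψ, fun M hM v => by
    beta_reduce
    rw [← hφ M hM v, ← hψ M hM v, Sat, BoundedFormula.realize_iff]⟩

theorem coe_snoc {M : ZFSet.{0}} (v : Fin n → M.toSet) (x : M.toSet) :
    ((fun i => ((Fin.snoc v x : Fin (n + 1) → M.toSet) (Fin.castSucc i)).1) = fun i => (v i).1) ∧
      ((Fin.snoc v x : Fin (n + 1) → M.toSet) (Fin.last n)).1 = x.1 := by
  simp

theorem ex {P : ZFSet.{0} → (Fin n → ZFSet.{0}) → ZFSet.{0} → Prop}
    (hP : Definable fun M (w : Fin (n + 1) → ZFSet.{0}) =>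
      P M (fun i => w i.castSucc) (w (Fin.last n))) :
    Definable fun M v => ∃ x ∈ M, P M v x := by
  obtain ⟨φ, hφ⟩ := hP
  refine ⟨φ.ex, fun M hM v => ?_⟩
  rw [Sat, BoundedFormula.realize_ex]
  have h : ∀ x : M.toSet, Sat M φ (Fin.snoc v x) ↔ P M (fun i => (v i).1) x.1 := by
    intro x
    refine (hφ M hM _).trans ?_
    beta_reduce
    rw [(coe_snoc v x).1, (coe_snoc v x).2]
  exact ⟨fun ⟨x, hx⟩ => ⟨x.1, x.2, (h x).1 hx⟩, fun ⟨x, hxM, hx⟩ => ⟨⟨x, hxM⟩, (h ⟨x, hxM⟩).2 hx⟩⟩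

theorem bex {P : ZFSet.{0} → (Fin n → ZFSet.{0}) → ZFSet.{0} → Prop} (ha : IsVar a)
    (hP : Definable fun M (w : Fin (n + 1) → ZFSet.{0}) =>
      P M (fun i => w i.castSucc) (w (Fin.last n))) :
    Definable fun M v => ∃ x ∈ a v, P M v x := by
  obtain ⟨φ, hφ⟩ := ex (P := fun M v x => x ∈ a v ∧ P M v x)
    (and (mem (var (Fin.last n)) (lift_var ha)) hP)
  refine ⟨φ, fun M hM v => (hφ M hM v).trans ⟨fun ⟨x, _, h⟩ => ⟨x, h⟩, fun ⟨x, h⟩ => ⟨x, ?_, h⟩⟩⟩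
  obtain ⟨i, rfl⟩ := ha
  exact hM _ (v i).2 h.1

theorem ball {P : ZFSet.{0} → (Fin n → ZFSet.{0}) → ZFSet.{0} → Prop} (ha : IsVar a)
    (hP : Definable fun M (w : Fin (n + 1) → ZFSet.{0}) =>
      P M (fun i => w i.castSucc) (w (Fin.last n))) :
    Definable fun M v => ∀ x ∈ a v, P M v x := by
  have := not (bex (P := fun M v x => ¬ P M v x) ha (not hP))
  simpa only [not_exists, not_and, not_not] using this

theorem transfer (hP : Definable P) {M N : ZFSet.{0}} {j : ZFSet.{0} → ZFSet.{0}}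
    (hM : M.IsTransitive) (hN : N.IsTransitive) (hj : IsElemEmbedding M N j)
    {v : Fin n → ZFSet.{0}} (hv : ∀ i, v i ∈ M) : P M v ↔ P N fun i => j (v i) := by
  obtain ⟨φ, hφ⟩ := hP
  have h1 := hj.2 n φ v hv
  rw [realizeIn_iff_sat hv, realizeIn_iff_sat fun i => hj.1 _ (hv i), hφ M hM, hφ N hN] at h1
  exact h1

end Definable

/-- `x` and `y` occur together in a member of a member of `f`. -/
def Linked (f x y : ZFSet.{0}) : Prop := ∃ q ∈ f, ∃ p ∈ q, x ∈ p ∧ y ∈ p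

/-- `f` codes an order isomorphism between `c` and the interval from `γ` to `δ`. -/
def CodesSum (c γ δ f : ZFSet.{0}) : Prop :=
  (∀ x ∈ γ, x ∈ δ) ∧ (∀ x ∈ c, ∃ y ∈ δ, y ∉ γ ∧ Linked f x y) ∧
    (∀ y ∈ δ, y ∉ γ → ∃ x ∈ c, Linked f x y) ∧
      ∀ x ∈ c, ∀ x' ∈ c, ∀ y ∈ δ, ∀ y' ∈ δ, y ∉ γ → y' ∉ γ → Linked f x y → Linked f x' y' →
        (x ∈ x' ↔ y ∈ y')

section

variable {n : ℕ} {a b c d : (Fin n → ZFSet.{0}) → ZFSet.{0}}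

theorem definable_linked (ha : IsVar a) (hb : IsVar b) (hc : IsVar c) :
    Definable fun _ v => Linked (a v) (b v) (c v) := by
  obtain ⟨i, rfl⟩ := ha
  obtain ⟨j, rfl⟩ := hb
  obtain ⟨l, rfl⟩ := hc
  unfold Linked
  repeat' first
    | apply Definable.bex | apply Definable.and | apply Definable.mem
    | exact Definable.var _

theorem definable_codesSum (ha : IsVar a) (hb : IsVar b) (hc : IsVar c) (hd : IsVar d) :
    Definable fun _ v => CodesSum (a v) (b v) (c v) (d v) := by
  obtain ⟨i, rfl⟩ := ha
  obtain ⟨j, rfl⟩ := hb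
  obtain ⟨l, rfl⟩ := hc
  obtain ⟨m, rfl⟩ := hd
  unfold CodesSum
  repeat' first
    | apply definable_linked
    | apply Definable.ball | apply Definable.bex | apply Definable.and | apply Definable.iff
    | apply Definable.not | apply Definable.imp | apply Definable.mem
    | exact Definable.var _

end

/-! ## Guessing at weakly compact sets -/

theorem CodesSum.eq_add {c γ δ : Ordinal.{0}} {f : ZFSet.{0}}
    (h : CodesSum c.toZFSet γ.toZFSet δ.toZFSet f) : δ = γ + c := by
  obtain ⟨h1, h2, h3, h4⟩ := h
  have hγδ : γ ≤ δ := toZFSet_subset_toZFSet_iff.1 fun x hx => h1 x hx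
  have e2 : ∀ x < c, ∃ y < δ, γ ≤ y ∧ Linked f x.toZFSet y.toZFSet := by
    intro x hx
    obtain ⟨y, hy, hyγ, hl⟩ := h2 _ (toZFSet_mem_toZFSet_iff.2 hx)
    obtain ⟨y, hy', rfl⟩ := mem_toZFSet_iff.1 hy
    exact ⟨y, hy', by simpa [toZFSet_mem_toZFSet_iff] using hyγ, hl⟩
  have e3 : ∀ y < δ, γ ≤ y → ∃ x < c, Linked f x.toZFSet y.toZFSet := by
    intro y hy hyγ
    obtain ⟨x, hx, hl⟩ := h3 _ (toZFSet_mem_toZFSet_iff.2 hy)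
      (by simpa [toZFSet_mem_toZFSet_iff] using hyγ)
    obtain ⟨x, hx', rfl⟩ := mem_toZFSet_iff.1 hx
    exact ⟨x, hx', hl⟩
  have e4 : ∀ x < c, ∀ x' < c, ∀ y < δ, ∀ y' < δ, γ ≤ y → γ ≤ y' → Linked f x.toZFSet y.toZFSet →
      Linked f x'.toZFSet y'.toZFSet → (x < x' ↔ y < y') := by
    intro x hx x' hx' y hy y' hy' hyγ hyγ' hl hl'
    have := h4 _ (toZFSet_mem_toZFSet_iff.2 hx) _ (toZFSet_mem_toZFSet_iff.2 hx') _
      (toZFSet_mem_toZFSet_iff.2 hy) _ (toZFSet_mem_toZFSet_iff.2 hy')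
      (by simpa [toZFSet_mem_toZFSet_iff] using hyγ)
      (by simpa [toZFSet_mem_toZFSet_iff] using hyγ') hl hl'
    simpa only [toZFSet_mem_toZFSet_iff] using this
  have key : ∀ x < c, ∀ y < δ, γ ≤ y → Linked f x.toZFSet y.toZFSet → y = γ + x := by
    intro x
    induction x using WellFoundedLT.induction with
    | _ x ih =>
    intro hx y hy hyγ hl
    apply le_antisymm
    · by_contra hlt
      push Not at hlt
      have hz : γ ≤ γ + x := le_self_add
      obtain ⟨x', hx', hl'⟩ := e3 _ (hlt.trans hy) hz
      have hxx := (e4 x' hx' x hx _ (hlt.trans hy) y hy hz hyγ hl' hl).2 hlt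
      have := ih x' hxx hx' _ (hlt.trans hy) hz hl'
      exact hxx.ne' (add_left_cancel this)
    · by_contra hlt
      push Not at hlt
      obtain ⟨x', rfl⟩ := exists_add_of_le hyγ
      have hxx : x' < x := lt_of_add_lt_add_left hlt
      obtain ⟨y', hy', hyγ', hl'⟩ := e2 x' (hxx.trans hx)
      have h5 := ih x' hxx (hxx.trans hx) y' hy' hyγ' hl'
      subst h5
      exact lt_irrefl _ ((e4 x' (hxx.trans hx) x hx _ hy' _ hy hyγ hyγ hl' hl).1 hxx)
  apply le_antisymm
  · by_contra hlt
    push Not at hlt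
    obtain ⟨x, hx, hl⟩ := e3 _ hlt le_self_add
    exact hx.ne' (add_left_cancel (key x hx _ hlt le_self_add hl))
  · by_contra hlt
    push Not at hlt
    obtain ⟨x, rfl⟩ := exists_add_of_le hγδ
    have hx : x < c := lt_of_add_lt_add_left hlt
    obtain ⟨y, hy, hyγ, hl⟩ := e2 x hx
    exact hy.ne (key x hx y hy hyγ hl)

theorem exists_codesSum {k : Ordinal.{0}} {M : ZFSet.{0}} (hM : IsKappaModel k.toZFSet M)
    {c γ : Ordinal.{0}} (hc : c ≤ γ) (hγ : γ + c < k) :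
    ∃ f ∈ M, CodesSum c.toZFSet γ.toZFSet (γ + c).toZFSet f := by
  have hm : ∀ i : c.ToType, toZFSet (γ + (ToType.toOrd i).1) ∈ M := fun i =>
    hM.2.2.1 _ hM.2.1 (mem_toZFSet_iff.2 ⟨_, ((add_lt_add_iff_left γ).2 (ToType.toOrd i).2).trans
      hγ, rfl⟩)
  obtain ⟨f, hf⟩ := exists_seq_mem hM ((hc.trans le_self_add).trans_lt hγ) fun i => ⟨_, hm i⟩
  have hl : ∀ x < c, ∀ y, γ ≤ y → (Linked f.1 x.toZFSet y.toZFSet ↔ y = γ + x) := by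
    intro x hx y hy
    constructor
    · rintro ⟨q, hq, p, hp, h1, h2⟩
      obtain ⟨i, rfl⟩ := (hf _).1 hq
      have hi : (ToType.toOrd i).1 < c := (ToType.toOrd i).2
      rw [pair, mem_pair] at hp
      rcases hp with rfl | rfl
      · rw [mem_singleton, toZFSet_injective.eq_iff] at h1 h2
        exact absurd (h2 ▸ hi) (hc.trans hy).not_gt
      · rw [mem_pair, toZFSet_injective.eq_iff, toZFSet_injective.eq_iff] at h1 h2
        have hy' : y = γ + (ToType.toOrd i).1 := by
          rcases h2 with h2 | h2
          · exact absurd (h2 ▸ hi) (hc.trans hy).not_gt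
          · exact h2
        rcases h1 with h1 | h1
        · rw [h1]; exact hy'
        · exact absurd (h1 ▸ hx) (hc.trans le_self_add).not_gt
    · rintro rfl
      refine ⟨_, (hf _).2 ⟨ToType.mk ⟨x, hx⟩, rfl⟩, {x.toZFSet, (γ + x).toZFSet}, ?_, ?_, ?_⟩ <;>
        simp [pair]
  have hlt : ∀ {x y : Ordinal.{0}}, y.toZFSet ∉ x.toZFSet ↔ x ≤ y := by
    simp [toZFSet_mem_toZFSet_iff]
  refine ⟨f.1, f.2, fun x hx => toZFSet_subset_toZFSet_iff.2 le_self_add hx, ?_, ?_, ?_⟩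
  · intro x hx
    obtain ⟨x, hxc, rfl⟩ := mem_toZFSet_iff.1 hx
    exact ⟨(γ + x).toZFSet, toZFSet_mem_toZFSet_iff.2 ((add_lt_add_iff_left γ).2 hxc),
      hlt.2 le_self_add, (hl x hxc _ le_self_add).2 rfl⟩
  · intro y hy hyγ
    obtain ⟨y, hyc, rfl⟩ := mem_toZFSet_iff.1 hy
    rw [hlt] at hyγ
    obtain ⟨x, rfl⟩ := exists_add_of_le hyγ
    have hx := lt_of_add_lt_add_left hyc
    exact ⟨x.toZFSet, toZFSet_mem_toZFSet_iff.2 hx, (hl x hx _ hyγ).2 rfl⟩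
  · intro x hx x' hx' y hy y' hy' hyγ hyγ' h h'
    obtain ⟨x, hxc, rfl⟩ := mem_toZFSet_iff.1 hx
    obtain ⟨x', hxc', rfl⟩ := mem_toZFSet_iff.1 hx'
    obtain ⟨y, hy, rfl⟩ := mem_toZFSet_iff.1 hy
    obtain ⟨y', hy', rfl⟩ := mem_toZFSet_iff.1 hy'
    rw [hlt] at hyγ hyγ'
    rw [hl x hxc y hyγ] at h
    rw [hl x' hxc' y' hyγ'] at h'
    rw [h, h', toZFSet_mem_toZFSet_iff, toZFSet_mem_toZFSet_iff, add_lt_add_iff_left]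

theorem Definable.reflect {n : ℕ} {P : ZFSet.{0} → (Fin n → ZFSet.{0}) → ZFSet.{0} → Prop}
    (hP : Definable fun M (w : Fin (n + 1) → ZFSet.{0}) =>
      P M (fun i => w i.castSucc) (w (Fin.last n))) {M N κ : ZFSet.{0}} {j : ZFSet.{0} → ZFSet.{0}}
    (hM : M.IsTransitive) (hN : N.IsTransitive) (hj : IsElemEmbedding M N j)
    {v : Fin n → ZFSet.{0}} (hv : ∀ i, v i ∈ M) (i : Fin n) (hκ : κ ∈ j (v i))
    (h : P N (fun i => j (v i)) κ) : ∃ γ ∈ v i, P M v γ :=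
  ((Definable.bex (Definable.var i) hP).transfer hM hN hj hv).2 ⟨κ, hκ, h⟩

theorem omega0_lt_of_isWeaklyCompact {k : Ordinal.{0}}
    (h : IsWeaklyCompactSubset k.toZFSet k.toZFSet) : ω < k := by
  obtain ⟨M, N, j, hM, hN, -, hκ, hj, hcrit, hκj⟩ := h.2 ∅ trivial fun x hx =>
    absurd hx (notMem_empty x)
  have htr := hM.2.2.1
  have hmem : ∀ x ∈ k.toZFSet, x ∈ M := fun x hx => htr _ hκ hx
  have h0 : 0 < k := by
    obtain ⟨γ, hγ, -⟩ := Definable.reflect (P := fun _ _ _ => True) (Definable.const True)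
      htr hN.2.2.1 hj (v := ![k.toZFSet]) (fun i => by fin_cases i; exact hκ) 0 hκj trivial
    obtain ⟨γ, hγk, rfl⟩ := mem_toZFSet_iff.1 hγ
    exact (bot_le (a := γ)).trans_lt hγk
  have hlim : ∀ β < k, ∃ γ < k, β < γ := by
    intro β hβ
    have hβκ : β.toZFSet ∈ k.toZFSet := mem_toZFSet_iff.2 ⟨β, hβ, rfl⟩
    obtain ⟨γ, hγ, h1⟩ := Definable.reflect (P := fun _ v γ => v 1 ∈ γ)
      (Definable.mem (Definable.var _) (Definable.var _))
      htr hN.2.2.1 hj (v := ![k.toZFSet, β.toZFSet])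
      (fun i => by fin_cases i; exacts [hκ, hmem _ hβκ]) 0 hκj
      (by change j β.toZFSet ∈ k.toZFSet; rw [hcrit.1 _ hβκ]; exact hβκ)
    obtain ⟨γ, hγk, rfl⟩ := mem_toZFSet_iff.1 hγ
    exact ⟨γ, hγk, toZFSet_mem_toZFSet_iff.1 h1⟩
  obtain ⟨γ, hγ, ⟨z, hz, -⟩, h2⟩ := Definable.reflect
    (P := fun _ _ γ => (∃ x ∈ γ, True) ∧ ∀ x ∈ γ, ∃ y ∈ γ, x ∈ y)
    (Definable.and (Definable.bex (Definable.var _) (Definable.const True))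
      (Definable.ball (Definable.var _) (Definable.bex (Definable.var _)
        (Definable.mem (Definable.var _) (Definable.var _)))))
    htr hN.2.2.1 hj (v := ![k.toZFSet]) (fun i => by fin_cases i; exact hκ) 0 hκj (by
      refine ⟨⟨toZFSet 0, mem_toZFSet_iff.2 ⟨0, h0, rfl⟩, trivial⟩, fun x hx => ?_⟩
      obtain ⟨β, hβ, rfl⟩ := mem_toZFSet_iff.1 hx
      obtain ⟨γ, hγ, h1⟩ := hlim β hβ
      exact ⟨γ.toZFSet, mem_toZFSet_iff.2 ⟨γ, hγ, rfl⟩, toZFSet_mem_toZFSet_iff.2 h1⟩)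
  obtain ⟨γ, hγk, rfl⟩ := mem_toZFSet_iff.1 hγ
  obtain ⟨z, hzγ, rfl⟩ := mem_toZFSet_iff.1 hz
  refine (omega0_le_of_isSuccLimit ?_).trans_lt hγk
  rw [isSuccLimit_iff]
  refine ⟨((bot_le (a := z)).trans_lt hzγ).ne', ?_⟩
  rw [Order.isSuccPrelimit_iff_succ_lt]
  intro x hx
  obtain ⟨y, hy, hxy⟩ := h2 _ (mem_toZFSet_iff.2 ⟨x, hx, rfl⟩)
  obtain ⟨y, hyγ, rfl⟩ := mem_toZFSet_iff.1 hy
  exact (Order.succ_le_of_lt (toZFSet_mem_toZFSet_iff.1 hxy)).trans_lt hyγ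

/-- `c` lies in the slice of `A` at `γ`, where `A` codes pairs by ordinal sums. -/
def InSlice (M A γ c : ZFSet.{0}) : Prop := ∃ δ ∈ A, ∃ f ∈ M, CodesSum c γ δ f

/-- The slice of `A` at `γ` is unbounded in `γ`. -/
def SliceUnbounded (M A γ : ZFSet.{0}) : Prop :=
  ∀ a ∈ γ, ∃ v ∈ γ, (a ∈ v ∨ a = v) ∧ InSlice M A γ v

/-- `γ` is closed under doubling, as computed in `M`. -/
def DoublingIn (M γ : ZFSet.{0}) : Prop := ∀ a ∈ γ, ∃ v ∈ γ, ∃ f ∈ M, CodesSum a a v f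

section

variable {n : ℕ} {a b c : (Fin n → ZFSet.{0}) → ZFSet.{0}}

theorem definable_inSlice (ha : IsVar a) (hb : IsVar b) (hc : IsVar c) :
    Definable fun M v => InSlice M (a v) (b v) (c v) := by
  obtain ⟨i, rfl⟩ := ha
  obtain ⟨j, rfl⟩ := hb
  obtain ⟨l, rfl⟩ := hc
  unfold InSlice
  apply Definable.bex (Definable.var _)
  apply Definable.ex
  exact definable_codesSum (Definable.var _) (Definable.var _) (Definable.var _) (Definable.var _)

theorem definable_sliceUnbounded (ha : IsVar a) (hb : IsVar b) :
    Definable fun M v => SliceUnbounded M (a v) (b v) := by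
  obtain ⟨i, rfl⟩ := ha
  obtain ⟨j, rfl⟩ := hb
  unfold SliceUnbounded
  repeat' first
    | apply definable_inSlice
    | apply Definable.ball | apply Definable.bex | apply Definable.and | apply Definable.or
    | apply Definable.mem | apply Definable.eq
    | exact Definable.var _

theorem definable_doublingIn (ha : IsVar a) : Definable fun M v => DoublingIn M (a v) := by
  obtain ⟨i, rfl⟩ := ha
  unfold DoublingIn
  apply Definable.ball (Definable.var _)
  apply Definable.bex (Definable.var _)
  apply Definable.ex
  exact definable_codesSum (Definable.var _) (Definable.var _) (Definable.var _) (Definable.var _)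

end

theorem sliceUnbounded_iff {M A : ZFSet.{0}} {γ : Ordinal.{0}} :
    SliceUnbounded M A γ.toZFSet ↔
      ∀ a < γ, ∃ v < γ, a ≤ v ∧ InSlice M A γ.toZFSet v.toZFSet := by
  constructor
  · intro h a ha
    obtain ⟨v, hv, hav, hs⟩ := h _ (toZFSet_mem_toZFSet_iff.2 ha)
    obtain ⟨v, hvγ, rfl⟩ := mem_toZFSet_iff.1 hv
    rw [toZFSet_mem_toZFSet_iff, toZFSet_injective.eq_iff] at hav
    exact ⟨v, hvγ, hav.elim le_of_lt le_of_eq, hs⟩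
  · intro h a ha
    obtain ⟨a, haγ, rfl⟩ := mem_toZFSet_iff.1 ha
    obtain ⟨v, hv, hav, hs⟩ := h a haγ
    refine ⟨v.toZFSet, toZFSet_mem_toZFSet_iff.2 hv, ?_, hs⟩
    rw [toZFSet_mem_toZFSet_iff, toZFSet_injective.eq_iff]
    exact hav.lt_or_eq

/-- The set of sums `γ + c` with `c < γ`, `c ∈ A γ` and `γ` closed under doubling. -/
noncomputable def sumCode (k : Ordinal.{0}) (A : Ordinal.{0} → Set Ordinal.{0}) : ZFSet.{0} :=
  ZFSet.sep (fun x => ∃ γ < k, ∃ c < γ, (∀ a < γ, a + a < γ) ∧ c ∈ A γ ∧ x = (γ + c).toZFSet)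
    k.toZFSet

theorem inSlice_sumCode {k : Ordinal.{0}} {A : Ordinal.{0} → Set Ordinal.{0}} {M : ZFSet.{0}}
    (hM : IsKappaModel k.toZFSet M) {γ c : Ordinal.{0}} (hγ : ∀ a < γ, a + a < γ) (hc : c < γ)
    (hγk : γ + γ < k) : InSlice M (sumCode k A) γ.toZFSet c.toZFSet ↔ c ∈ A γ := by
  have hlt : γ + c < k := ((add_lt_add_iff_left γ).2 hc).trans hγk
  constructor
  · rintro ⟨δ, hδ, f, -, hf⟩
    obtain ⟨-, γ', -, c', hc', hd, hA, rfl⟩ := mem_sep.1 hδ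
    have h1 := hf.eq_add
    obtain h2 | rfl | h2 := lt_trichotomy γ' γ
    · refine absurd h1 (ne_of_lt ?_)
      exact ((add_lt_add_iff_left _).2 hc').trans ((hγ _ h2).trans_le le_self_add)
    · rwa [← add_left_cancel h1]
    · refine absurd h1 (ne_of_gt ?_)
      exact ((add_lt_add_iff_left _).2 hc).trans ((hd _ h2).trans_le le_self_add)
  · intro hA
    obtain ⟨f, hf, hs⟩ := exists_codesSum hM hc.le hlt
    exact ⟨_, mem_sep.2 ⟨toZFSet_mem_toZFSet_iff.2 hlt, γ, le_self_add.trans_lt hγk, c, hc, hγ, hA,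
      rfl⟩, f, hf, hs⟩

theorem DoublingIn.add_lt {M : ZFSet.{0}} {γ : Ordinal.{0}} (h : DoublingIn M γ.toZFSet)
    {a : Ordinal.{0}} (ha : a < γ) : a + a < γ := by
  obtain ⟨v, hv, f, -, hf⟩ := h _ (toZFSet_mem_toZFSet_iff.2 ha)
  obtain ⟨v, hvγ, rfl⟩ := mem_toZFSet_iff.1 hv
  rwa [← hf.eq_add]

theorem normalGuess_of_isWeaklyCompact {k : Ordinal.{0}} {S : ZFSet.{0}} (hk : k.card.ord = k)
    (hω : ω < k) (h : IsWeaklyCompactSubset k.toZFSet S) :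
    NormalGuess k {γ | γ.toZFSet ∈ S} := by
  intro A
  have hadd : ∀ a < k, a + a < k := fun a ha => by
    have hc : ℵ₀ ≤ k.card := by
      rw [← ord_le_ord, hk, ord_aleph0]
      exact hω.le
    have := isPrincipal_add_ord hc
    rw [hk] at this
    exact this ha ha
  obtain ⟨M, N, j, hM, hN, hA, hS, hj, hcrit, hκ⟩ := h.2 (sumCode k A) trivial fun x hx =>
    (mem_sep.1 hx).1
  have hmem : ∀ x ∈ k.toZFSet, x ∈ M := fun x hx => hM.2.2.1 _ hM.2.1 hx
  let X : Set Ordinal.{0} := {c | InSlice N (j (sumCode k A)) k.toZFSet c.toZFSet}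
  let X' : ZFSet.{0} :=
    ZFSet.sep (fun c => InSlice N (j (sumCode k A)) k.toZFSet c) k.toZFSet
  refine ⟨X, fun β hβ => ?_⟩
  have hβκ : β.toZFSet ∈ k.toZFSet := toZFSet_mem_toZFSet_iff.2 hβ
  let g : ZFSet.{0} := X' ∩ β.toZFSet
  have hg : g ∈ M := inter_mem_kappaModel hM hβ X'
  have hcg : ∀ c < β, c.toZFSet ∈ g ↔ c ∈ X := by
    intro c hc
    simp only [g, X', X, mem_inter, mem_sep, toZFSet_mem_toZFSet_iff, Set.mem_ofPred_eq]
    exact ⟨fun h => h.1.2, fun h => ⟨⟨hc.trans hβ, h⟩, hc⟩⟩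
  let v : Fin 4 → ZFSet.{0} := ![S, sumCode k A, β.toZFSet, g]
  have hv : ∀ i, v i ∈ M := by
    intro i
    fin_cases i
    exacts [hS, hA, hmem _ hβκ, hg]
  obtain ⟨γ, hγ, h1, h2, h3, h4⟩ := Definable.reflect
    (P := fun M w γ => w 2 ∈ γ ∧ DoublingIn M γ ∧ (∀ c ∈ w 2, c ∈ w 3 ↔ InSlice M (w 1) γ c) ∧
      (SliceUnbounded M (w 1) γ ↔ SliceUnbounded N (j (sumCode k A)) k.toZFSet))
    (by
      repeat' first
        | exact Definable.const _
        | apply definable_inSlice | apply definable_sliceUnbounded | apply definable_doublingIn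
        | apply Definable.and | apply Definable.ball | apply Definable.iff
        | apply Definable.mem
        | exact Definable.var _)
    hM.2.2.1 hN.2.2.1 hj hv 0 hκ (by
      have hjβ : j β.toZFSet = β.toZFSet := hcrit.1 _ hβκ
      refine ⟨?_, ?_, ?_, Iff.rfl⟩
      · change j β.toZFSet ∈ _
        rwa [hjβ]
      · intro a ha
        obtain ⟨a, hak, rfl⟩ := mem_toZFSet_iff.1 ha
        exact ⟨_, toZFSet_mem_toZFSet_iff.2 (hadd a hak), exists_codesSum hN le_rfl (hadd a hak)⟩
      · change ∀ c ∈ j β.toZFSet, c ∈ j g ↔ InSlice N (j (sumCode k A)) k.toZFSet c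
        rw [hjβ]
        intro c hc
        obtain ⟨c, hcβ, rfl⟩ := mem_toZFSet_iff.1 hc
        have hck := toZFSet_mem_toZFSet_iff.2 (hcβ.trans hβ)
        have ht := (Definable.mem (Definable.var 0) (Definable.var 1)).transfer hM.2.2.1 hN.2.2.1 hj
          (v := ![c.toZFSet, g]) (fun i => by fin_cases i; exacts [hmem _ hck, hg])
        have ht' : c.toZFSet ∈ g ↔ j c.toZFSet ∈ j g := ht
        rw [hcrit.1 _ hck] at ht'
        rw [← ht']
        exact hcg c hcβ)
  have hγS : γ ∈ S := hγ
  obtain ⟨γ, hγk, rfl⟩ := mem_toZFSet_iff.1 (h.1 hγS)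
  have h3' : ∀ c ∈ β.toZFSet, c ∈ g ↔ InSlice M (sumCode k A) γ.toZFSet c := h3
  have h4' : SliceUnbounded M (sumCode k A) γ.toZFSet ↔ _ := h4
  have hβγ : β < γ := toZFSet_mem_toZFSet_iff.1 h1
  have hdec : ∀ c < γ, InSlice M (sumCode k A) γ.toZFSet c.toZFSet ↔ c ∈ A γ := fun c hc =>
    inSlice_sumCode hM (fun a ha => h2.add_lt ha) hc (hadd γ hγk)
  refine ⟨γ, hγk, hγS, hβγ, fun c hc => ?_, ?_⟩
  · rw [← hdec c (hc.trans hβγ), ← h3' _ (toZFSet_mem_toZFSet_iff.2 hc), hcg c hc]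
  · rw [sliceUnbounded_iff, sliceUnbounded_iff] at h4'
    refine Iff.trans ?_ h4'
    refine forall₂_congr fun a _ => exists_congr fun v => and_congr_right fun hv => ?_
    rw [hdec v hv]

/-! ## Translation between sets and ordinals -/

theorem mk_ofNat (n : ℕ) : ZFSet.mk (PSet.ofNat.{0} n) = toZFSet (n : Ordinal.{0}) := by
  induction n with
  | zero => simp [PSet.ofNat]; rfl
  | succ n ih =>
    rw [Nat.cast_succ, toZFSet_add_one, ← ih]
    rfl

theorem omega_eq : ZFSet.omega.{0} = toZFSet ω := by
  ext x
  rw [mem_toZFSet_iff]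
  constructor
  · intro hx
    induction x using Quotient.inductionOn with
    | _ x =>
    obtain ⟨n, hn⟩ := hx
    refine ⟨n.down, natCast_lt_omega0 _, ?_⟩
    rw [← mk_ofNat]
    exact (Quotient.sound hn).symm
  · rintro ⟨a, ha, rfl⟩
    obtain ⟨n, rfl⟩ := lt_omega0.1 ha
    rw [← mk_ofNat]
    exact ⟨⟨n⟩, PSet.Equiv.refl _⟩

theorem isCardinalZ_iff {γ : Ordinal.{0}} : IsCardinalZ γ.toZFSet ↔ γ.card.ord = γ := by
  constructor
  · rintro ⟨-, h⟩
    refine le_antisymm (ord_card_le γ) (not_lt.1 fun hlt => ?_)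
    have := h _ (toZFSet_mem_toZFSet_iff.2 hlt)
    rw [zcard_toZFSet, zcard_toZFSet, card_ord] at this
    exact lt_irrefl _ this
  · intro h
    refine ⟨isOrdinal_toZFSet γ, fun β hβ => ?_⟩
    obtain ⟨β, hβγ, rfl⟩ := mem_toZFSet_iff.1 hβ
    rw [zcard_toZFSet, zcard_toZFSet, Cardinal.lift_lt]
    exact card_lt_of_lt h hβγ

theorem power_le_of_powLtEqSelf {k : Ordinal.{0}} (hk : k.card.ord = k)
    (h : PowLtEqSelf k.toZFSet) : ∀ μ < k.card, k.card ^ μ ≤ k.card := by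
  intro μ hμ
  have := h μ.ord.toZFSet (toZFSet_mem_toZFSet_iff.2 (by rw [← hk]; exact ord_lt_ord.2 hμ))
  rw [zcard_toZFSet, zcard_toZFSet, card_ord, ← Cardinal.lift_power, Cardinal.lift_le] at this
  exact this

theorem isFunc_toOrd {β : Ordinal.{0}} {F : Ordinal.{0} → ZFSet.{0}} {Y : ZFSet.{0}}
    (hF : ∀ α < β, F α ∈ Y) :
    ∃ f, IsFunc β.toZFSet Y f ∧ ∀ x y, pair x y ∈ f ↔ ∃ α < β, x = α.toZFSet ∧ y = F α := by
  obtain ⟨f, hf⟩ := exists_seq_function β fun i => F (ToType.toOrd i).1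
  refine ⟨f, isFunc_of_mem_iff hf fun i => hF _ (ToType.toOrd i).2, fun x y => ?_⟩
  rw [hf]
  constructor
  · rintro ⟨i, hi⟩
    obtain ⟨rfl, rfl⟩ := pair_inj.1 hi
    exact ⟨_, (ToType.toOrd i).2, rfl, rfl⟩
  · rintro ⟨α, hα, rfl, rfl⟩
    exact ⟨ToType.mk ⟨α, hα⟩, by simp⟩

theorem exists_isFunc_injective {γ β : Ordinal.{0}} (h : γ.card ≤ 2 ^ β.card) :
    ∃ f, IsFunc γ.toZFSet (powerset β.toZFSet) f ∧
      ∀ x x' y, pair x y ∈ f → pair x' y ∈ f → x = x' := by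
  rw [← mk_toType γ, ← mk_toType β, ← mk_set] at h
  obtain ⟨e⟩ := Cardinal.le_def _ _ |>.1 h
  obtain ⟨f, hf, hf'⟩ := isFunc_toOrd (β := γ) (Y := powerset β.toZFSet)
    (F := fun α => if hα : α < γ then
      ZFSet.sep (fun x => ∃ i ∈ e (ToType.mk ⟨α, hα⟩), x = toZFSet (ToType.toOrd i).1) β.toZFSet
      else ∅) (fun α hα => by
        rw [mem_powerset, dif_pos hα]
        exact fun x hx => (mem_sep.1 hx).1)
  refine ⟨f, hf, fun x x' y hx hx' => ?_⟩
  obtain ⟨α, hα, rfl, rfl⟩ := (hf' _ _).1 hx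
  obtain ⟨α', hα', rfl, h2⟩ := (hf' _ _).1 hx'
  rw [dif_pos hα, dif_pos hα'] at h2
  have h3 : ∀ (ε : Set β.ToType) (i : β.ToType), i ∈ ε ↔ toZFSet (ToType.toOrd i).1 ∈
      ZFSet.sep (fun x => ∃ i ∈ ε, x = toZFSet (ToType.toOrd i).1) β.toZFSet := by
    intro ε i
    rw [mem_sep]
    refine ⟨fun hi => ⟨toZFSet_mem_toZFSet_iff.2 (ToType.toOrd i).2, i, hi, rfl⟩, ?_⟩
    rintro ⟨-, i', hi', he⟩
    have := ToType.mk.symm.injective (Subtype.ext (toZFSet_injective he))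
    rwa [this]
  have h4 : e (ToType.mk ⟨α, hα⟩) = e (ToType.mk ⟨α', hα'⟩) := by
    ext i
    rw [h3, h2, ← h3]
  exact congrArg (fun x : Set.Iio γ => toZFSet x.1) (ToType.mk.injective (e.injective h4))

theorem card_le_of_isFunc_injective {γ β : Ordinal.{0}} {f : ZFSet.{0}}
    (hf : IsFunc γ.toZFSet (powerset β.toZFSet) f)
    (hinj : ∀ x x' y, pair x y ∈ f → pair x' y ∈ f → x = x') : γ.card ≤ 2 ^ β.card := by
  obtain ⟨a, ha, hfa⟩ := exists_seq_of_isFunc hf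
  rw [← mk_toType γ, ← mk_toType β, ← mk_set]
  refine mk_le_of_injective
    (f := fun i => {l : β.ToType | toZFSet (ToType.toOrd l).1 ∈ a i}) fun i i' hii => ?_
  have h1 : a i = a i' := by
    ext x
    have h2 : ∀ i, x ∈ a i → ∃ l : β.ToType, x = toZFSet (ToType.toOrd l).1 := by
      intro i hx
      obtain ⟨ξ, hξ, rfl⟩ := mem_toZFSet_iff.1 (mem_powerset.1 (ha i) hx)
      exact ⟨ToType.mk ⟨ξ, hξ⟩, by simp⟩
    constructor
    · intro hx
      obtain ⟨l, rfl⟩ := h2 _ hx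
      exact (Set.ext_iff.1 hii l).1 hx
    · intro hx
      obtain ⟨l, rfl⟩ := h2 _ hx
      exact (Set.ext_iff.1 hii l).2 hx
  have h2 := hinj _ _ (a i) ((hfa _).2 ⟨i, rfl⟩) (by rw [h1]; exact (hfa _).2 ⟨i', rfl⟩)
  exact ToType.mk.symm.injective (Subtype.ext (toZFSet_injective h2))

theorem isInaccessibleIn_iff {γ : Ordinal.{0}} :
    IsInaccessibleIn Set.univ γ.toZFSet ↔ IsInaccOrd γ := by
  constructor
  · rintro ⟨⟨hc, hreg⟩, hω, hpow⟩
    rw [isCardinalZ_iff] at hc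
    rw [omega_eq, toZFSet_mem_toZFSet_iff] at hω
    have hω' : ℵ₀ < γ.card := by rwa [← ord_lt_ord, hc, ord_aleph0]
    have hr : γ.card.IsRegular := by
      by_contra hn
      obtain ⟨β, hβ, F, hF, hcof⟩ := exists_cofinal_map_of_not_regular hc hω.le hn
      obtain ⟨f, hf, hf'⟩ := isFunc_toOrd (F := fun α => (F α).toZFSet) (Y := γ.toZFSet)
        fun α hα => toZFSet_mem_toZFSet_iff.2 (hF α hα)
      obtain ⟨δ, hδ, hb⟩ := hreg _ (toZFSet_mem_toZFSet_iff.2 hβ) f trivial hf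
      obtain ⟨δ, hδγ, rfl⟩ := mem_toZFSet_iff.1 hδ
      obtain ⟨α, hα, hle⟩ := hcof δ hδγ
      have := hb _ (toZFSet_mem_toZFSet_iff.2 hα) _ ((hf' _ _).2 ⟨α, hα, rfl, rfl⟩)
      exact hle.not_gt (toZFSet_mem_toZFSet_iff.1 this)
    refine ⟨hc, hω', ?_, ?_⟩
    · exact hr.2
    · intro x hx
      by_contra! hle
      have hx' : x.ord < γ := by rw [← hc]; exact ord_lt_ord.2 hx
      obtain ⟨f, hf, hinj⟩ := exists_isFunc_injective (γ := γ) (β := x.ord) (by rwa [card_ord])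
      exact hpow _ (toZFSet_mem_toZFSet_iff.2 hx') ⟨f, trivial, hf, hinj⟩
  · intro h
    refine ⟨⟨isCardinalZ_iff.2 h.1, fun β hβ f _ hf => ?_⟩, ?_, ?_⟩
    · obtain ⟨β, hβγ, rfl⟩ := mem_toZFSet_iff.1 hβ
      obtain ⟨a, ha, hfa⟩ := exists_seq_of_isFunc hf
      choose b hb hba using fun i => mem_toZFSet_iff.1 (ha i)
      obtain ⟨δ, hδ, hbd⟩ := h.isRegOrd.exists_bound
        (by simpa using card_lt_of_lt h.1 hβγ) b hb
      refine ⟨_, toZFSet_mem_toZFSet_iff.2 hδ, fun ξ _ y hy => ?_⟩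
      obtain ⟨i, hi⟩ := (hfa _).1 hy
      obtain ⟨-, rfl⟩ := pair_inj.1 hi
      rw [← hba]
      exact toZFSet_mem_toZFSet_iff.2 (hbd i)
    · rw [omega_eq, toZFSet_mem_toZFSet_iff]
      exact h.omega0_lt
    · rintro β hβ ⟨f, -, hf, hinj⟩
      obtain ⟨β, hβγ, rfl⟩ := mem_toZFSet_iff.1 hβ
      exact (card_le_of_isFunc_injective hf hinj).not_gt
        (h.2.isStrongPrelimit (card_lt_of_lt h.1 hβγ))

/-- The ordinals whose von Neumann representative lies in `C`. -/
def ordSet (C : ZFSet.{0}) : Set Ordinal.{0} := {γ | γ.toZFSet ∈ C}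

theorem isClubIn_iff {C : ZFSet.{0}} {γ : Ordinal.{0}} :
    IsClubIn C γ.toZFSet ↔ C ⊆ γ.toZFSet ∧ IsClubOrd (ordSet C) γ := by
  refine and_congr_right fun hC => ?_
  have hmem : ∀ {β : Ordinal.{0}}, (∀ ξ < β, ∃ η ∈ ordSet C, η < β ∧ ξ < η) ↔
      ∀ ξ ∈ β.toZFSet, ∃ η, η ∈ C ∧ η ∈ β.toZFSet ∧ ξ ∈ η := by
    intro β
    constructor
    · intro h ξ hξ
      obtain ⟨ξ, hξβ, rfl⟩ := mem_toZFSet_iff.1 hξ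
      obtain ⟨η, hη, hηβ, hlt⟩ := h ξ hξβ
      exact ⟨_, hη, toZFSet_mem_toZFSet_iff.2 hηβ, toZFSet_mem_toZFSet_iff.2 hlt⟩
    · intro h ξ hξ
      obtain ⟨η, hη, hηβ, hlt⟩ := h _ (toZFSet_mem_toZFSet_iff.2 hξ)
      obtain ⟨η, hηβ', rfl⟩ := mem_toZFSet_iff.1 hηβ
      exact ⟨η, hη, hηβ', toZFSet_mem_toZFSet_iff.1 hlt⟩
  refine and_congr ?_ ?_
  · constructor
    · intro h ξ hξ
      obtain ⟨η, hη, hle⟩ := h _ (toZFSet_mem_toZFSet_iff.2 hξ)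
      obtain ⟨η, hηγ, rfl⟩ := mem_toZFSet_iff.1 (hC hη)
      rw [toZFSet_mem_toZFSet_iff, toZFSet_injective.eq_iff] at hle
      exact ⟨η, hη, hηγ, hle.elim le_of_lt le_of_eq⟩
    · intro h ξ hξ
      obtain ⟨ξ, hξγ, rfl⟩ := mem_toZFSet_iff.1 hξ
      obtain ⟨η, hη, -, hle⟩ := h ξ hξγ
      refine ⟨η.toZFSet, hη, ?_⟩
      rw [toZFSet_mem_toZFSet_iff, toZFSet_injective.eq_iff]
      exact hle.lt_or_eq
  · constructor
    · intro h β hβ h0 hlim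
      exact h _ (toZFSet_mem_toZFSet_iff.2 hβ) ⟨_, toZFSet_mem_toZFSet_iff.2 h0⟩ (hmem.1 hlim)
    · rintro h β hβ ⟨z, hz⟩ hlim
      obtain ⟨β, hβγ, rfl⟩ := mem_toZFSet_iff.1 hβ
      obtain ⟨z, hzβ, rfl⟩ := mem_toZFSet_iff.1 hz
      exact h β hβγ ((bot_le (a := z)).trans_lt hzβ) (hmem.2 hlim)

theorem IsClubOrd.congr {C D : Set Ordinal.{0}} {γ : Ordinal.{0}} (h : ∀ x < γ, x ∈ C ↔ x ∈ D)
    (hC : IsClubOrd C γ) : IsClubOrd D γ := by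
  refine ⟨fun ξ hξ => ?_, fun β hβ h0 hlim => (h β hβ).1 (hC.2 β hβ h0 fun ξ hξ => ?_)⟩
  · obtain ⟨η, hη, hηγ, hle⟩ := hC.1 ξ hξ
    exact ⟨η, (h η hηγ).1 hη, hηγ, hle⟩
  · obtain ⟨η, hη, hηβ, hlt⟩ := hlim ξ hξ
    exact ⟨η, (h η (hηβ.trans hβ)).2 hη, hηβ, hlt⟩

theorem exists_ordSet (D : Set Ordinal.{0}) (γ : Ordinal.{0}) :
    ∃ C ⊆ γ.toZFSet, ∀ x < γ, x ∈ D ↔ x ∈ ordSet C := by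
  refine ⟨ZFSet.sep (fun x => ∃ a ∈ D, x = a.toZFSet) γ.toZFSet, fun x hx => (mem_sep.1 hx).1,
    fun x hx => ?_⟩
  simp [ordSet, toZFSet_injective.eq_iff, toZFSet_mem_toZFSet_iff, hx]

theorem isStationaryIn_iff {S : ZFSet.{0}} {γ : Ordinal.{0}} :
    IsStationaryIn Set.univ S γ.toZFSet ↔ IsStationaryOrd (ordSet S) γ := by
  constructor
  · intro h D hD
    obtain ⟨C, hC, hDC⟩ := exists_ordSet D γ
    obtain ⟨x, hxS, hxC⟩ := h C trivial (isClubIn_iff.2 ⟨hC, hD.congr hDC⟩)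
    obtain ⟨x, hx, rfl⟩ := mem_toZFSet_iff.1 (hC hxC)
    exact ⟨x, hx, hxS, (hDC x hx).2 hxC⟩
  · intro h C _ hC
    obtain ⟨x, -, hxS, hxC⟩ := h _ (isClubIn_iff.1 hC).2
    exact ⟨x.toZFSet, hxS, hxC⟩

theorem IsStationaryOrd.congr {S T : Set Ordinal.{0}} {γ : Ordinal.{0}}
    (h : ∀ x < γ, x ∈ S ↔ x ∈ T) : IsStationaryOrd S γ ↔ IsStationaryOrd T γ :=
  forall₂_congr fun _ _ => exists_congr fun x => and_congr_right fun hx =>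
    and_congr_left fun _ => h x hx

theorem isOneClubIn_iff {C : ZFSet.{0}} {k : Ordinal.{0}} :
    IsOneClubIn Set.univ C k.toZFSet ↔ IsOneClubOrd (ordSet C) k := by
  refine and_congr isStationaryIn_iff ?_
  have hrestr : ∀ γ : Ordinal.{0}, IsStationaryOrd (ordSet (C ∩ γ.toZFSet)) γ ↔
      IsStationaryOrd (ordSet C) γ := fun γ => IsStationaryOrd.congr fun x hx => by
    simp [ordSet, toZFSet_mem_toZFSet_iff, hx]
  constructor
  · intro h γ hγ hi hs
    exact h _ (toZFSet_mem_toZFSet_iff.2 hγ) (isInaccessibleIn_iff.2 hi)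
      (isStationaryIn_iff.2 ((hrestr γ).2 hs))
  · intro h γ hγ hi hs
    obtain ⟨γ, hγk, rfl⟩ := mem_toZFSet_iff.1 hγ
    exact h γ hγk (isInaccessibleIn_iff.1 hi) ((hrestr γ).1 (isStationaryIn_iff.1 hs))

theorem IsOneClubOrd.congr {C D : Set Ordinal.{0}} {k : Ordinal.{0}}
    (h : ∀ x < k, x ∈ C ↔ x ∈ D) (hC : IsOneClubOrd C k) : IsOneClubOrd D k :=
  ⟨(IsStationaryOrd.congr h).1 hC.1, fun γ hγ hi hs => (h γ hγ).1
    (hC.2 γ hγ hi ((IsStationaryOrd.congr fun x hx => h x (hx.trans hγ)).2 hs))⟩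

theorem meets_oneClub_iff {k : Ordinal.{0}} {S : ZFSet.{0}} (hS : S ⊆ k.toZFSet) :
    (∀ C, IsOneClubIn Set.univ C k.toZFSet → S ∩ C ≠ ∅) ↔
      ∀ C, IsOneClubOrd C k → ∃ γ < k, γ ∈ ordSet S ∧ γ ∈ C := by
  constructor
  · intro h D hD
    obtain ⟨C, -, hDC⟩ := exists_ordSet D k
    obtain ⟨x, hx⟩ := (nonempty_def _).1
      ((eq_empty_or_nonempty _).resolve_left (h C (isOneClubIn_iff.2 (hD.congr hDC))))
    obtain ⟨hxS, hxC⟩ := mem_inter.1 hx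
    obtain ⟨γ, hγ, rfl⟩ := mem_toZFSet_iff.1 (hS hxS)
    exact ⟨γ, hγ, hxS, (hDC γ hγ).2 hxC⟩
  · intro h C hC
    obtain ⟨γ, -, hγS, hγC⟩ := h _ (isOneClubIn_iff.1 hC)
    have hmem : γ.toZFSet ∈ S ∩ C := mem_inter.2 ⟨hγS, hγC⟩
    exact fun he => notMem_empty _ (he ▸ hmem)

theorem RegressiveGuess.mono {k : Ordinal.{0}} {S T : Set Ordinal.{0}} (h : RegressiveGuess k S)
    (hST : S ⊆ T) : RegressiveGuess k T := by
  intro F hF g hg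
  obtain ⟨V, hV⟩ := h F hF g hg
  refine ⟨V, fun β hβ => ?_⟩
  obtain ⟨γ, h1, h2, h3⟩ := hV β hβ
  exact ⟨γ, h1, hST h2, h3⟩

end SunChar

open SunChar in
/-- **Sun.** For a weakly compact cardinal `κ` and `S ⊆ κ`: `S` is a weakly
compact subset of `κ` iff `S` meets every 1-club subset of `κ`. -/
theorem weaklyCompact_iff_meets_every_oneClub (κ S : ZFSet)
    (hκ : IsWCCardinal κ) (hS : S ⊆ κ) :
    IsWeaklyCompactSubset κ S ↔
      ∀ C : ZFSet, IsOneClubIn Set.univ C κ → S ∩ C ≠ ∅ := by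
  obtain ⟨k, rfl⟩ : ∃ k : Ordinal.{0}, κ = k.toZFSet := ⟨_, hκ.1.1.toZFSet_rank_eq.symm⟩
  have hk := isCardinalZ_iff.1 hκ.1
  have hpow := power_le_of_powLtEqSelf hk hκ.2.1
  have hω := omega0_lt_of_isWeaklyCompact hκ.2.2
  have hguess := normalGuess_of_isWeaklyCompact hk hω hκ.2.2
  have hi := hguess.isInaccOrd hk hω
  have hreg := hguess.regressiveGuess hi hpow
  rw [meets_oneClub_iff hS]
  constructor
  · intro h C hC
    exact ((normalGuess_of_isWeaklyCompact hk hω h).regressiveGuess hi hpow).exists_mem_oneClub hi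
      hC
  · intro h
    have hSreg := (hreg.mono (Set.subset_univ _)).of_meets_oneClub hi h
    refine ⟨hS, fun A _ hA => ?_⟩
    obtain ⟨M₀, -, -, hM₀, -, -, hκM₀, -⟩ := hκ.2.2.2 ∅ trivial fun x hx =>
      absurd hx (ZFSet.notMem_empty x)
    obtain ⟨M, -, hM, -, -, -, hAM, hSM⟩ := exists_embedding hi hpow hreg hM₀ hκM₀ hA hS
    obtain ⟨N, j, hN, hj, hcrit, hκj, -, -⟩ := exists_embedding hi hpow hSreg hM hSM hA hA
    exact ⟨M, N, j, hM, hN, hAM, hSM, hj, hcrit, hκj⟩
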